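/- Let n ≥ 1, 0 ≤ ρ ≤ 1 and 1 < p < ∞, and set m_p = n(1−ρ)|1/p − 1/2|. Let σ₁ : ℝⁿ → ℂ be a smooth symbol for which there is C > 0 such that |∂_ξ^α σ₁(ξ)| ≤ C ⟨ξ⟩^{−m_p − ρ|α|} for all ξ ∈ ℝⁿ and all multi-indices α with |α| ≤ [n/2]+1. Then the periodic Fourier multiplier σ(D) with symbol σ(ξ) = σ₁(ξ) for ξ ∈ ℤⁿ is a bounded operator on L^p(𝕋ⁿ). -/

import Mathlib

open MeasureTheory Real ENNReal

noncomputable section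

/-- Partial derivative of a complex-valued function on `ℝⁿ` in the `j`-th coordinate
direction. -/
def pd {n : ℕ} (j : Fin n) (f : (Fin n → ℝ) → ℂ) : (Fin n → ℝ) → ℂ :=
  fun x => fderiv ℝ f x (Pi.single j 1)

/-- The canonical list of directions associated to a multi-index `β ∈ ℕⁿ`. -/
def mIdxList {n : ℕ} (β : Fin n → ℕ) : List (Fin n) :=
  (List.finRange n).flatMap fun j => List.replicate (β j) j

/-- Iterated partial derivative `∂^β` associated to a multi-index `β`. -/
def pdM {n : ℕ} (β : Fin n → ℕ) (f : (Fin n → ℝ) → ℂ) : (Fin n → ℝ) → ℂ :=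
  (mIdxList β).foldr pd f

/-- Forward difference operator in the `j`-th direction on functions of `ξ ∈ ℤⁿ`. -/
def dd {n : ℕ} (j : Fin n) (g : (Fin n → ℤ) → ℂ) : (Fin n → ℤ) → ℂ :=
  fun ξ => g (ξ + Pi.single j 1) - g ξ

/-- Iterated difference operator `Δ_ξ^α` associated to a multi-index `α`. -/
def ddM {n : ℕ} (α : Fin n → ℕ) (g : (Fin n → ℤ) → ℂ) : (Fin n → ℤ) → ℂ :=
  (mIdxList α).foldr dd g

/-- Japanese bracket `⟨ξ⟩ = (1+|ξ|²)^{1/2}` of a lattice point `ξ ∈ ℤⁿ`. -/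
def jb {n : ℕ} (ξ : Fin n → ℤ) : ℝ := Real.sqrt (1 + ∑ j, ((ξ j : ℝ)) ^ 2)

/-- Japanese bracket `⟨ξ⟩ = (1+|ξ|²)^{1/2}` of a vector `ξ ∈ ℝⁿ`. -/
def jbR {n : ℕ} (ξ : Fin n → ℝ) : ℝ := Real.sqrt (1 + ∑ j, (ξ j) ^ 2)

/-- The canonical embedding `ℤⁿ → ℝⁿ`. -/
def castZ {n : ℕ} (ξ : Fin n → ℤ) : Fin n → ℝ := fun j => (ξ j : ℝ)

/-- The fundamental domain `[0,1)ⁿ` of the torus `𝕋ⁿ = ℝⁿ/ℤⁿ`. -/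
def cube (n : ℕ) : Set (Fin n → ℝ) := Set.univ.pi fun _ => Set.Ico (0 : ℝ) 1

/-- The normalized Lebesgue measure of the torus `𝕋ⁿ`, realized as the Lebesgue measure
on `ℝⁿ` restricted to the fundamental domain `[0,1)ⁿ`. -/
def μT (n : ℕ) : Measure (Fin n → ℝ) := volume.restrict (cube n)

/-- `1`-periodicity of a function on `ℝⁿ` (i.e. the function descends to `𝕋ⁿ`). -/
def Per {n : ℕ} (f : (Fin n → ℝ) → ℂ) : Prop :=
  ∀ (x : Fin n → ℝ) (v : Fin n → ℤ), f (x + fun j => (v j : ℝ)) = f x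

/-- The character `e^{2πi⟨x,ξ⟩}`. -/
def eChar {n : ℕ} (x : Fin n → ℝ) (ξ : Fin n → ℤ) : ℂ :=
  Complex.exp (2 * (π : ℂ) * Complex.I * ∑ j, (x j : ℂ) * (ξ j : ℂ))

/-- Fourier coefficient `f̂(ξ) = ∫_{𝕋ⁿ} e^{-2πi⟨x,ξ⟩} f(x) dx` of a function on `𝕋ⁿ`. -/
def fc {n : ℕ} (f : (Fin n → ℝ) → ℂ) (ξ : Fin n → ℤ) : ℂ :=
  ∫ x, Complex.exp (-(2 * (π : ℂ) * Complex.I) * ∑ j, (x j : ℂ) * (ξ j : ℂ)) * f x ∂(μT n)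

/-- Periodic pseudo-differential operator
    `σ(x,D)f(x) = Σ_{ξ ∈ ℤⁿ} e^{2πi⟨x,ξ⟩} σ(x,ξ) f̂(ξ)`
with symbol `σ` on `𝕋ⁿ × ℤⁿ`. -/
def Op {n : ℕ} (σ : (Fin n → ℝ) → (Fin n → ℤ) → ℂ) (f : (Fin n → ℝ) → ℂ) :
    (Fin n → ℝ) → ℂ :=
  fun x => ∑' ξ : Fin n → ℤ, eChar x ξ * σ x ξ * fc f ξ

/-- The `L^p(𝕋ⁿ)` norm, for a real exponent `p`. -/
def lpT (n : ℕ) (p : ℝ) (g : (Fin n → ℝ) → ℂ) : ℝ :=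
  (∫ x, ‖g x‖ ^ p ∂(μT n)) ^ (1 / p)

/-- `∂_x^β Δ_ξ^α σ(x,ξ)` for a symbol `σ` on `𝕋ⁿ × ℤⁿ` (difference operator applied first,
then the derivatives in `x`). -/
def symbDxD {n : ℕ} (β α : Fin n → ℕ) (σ : (Fin n → ℝ) → (Fin n → ℤ) → ℂ)
    (x : Fin n → ℝ) (ξ : Fin n → ℤ) : ℂ :=
  pdM β (fun x' => ddM α (σ x') ξ) x

/-- `Δ_ξ^α ∂_x^β σ(x,ξ)` for a symbol `σ` on `𝕋ⁿ × ℤⁿ` (derivatives in `x` applied first,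
then the difference operator in `ξ`). -/
def symbDDx {n : ℕ} (α β : Fin n → ℕ) (σ : (Fin n → ℝ) → (Fin n → ℤ) → ℂ)
    (x : Fin n → ℝ) (ξ : Fin n → ℤ) : ℂ :=
  ddM α (fun ξ' => pdM β (fun x' => σ x' ξ') x) ξ

/-- `∂_ξ^α ∂_x^β σ(x,ξ)` for a symbol `σ` on `𝕋ⁿ × ℝⁿ` (derivatives in `x` applied first,
then the derivatives in `ξ`). -/
def symbDξDx {n : ℕ} (α β : Fin n → ℕ) (σ : (Fin n → ℝ) → (Fin n → ℝ) → ℂ)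
    (x ξ : Fin n → ℝ) : ℂ :=
  pdM α (fun ξ' => pdM β (fun x' => σ x' ξ') x) ξ

/-- `∂_x^β ∂_ξ^α σ(x,ξ)` for a symbol `σ` on `𝕋ⁿ × ℝⁿ` (derivatives in `ξ` applied first,
then the derivatives in `x`). -/
def symbDxDξ {n : ℕ} (β α : Fin n → ℕ) (σ : (Fin n → ℝ) → (Fin n → ℝ) → ℂ)
    (x ξ : Fin n → ℝ) : ℂ :=
  pdM β (fun x' => pdM α (σ x') ξ) x

/-- The Euclidean Fourier transform `û(ξ) = ∫_{ℝⁿ} e^{-2πi⟨x,ξ⟩} u(x) dx`. -/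
def FT {n : ℕ} (u : (Fin n → ℝ) → ℂ) (ξ : Fin n → ℝ) : ℂ :=
  ∫ x, Complex.exp (-(2 * (π : ℂ) * Complex.I) * ∑ j, (x j : ℂ) * (ξ j : ℂ)) * u x

/-- Pseudo-differential operator on `ℝⁿ`:
`T_σ u(x) = ∫_{ℝⁿ} e^{2πi⟨x,ξ⟩} σ(x,ξ) û(ξ) dξ`. -/
def OpR {n : ℕ} (σ : (Fin n → ℝ) → (Fin n → ℝ) → ℂ) (u : (Fin n → ℝ) → ℂ) :
    (Fin n → ℝ) → ℂ :=
  fun x => ∫ ξ, Complex.exp (2 * (π : ℂ) * Complex.I * ∑ j, (x j : ℂ) * (ξ j : ℂ)) * σ x ξ * FT u ξ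

/-- Periodic amplitude operator
`a(x,y,D)u(x) = ∫_{𝕋ⁿ} ∫_{ℝⁿ} e^{2πi⟨x-y,ξ⟩} a(x,y,ξ) u(y) dξ dy`. -/
def OpAmp {n : ℕ} (a : (Fin n → ℝ) → (Fin n → ℝ) → (Fin n → ℝ) → ℂ)
    (u : (Fin n → ℝ) → ℂ) : (Fin n → ℝ) → ℂ :=
  fun x => ∫ y,
    (∫ ξ, Complex.exp (2 * (π : ℂ) * Complex.I * ∑ j, ((x j : ℂ) - (y j : ℂ)) * (ξ j : ℂ)) *
        a x y ξ) * u y ∂(μT n)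

/-- The `L^p(ℝⁿ)` norm, for a real exponent `p`. -/
def lpR (n : ℕ) (p : ℝ) (g : (Fin n → ℝ) → ℂ) : ℝ :=
  (∫ x, ‖g x‖ ^ p) ^ (1 / p)

/-- Invariance of a function on `ℝⁿ` under translations by the lattice `ℤⁿ`. -/
def ZPer {n : ℕ} {E : Type*} (F : (Fin n → ℝ) → E) : Prop :=
  ∀ (x : Fin n → ℝ) (v : Fin n → ℤ), F (x + fun j => (v j : ℝ)) = F x

lemma measurableSet_cube (n : ℕ) : MeasurableSet (cube n) :=
  MeasurableSet.univ_pi fun _ => measurableSet_Ico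

lemma volume_cube (n : ℕ) : volume (cube n) = 1 := by
  simp [cube, volume_pi_pi]

instance isProbabilityMeasure_μT (n : ℕ) : IsProbabilityMeasure (μT n) :=
  ⟨by simp [μT, volume_cube]⟩

lemma isAddFundamentalDomain_cube (n : ℕ) :
    IsAddFundamentalDomain (Submodule.span ℤ (Set.range (Pi.basisFun ℝ (Fin n)))).toAddSubgroup
      (cube n) volume := by
  have h := ZSpan.isAddFundamentalDomain' (Pi.basisFun ℝ (Fin n)) volume
  rwa [ZSpan.fundamentalDomain_pi_basisFun] at h

lemma ZPer.vadd {n : ℕ} {E : Type*} {F : (Fin n → ℝ) → E} (hF : ZPer F)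
    (g : (Submodule.span ℤ (Set.range (Pi.basisFun ℝ (Fin n)))).toAddSubgroup) (x : Fin n → ℝ) :
    F (g +ᵥ x) = F x := by
  have hg : (g : Fin n → ℝ) ∈ Submodule.span ℤ (Set.range (Pi.basisFun ℝ (Fin n))) := g.2
  rw [Module.Basis.mem_span_iff_repr_mem] at hg
  choose v hv using hg
  have : g +ᵥ x = x + fun j => (v j : ℝ) := by
    ext j
    have := hv j
    simp at this
    simp [AddSubgroup.vadd_def, this, add_comm]
  rw [this, hF]

lemma isAddFundamentalDomain_preimage_cube {n : ℕ} {f : (Fin n → ℝ) → Fin n → ℝ}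
    (hf : MeasurePreserving f volume volume) (ε : ℤ) (hε : ε = 1 ∨ ε = -1)
    (hadd : ∀ v x, f (v + x) = ε • v + f x) :
    IsAddFundamentalDomain (Submodule.span ℤ (Set.range (Pi.basisFun ℝ (Fin n)))).toAddSubgroup
      (f ⁻¹' cube n) volume := by
  refine (isAddFundamentalDomain_cube n).preimage_of_equiv hf.quasiMeasurePreserving
    (e := fun g => ε • g) ?_ ?_
  · have hε2 : ε * ε = 1 := by rcases hε with rfl | rfl <;> rfl
    refine Function.bijective_iff_has_inverse.2 ⟨fun g => ε • g, fun g => ?_, fun g => ?_⟩ <;>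
    · simp only [smul_smul, hε2, one_smul]
  · intro g x
    have hε2 : ε * ε = 1 := by rcases hε with rfl | rfl <;> rfl
    simp only [AddSubgroup.vadd_def, vadd_eq_add]
    rw [hadd, AddSubgroup.coe_zsmul, smul_smul, hε2, one_smul]

instance countable_span_basisFun (n : ℕ) :
    Countable (Submodule.span ℤ (Set.range (Pi.basisFun ℝ (Fin n)))).toAddSubgroup :=
  inferInstanceAs (Countable (Submodule.span ℤ (Set.range (Pi.basisFun ℝ (Fin n)))))

lemma lintegral_comp_cube {n : ℕ} {f : (Fin n → ℝ) → Fin n → ℝ}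
    (hf : MeasurePreserving f volume volume) (hfe : MeasurableEmbedding f)
    (ε : ℤ) (hε : ε = 1 ∨ ε = -1)
    (hadd : ∀ v x, f (v + x) = ε • v + f x) {F : (Fin n → ℝ) → ℝ≥0∞} (hF : ZPer F) :
    ∫⁻ x, F (f x) ∂μT n = ∫⁻ x, F x ∂μT n := by
  have h1 := hf.setLIntegral_comp_preimage_emb hfe F (cube n)
  have hz : ZPer (fun x => F (f x)) := by
    intro x v
    simp only
    rw [add_comm, hadd, add_comm]
    have : (ε • fun j => (v j : ℝ)) = fun j => (((ε • v) j : ℤ) : ℝ) := by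
      ext j; simp
    rw [this, hF]
  rw [μT, ← h1]
  exact (isAddFundamentalDomain_cube n).setLIntegral_eq
    (isAddFundamentalDomain_preimage_cube hf ε hε hadd) _ (fun g x => hz.vadd g x)

lemma integral_comp_cube {n : ℕ} {f : (Fin n → ℝ) → Fin n → ℝ}
    (hf : MeasurePreserving f volume volume) (hfe : MeasurableEmbedding f)
    (ε : ℤ) (hε : ε = 1 ∨ ε = -1)
    (hadd : ∀ v x, f (v + x) = ε • v + f x) {F : (Fin n → ℝ) → ℂ} (hF : ZPer F) :
    ∫ x, F (f x) ∂μT n = ∫ x, F x ∂μT n := by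
  have h1 := hf.setIntegral_preimage_emb hfe F (cube n)
  have hz : ZPer (fun x => F (f x)) := by
    intro x v
    simp only
    rw [add_comm, hadd, add_comm]
    have : (ε • fun j => (v j : ℝ)) = fun j => (((ε • v) j : ℤ) : ℝ) := by
      ext j; simp
    rw [this, hF]
  rw [μT, ← h1]
  exact (isAddFundamentalDomain_cube n).setIntegral_eq
    (isAddFundamentalDomain_preimage_cube hf ε hε hadd) (fun g x => hz.vadd g x)

lemma lintegral_cube_sub {n : ℕ} {F : (Fin n → ℝ) → ℝ≥0∞} (hF : ZPer F) (t : Fin n → ℝ) :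
    ∫⁻ x, F (t - x) ∂μT n = ∫⁻ x, F x ∂μT n :=
  lintegral_comp_cube (Measure.measurePreserving_sub_left volume t)
    (MeasurableEquiv.subLeft t).measurableEmbedding (-1) (Or.inr rfl)
    (fun v x => by ext; simp; ring) hF

lemma integral_cube_add {n : ℕ} {F : (Fin n → ℝ) → ℂ} (hF : ZPer F) (t : Fin n → ℝ) :
    ∫ x, F (x + t) ∂μT n = ∫ x, F x ∂μT n :=
  integral_comp_cube (measurePreserving_add_right volume t)
    (MeasurableEquiv.addRight t).measurableEmbedding 1 (Or.inl rfl)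
    (fun v x => by simp [add_assoc]) hF

lemma lintegral_cube_neg {n : ℕ} {F : (Fin n → ℝ) → ℝ≥0∞} (hF : ZPer F) :
    ∫⁻ x, F (-x) ∂μT n = ∫⁻ x, F x ∂μT n := by
  simpa using lintegral_cube_sub hF 0

lemma integral_cube_neg {n : ℕ} {F : (Fin n → ℝ) → ℂ} (hF : ZPer F) :
    ∫ x, F (-x) ∂μT n = ∫ x, F x ∂μT n := by
  simpa using integral_comp_cube (Measure.measurePreserving_sub_left volume 0)
    (MeasurableEquiv.subLeft 0).measurableEmbedding (-1) (Or.inr rfl)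
    (fun v x => by ext; simp; ring) hF

lemma eChar_eq_exp {n : ℕ} (x : Fin n → ℝ) (ξ : Fin n → ℤ) :
    eChar x ξ = Complex.exp (((2 * π * ∑ j, x j * ξ j : ℝ) : ℂ) * Complex.I) := by
  simp only [eChar]; congr 1; push_cast; ring

@[simp] lemma norm_eChar {n : ℕ} (x : Fin n → ℝ) (ξ : Fin n → ℤ) : ‖eChar x ξ‖ = 1 := by
  rw [eChar_eq_exp, Complex.norm_exp_ofReal_mul_I]

lemma eChar_add_left {n : ℕ} (x y : Fin n → ℝ) (ξ : Fin n → ℤ) :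
    eChar (x + y) ξ = eChar x ξ * eChar y ξ := by
  simp only [eChar, ← Complex.exp_add]
  congr 1
  simp [add_mul, Finset.sum_add_distrib, mul_add]

lemma eChar_add_right {n : ℕ} (x : Fin n → ℝ) (ξ η : Fin n → ℤ) :
    eChar x (ξ + η) = eChar x ξ * eChar x η := by
  simp only [eChar, ← Complex.exp_add]
  congr 1
  simp [Finset.sum_add_distrib, mul_add]

@[simp] lemma eChar_zero_right {n : ℕ} (x : Fin n → ℝ) : eChar x 0 = 1 := by
  simp [eChar]

lemma eChar_neg_left {n : ℕ} (x : Fin n → ℝ) (ξ : Fin n → ℤ) :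
    eChar (-x) ξ = eChar x (-ξ) := by
  simp [eChar]

lemma eChar_neg_right {n : ℕ} (x : Fin n → ℝ) (ξ : Fin n → ℤ) :
    eChar x (-ξ) = (starRingEnd ℂ) (eChar x ξ) := by
  rw [eChar_eq_exp, eChar_eq_exp, ← Complex.exp_conj]
  congr 1
  rw [map_mul, Complex.conj_I, Complex.conj_ofReal]
  simp

lemma eChar_sub_left {n : ℕ} (x y : Fin n → ℝ) (ξ : Fin n → ℤ) :
    eChar (x - y) ξ = eChar x ξ * eChar (-y) ξ := by
  rw [sub_eq_add_neg, eChar_add_left]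

lemma eChar_intCast {n : ℕ} (v ξ : Fin n → ℤ) : eChar (fun j => (v j : ℝ)) ξ = 1 := by
  rw [eChar, Complex.exp_eq_one_iff]
  exact ⟨∑ j, v j * ξ j, by push_cast; ring⟩

lemma zPer_eChar {n : ℕ} (ξ : Fin n → ℤ) : ZPer (fun x : Fin n → ℝ => eChar x ξ) := by
  intro x v
  simp only [eChar_add_left, eChar_intCast, mul_one]

@[fun_prop] lemma continuous_eChar {n : ℕ} (ξ : Fin n → ℤ) :
    Continuous (fun x : Fin n → ℝ => eChar x ξ) := by
  unfold eChar; fun_prop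

lemma fc_eq {n : ℕ} (f : (Fin n → ℝ) → ℂ) (ξ : Fin n → ℤ) :
    fc f ξ = ∫ x, eChar (-x) ξ * f x ∂μT n := by
  simp [fc, eChar]

lemma integral_eChar {n : ℕ} (ξ : Fin n → ℤ) :
    ∫ x, eChar x ξ ∂μT n = if ξ = 0 then 1 else 0 := by
  split_ifs with h
  · simp [h]
  · obtain ⟨l, hl⟩ := Function.ne_iff.1 h
    have hl' : (ξ l : ℝ) ≠ 0 := by exact_mod_cast hl
    have hl2 : (ξ l : ℂ) ≠ 0 := by exact_mod_cast hl
    have h1 := integral_cube_add (zPer_eChar ξ) (Pi.single l (1 / (2 * (ξ l : ℝ))))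
    have h2 : eChar (Pi.single l (1 / (2 * (ξ l : ℝ)))) ξ = -1 := by
      rw [eChar, Finset.sum_eq_single l]
      · rw [← Complex.exp_pi_mul_I]
        congr 1
        simp
        field_simp
      · intro b _ hb; simp [hb]
      · simp
    simp only [eChar_add_left, h2] at h1
    rw [integral_mul_const] at h1
    linear_combination (-1 / 2) * h1

/-- The trigonometric series with coefficients `c`. -/
def trig {n : ℕ} (c : (Fin n → ℤ) → ℂ) (x : Fin n → ℝ) : ℂ :=
  ∑' ξ : Fin n → ℤ, c ξ * eChar x ξ

/-- The Fourier multiplier with symbol `a`. -/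
def mult {n : ℕ} (a : (Fin n → ℤ) → ℂ) (f : (Fin n → ℝ) → ℂ) : (Fin n → ℝ) → ℂ :=
  trig fun ξ => a ξ * fc f ξ

/-- Bounded measurable functions. -/
structure Bdd {n : ℕ} (f : (Fin n → ℝ) → ℂ) : Prop where
  meas : Measurable f
  bound : ∃ B : ℝ, ∀ x, ‖f x‖ ≤ B

section trig

variable {n : ℕ} {c : (Fin n → ℤ) → ℂ}

lemma trig_eq_sum {s : Finset (Fin n → ℤ)} (hs : c.support ⊆ s) (x : Fin n → ℝ) :
    trig c x = ∑ ξ ∈ s, c ξ * eChar x ξ := by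
  refine tsum_eq_sum fun ξ hξ => ?_
  have : c ξ = 0 := by
    by_contra h
    exact hξ (hs h)
  simp [this]

lemma continuous_trig (hc : c.support.Finite) : Continuous (trig c) := by
  have : trig c = fun x => ∑ ξ ∈ hc.toFinset, c ξ * eChar x ξ := by
    ext x; exact trig_eq_sum (by simp) x
  rw [this]; fun_prop

lemma zPer_trig (c : (Fin n → ℤ) → ℂ) : ZPer (trig c) := by
  intro x v
  simp only [trig]
  congr 1; ext ξ
  rw [show eChar (x + fun j => (v j : ℝ)) ξ = eChar x ξ from zPer_eChar ξ x v]

lemma trig_bounded (hc : c.support.Finite) : ∃ B : ℝ, ∀ x, ‖trig c x‖ ≤ B := by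
  refine ⟨∑ ξ ∈ hc.toFinset, ‖c ξ‖, fun x => ?_⟩
  rw [trig_eq_sum (s := hc.toFinset) (by simp) x]
  exact (norm_sum_le _ _).trans (by simp)

lemma bdd_trig (hc : c.support.Finite) : Bdd (trig c) :=
  ⟨(continuous_trig hc).measurable, trig_bounded hc⟩

lemma trig_add {d : (Fin n → ℤ) → ℂ} (hc : c.support.Finite) (hd : d.support.Finite)
    (x : Fin n → ℝ) : trig (c + d) x = trig c x + trig d x := by
  simp only [trig, Pi.add_apply, add_mul]
  refine Summable.tsum_add (summable_of_hasFiniteSupport (hc.subset ?_))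
    (summable_of_hasFiniteSupport (hd.subset ?_)) <;>
  exact Function.support_mul_subset_left _ _

lemma trig_sum {ι : Type*} (s : Finset ι) {c : ι → (Fin n → ℤ) → ℂ}
    (hc : ∀ i, (c i).support.Finite) (x : Fin n → ℝ) :
    trig (fun ξ => ∑ i ∈ s, c i ξ) x = ∑ i ∈ s, trig (c i) x := by
  simp only [trig, Finset.sum_mul]
  refine Summable.tsum_finsetSum fun i _ => summable_of_hasFiniteSupport ((hc i).subset ?_)
  exact Function.support_mul_subset_left _ _

lemma integral_trig_normSq {s : Finset (Fin n → ℤ)} (hs : c.support ⊆ s) :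
    ∫ x, ‖trig c x‖ ^ 2 ∂μT n = ∑ ξ ∈ s, ‖c ξ‖ ^ 2 := by
  have h1 : ∀ x, ((‖trig c x‖ ^ 2 : ℝ) : ℂ) =
      ∑ ξ ∈ s, ∑ η ∈ s, (c ξ * (starRingEnd ℂ) (c η)) * eChar x (ξ + -η) := by
    intro x
    rw [← Complex.normSq_eq_norm_sq, ← Complex.mul_conj, trig_eq_sum hs, map_sum,
      Finset.sum_mul_sum]
    refine Finset.sum_congr rfl fun ξ _ => Finset.sum_congr rfl fun η _ => ?_
    rw [eChar_add_right, eChar_neg_right, map_mul]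
    ring
  have hinteg : ∀ ξ η : Fin n → ℤ, Integrable
      (fun x => (c ξ * (starRingEnd ℂ) (c η)) * eChar x (ξ + -η)) (μT n) := fun ξ η => by
    refine Integrable.const_mul ?_ _
    refine Integrable.of_bound (C := 1) (by fun_prop) (by simp)
  have h2 : ((∫ x, ‖trig c x‖ ^ 2 ∂μT n : ℝ) : ℂ) = ((∑ ξ ∈ s, ‖c ξ‖ ^ 2 : ℝ) : ℂ) := by
    rw [← integral_complex_ofReal]
    simp_rw [h1]
    rw [integral_finsetSum _ fun ξ _ => integrable_finsetSum _ fun η _ => hinteg ξ η]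
    push_cast
    refine Finset.sum_congr rfl fun ξ hξ => ?_
    rw [integral_finsetSum _ fun η _ => hinteg ξ η]
    rw [Finset.sum_eq_single ξ]
    · rw [integral_const_mul, integral_eChar]
      simp [Complex.mul_conj, Complex.normSq_eq_norm_sq]
    · intro η _ hη
      rw [integral_const_mul, integral_eChar, if_neg, mul_zero]
      rw [← sub_eq_add_neg]
      exact sub_ne_zero.2 hη.symm
    · exact fun h => absurd hξ h
  exact_mod_cast h2

lemma enorm_sq_eq_ofReal (z : ℂ) : ‖z‖ₑ ^ 2 = ENNReal.ofReal (‖z‖ ^ 2) := by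
  rw [← ofReal_norm, ENNReal.ofReal_pow (norm_nonneg _)]

lemma Bdd.integrable {f : (Fin n → ℝ) → ℂ} (hf : Bdd f) : Integrable f (μT n) := by
  obtain ⟨B, hB⟩ := hf.bound
  exact Integrable.of_bound hf.meas.aestronglyMeasurable B (by simp [hB])

lemma Bdd.integrable_sq {f : (Fin n → ℝ) → ℂ} (hf : Bdd f) :
    Integrable (fun x => ‖f x‖ ^ 2) (μT n) := by
  obtain ⟨B, hB⟩ := hf.bound
  refine Integrable.of_bound (hf.meas.norm.pow_const 2).aestronglyMeasurable (B ^ 2) ?_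
  refine Filter.Eventually.of_forall fun x => ?_
  rw [Real.norm_of_nonneg (by positivity)]
  exact pow_le_pow_left₀ (norm_nonneg _) (hB x) 2

lemma Bdd.lintegral_sq {f : (Fin n → ℝ) → ℂ} (hf : Bdd f) :
    ∫⁻ x, ‖f x‖ₑ ^ 2 ∂μT n = ENNReal.ofReal (∫ x, ‖f x‖ ^ 2 ∂μT n) := by
  simp_rw [enorm_sq_eq_ofReal]
  rw [ofReal_integral_eq_lintegral_ofReal hf.integrable_sq]
  exact Filter.Eventually.of_forall fun x => by positivity

lemma lintegral_trig_sq (hc : c.support.Finite) :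
    ∫⁻ x, ‖trig c x‖ₑ ^ 2 ∂μT n = ∑' ξ, ‖c ξ‖ₑ ^ 2 := by
  rw [(bdd_trig hc).lintegral_sq, integral_trig_normSq (s := hc.toFinset) (by simp),
    ENNReal.ofReal_sum_of_nonneg (fun _ _ => by positivity), tsum_eq_sum (s := hc.toFinset)]
  · simp_rw [enorm_sq_eq_ofReal]
  · intro ξ hξ
    simp at hξ
    simp [hξ]

lemma bdd_mul {f g : (Fin n → ℝ) → ℂ} (hf : Bdd f) (hg : Bdd g) : Bdd (fun x => f x * g x) := by
  obtain ⟨B, hB⟩ := hf.bound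
  obtain ⟨B', hB'⟩ := hg.bound
  refine ⟨hf.meas.mul hg.meas, B * B', fun x => ?_⟩
  rw [norm_mul]
  exact mul_le_mul (hB x) (hB' x) (norm_nonneg _) ((norm_nonneg _).trans (hB x))

lemma bdd_eChar (ξ : Fin n → ℤ) : Bdd (fun x => eChar x ξ) :=
  ⟨(continuous_eChar ξ).measurable, 1, by simp⟩

lemma bdd_eChar_neg (ξ : Fin n → ℤ) : Bdd (fun x => eChar (-x) ξ) := by
  simp_rw [eChar_neg_left]; exact bdd_eChar _

lemma sum_fc_sq_le {f : (Fin n → ℝ) → ℂ} (hf : Bdd f) (s : Finset (Fin n → ℤ)) :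
    ∑ ξ ∈ s, ‖fc f ξ‖ ^ 2 ≤ ∫ x, ‖f x‖ ^ 2 ∂μT n := by
  classical
  set c : (Fin n → ℤ) → ℂ := fun ξ => if ξ ∈ s then fc f ξ else 0 with hcdef
  have hs : c.support ⊆ s := by
    intro ξ hξ
    by_contra h
    exact hξ (by simp only [hcdef]; rw [if_neg]; exact h)
  have hcf : c.support.Finite := s.finite_toSet.subset hs
  have hpt : ∀ x, 2 * ((starRingEnd ℂ) (trig c x) * f x).re ≤ ‖trig c x‖ ^ 2 + ‖f x‖ ^ 2 := by
    intro x
    have h1 : ((starRingEnd ℂ) (trig c x) * f x).re ≤ ‖trig c x‖ * ‖f x‖ := by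
      refine (Complex.re_le_norm _).trans ?_
      rw [norm_mul, Complex.norm_conj]
    nlinarith [sq_nonneg (‖trig c x‖ - ‖f x‖)]
  have hb : Bdd (fun x => (starRingEnd ℂ) (trig c x)) := by
    obtain ⟨B, hB⟩ := trig_bounded hcf
    exact ⟨(Complex.continuous_conj.comp (continuous_trig hcf)).measurable, B, by simpa using hB⟩
  have hI : ∫ x, (starRingEnd ℂ) (trig c x) * f x ∂μT n = ((∑ ξ ∈ s, ‖fc f ξ‖ ^ 2 : ℝ) : ℂ) := by
    have : ∀ x, (starRingEnd ℂ) (trig c x) * f x =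
        ∑ ξ ∈ s, (starRingEnd ℂ) (c ξ) * (eChar (-x) ξ * f x) := by
      intro x
      rw [trig_eq_sum hs, map_sum, Finset.sum_mul]
      refine Finset.sum_congr rfl fun ξ _ => ?_
      rw [map_mul, eChar_neg_left, eChar_neg_right]; ring
    simp_rw [this]
    rw [integral_finsetSum _ fun ξ _ => (bdd_mul (bdd_eChar_neg ξ) hf).integrable.const_mul _]
    push_cast
    refine Finset.sum_congr rfl fun ξ hξ => ?_
    rw [integral_const_mul, ← fc_eq]
    simp only [hcdef, if_pos hξ]
    rw [mul_comm, Complex.mul_conj, Complex.normSq_eq_norm_sq]; push_cast; rfl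
  have hre : ∫ x, ((starRingEnd ℂ) (trig c x) * f x).re ∂μT n = ∑ ξ ∈ s, ‖fc f ξ‖ ^ 2 := by
    have := integral_re (bdd_mul hb hf).integrable
    simp only [RCLike.re_to_complex] at this
    rw [this, hI, Complex.ofReal_re]
  have hle := integral_mono ((bdd_mul hb hf).integrable.re.const_mul 2)
    ((bdd_trig hcf).integrable_sq.add hf.integrable_sq) hpt
  simp only [RCLike.re_to_complex, Pi.add_apply] at hle
  rw [integral_const_mul, hre, integral_add (bdd_trig hcf).integrable_sq hf.integrable_sq,
    integral_trig_normSq hs] at hle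
  have : ∑ ξ ∈ s, ‖c ξ‖ ^ 2 = ∑ ξ ∈ s, ‖fc f ξ‖ ^ 2 :=
    Finset.sum_congr rfl fun ξ hξ => by simp only [hcdef, if_pos hξ]
  linarith

lemma tsum_fc_sq_le {f : (Fin n → ℝ) → ℂ} (hf : Bdd f) :
    ∑' ξ, ‖fc f ξ‖ₑ ^ 2 ≤ ∫⁻ x, ‖f x‖ₑ ^ 2 ∂μT n := by
  rw [ENNReal.tsum_eq_iSup_sum]
  refine iSup_le fun s => ?_
  simp_rw [hf.lintegral_sq, enorm_sq_eq_ofReal]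
  rw [← ENNReal.ofReal_sum_of_nonneg (fun _ _ => by positivity)]
  exact ENNReal.ofReal_le_ofReal (sum_fc_sq_le hf s)

end trig

section mult

variable {n : ℕ} {a b : (Fin n → ℤ) → ℂ} {f g : (Fin n → ℝ) → ℂ}

lemma support_mul_fc_finite (ha : a.support.Finite) (f : (Fin n → ℝ) → ℂ) :
    (fun ξ => a ξ * fc f ξ).support.Finite :=
  ha.subset (Function.support_mul_subset_left _ _)

lemma bdd_mult (ha : a.support.Finite) (f : (Fin n → ℝ) → ℂ) : Bdd (mult a f) :=
  bdd_trig (support_mul_fc_finite ha f)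

lemma continuous_mult (ha : a.support.Finite) (f : (Fin n → ℝ) → ℂ) : Continuous (mult a f) :=
  continuous_trig (support_mul_fc_finite ha f)

lemma zPer_mult (a : (Fin n → ℤ) → ℂ) (f : (Fin n → ℝ) → ℂ) : ZPer (mult a f) := zPer_trig _

lemma lintegral_mult_sq (ha : a.support.Finite) (f : (Fin n → ℝ) → ℂ) :
    ∫⁻ x, ‖mult a f x‖ₑ ^ 2 ∂μT n = ∑' ξ, ‖a ξ‖ₑ ^ 2 * ‖fc f ξ‖ₑ ^ 2 := by
  rw [mult, lintegral_trig_sq (support_mul_fc_finite ha f)]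
  simp_rw [enorm_mul, mul_pow]

lemma lintegral_mult_sq_le (ha : a.support.Finite) (hf : Bdd f) {L : ℝ≥0∞}
    (hL : ∀ ξ, ‖a ξ‖ₑ ≤ L) :
    ∫⁻ x, ‖mult a f x‖ₑ ^ 2 ∂μT n ≤ L ^ 2 * ∫⁻ x, ‖f x‖ₑ ^ 2 ∂μT n := by
  rw [lintegral_mult_sq ha]
  refine le_trans ?_ (mul_le_mul_right (tsum_fc_sq_le hf) _)
  rw [← ENNReal.tsum_mul_left]
  refine ENNReal.tsum_le_tsum fun ξ => ?_
  gcongr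
  exact hL ξ

lemma fc_add (hf : Bdd f) (hg : Bdd g) (ξ : Fin n → ℤ) : fc (f + g) ξ = fc f ξ + fc g ξ := by
  simp only [fc_eq, Pi.add_apply, mul_add]
  exact integral_add (bdd_mul (bdd_eChar_neg ξ) hf).integrable
    (bdd_mul (bdd_eChar_neg ξ) hg).integrable

lemma mult_add (ha : a.support.Finite) (hf : Bdd f) (hg : Bdd g) (x : Fin n → ℝ) :
    mult a (f + g) x = mult a f x + mult a g x := by
  rw [mult, mult, mult, ← trig_add (support_mul_fc_finite ha f) (support_mul_fc_finite ha g)]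
  congr 1; ext ξ
  simp [fc_add hf hg, mul_add]

lemma mult_sum {ι : Type*} (s : Finset ι) {a : ι → (Fin n → ℤ) → ℂ}
    (ha : ∀ i, (a i).support.Finite) (f : (Fin n → ℝ) → ℂ) (x : Fin n → ℝ) :
    mult (fun ξ => ∑ i ∈ s, a i ξ) f x = ∑ i ∈ s, mult (a i) f x := by
  simp only [mult]
  rw [← trig_sum s (fun i => support_mul_fc_finite (ha i) f)]
  congr 1; ext ξ
  rw [Finset.sum_mul]

lemma mult_eq_integral (ha : a.support.Finite) (hf : Bdd f) (x : Fin n → ℝ) :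
    mult a f x = ∫ y, trig a (x - y) * f y ∂μT n := by
  have : ∀ y, trig a (x - y) * f y =
      ∑ ξ ∈ ha.toFinset, (a ξ * eChar x ξ) * (eChar (-y) ξ * f y) := by
    intro y
    rw [trig_eq_sum (s := ha.toFinset) (by simp), Finset.sum_mul]
    refine Finset.sum_congr rfl fun ξ _ => ?_
    rw [eChar_sub_left]; ring
  simp_rw [this]
  rw [integral_finsetSum _ fun ξ _ => (bdd_mul (bdd_eChar_neg ξ) hf).integrable.const_mul _,
    mult, trig_eq_sum (s := ha.toFinset)]
  · refine Finset.sum_congr rfl fun ξ _ => ?_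
    rw [integral_const_mul, ← fc_eq]; ring
  · simp only [Set.Finite.coe_toFinset]
    exact Function.support_mul_subset_left _ _

lemma enorm_mult_le (ha : a.support.Finite) (hf : Bdd f) (x : Fin n → ℝ) :
    ‖mult a f x‖ₑ ≤ ∫⁻ y, ‖trig a (x - y)‖ₑ * ‖f y‖ₑ ∂μT n := by
  rw [mult_eq_integral ha hf]
  refine (enorm_integral_le_lintegral_enorm _).trans ?_
  simp_rw [enorm_mul]; rfl

lemma mult_add_sub (ha : a.support.Finite) (f : (Fin n → ℝ) → ℂ) (v x : Fin n → ℝ) :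
    mult a f (x + v) - mult a f x = mult (fun ξ => a ξ * (eChar v ξ - 1)) f x := by
  have hs : (fun ξ => a ξ * fc f ξ).support ⊆ ha.toFinset := by
    simp only [Set.Finite.coe_toFinset]
    exact Function.support_mul_subset_left _ _
  have hs' : (fun ξ => a ξ * (eChar v ξ - 1) * fc f ξ).support ⊆ ha.toFinset := by
    simp only [Set.Finite.coe_toFinset]
    exact (Function.support_mul_subset_left _ _).trans (Function.support_mul_subset_left _ _)
  rw [mult, mult, trig_eq_sum hs, trig_eq_sum hs, trig_eq_sum hs', ← Finset.sum_sub_distrib]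
  refine Finset.sum_congr rfl fun ξ _ => ?_
  rw [eChar_add_left]; ring

end mult

/-- The distance on the unit circle between the points of parameters `t` and `0`. -/
def chord (t : ℝ) : ℝ := ‖Complex.exp (((2 * π * t : ℝ) : ℂ) * Complex.I) - 1‖

section chord

lemma continuous_chord : Continuous chord := by unfold chord; fun_prop

lemma chord_eq (t : ℝ) : chord t = 2 * |sin (π * t)| := by
  rw [chord, mul_comm, Complex.norm_exp_I_mul_ofReal_sub_one, norm_mul, Real.norm_eq_abs,
    Real.norm_eq_abs]
  simp only [Nat.abs_ofNat]
  congr 3; ring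

lemma chord_neg (t : ℝ) : chord (-t) = chord t := by
  rw [chord_eq, chord_eq, mul_neg, sin_neg, abs_neg]

lemma chord_le (t : ℝ) : chord t ≤ 2 * π * |t| := by
  rw [chord_eq]
  have := abs_sin_le_abs (x := π * t)
  rw [abs_mul, abs_of_pos pi_pos] at this
  linarith

lemma chord_add_le (t u : ℝ) : chord (t + u) ≤ chord t + chord u := by
  rw [chord_eq, chord_eq, chord_eq, mul_add, sin_add]
  have h1 : |sin (π * t) * cos (π * u)| ≤ |sin (π * t)| := by
    rw [abs_mul]; exact mul_le_of_le_one_right (abs_nonneg _) (abs_cos_le_one _)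
  have h2 : |cos (π * t) * sin (π * u)| ≤ |sin (π * u)| := by
    rw [abs_mul]; exact mul_le_of_le_one_left (abs_nonneg _) (abs_cos_le_one _)
  have h3 := abs_add_le (sin (π * t) * cos (π * u)) (cos (π * t) * sin (π * u))
  linarith

lemma chord_add_int (t : ℝ) (v : ℤ) : chord (t + v) = chord t := by
  unfold chord
  congr 2
  have : ((2 * π * (t + v) : ℝ) : ℂ) * Complex.I =
      ((2 * π * t : ℝ) : ℂ) * Complex.I + v * (2 * π * Complex.I) := by push_cast; ring
  rw [this, Complex.exp_add, Complex.exp_int_mul_two_pi_mul_I, mul_one]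

lemma four_mul_min_le_chord {u : ℝ} (h0 : 0 ≤ u) (h1 : u ≤ 1) : 4 * min u (1 - u) ≤ chord u := by
  have key : ∀ v : ℝ, 0 ≤ v → v ≤ 1 / 2 → 2 * v ≤ sin (π * v) := by
    intro v hv0 hv1
    have := Real.mul_le_sin (x := π * v) (by positivity) (by nlinarith [pi_pos])
    calc 2 * v = 2 / π * (π * v) := by field_simp
      _ ≤ _ := this
  rw [chord_eq]
  rcases le_total u (1 / 2) with h | h
  · have := key u h0 h
    have := le_abs_self (sin (π * u))
    have := min_le_left u (1 - u)
    linarith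
  · have h2 := key (1 - u) (by linarith) (by linarith)
    rw [show π * (1 - u) = π - π * u by ring, sin_pi_sub] at h2
    have := le_abs_self (sin (π * u))
    have := min_le_right u (1 - u)
    linarith

lemma volume_chord_lt_le (r : ℝ) :
    volume (Set.Ico (0 : ℝ) 1 ∩ {u | chord u < r}) ≤ ENNReal.ofReal r := by
  have hsub : Set.Ico (0 : ℝ) 1 ∩ {u | chord u < r} ⊆
      Set.Icc 0 (r / 4) ∪ Set.Icc (1 - r / 4) 1 := by
    rintro u ⟨⟨h0, h1⟩, hu⟩
    have h := (four_mul_min_le_chord h0 h1.le).trans_lt hu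
    rcases min_choice u (1 - u) with hm | hm <;> rw [hm] at h
    · exact Or.inl ⟨h0, by linarith⟩
    · exact Or.inr ⟨by linarith, h1.le⟩
  refine (measure_mono hsub).trans ((measure_union_le _ _).trans ?_)
  rw [Real.volume_Icc, Real.volume_Icc]
  rcases le_total r 0 with hr | hr
  · rw [ENNReal.ofReal_of_nonpos (by linarith), ENNReal.ofReal_of_nonpos (by linarith)]; simp
  · rw [← ENNReal.ofReal_add (by linarith) (by linarith)]
    exact ENNReal.ofReal_le_ofReal (by linarith)

lemma measurableSet_chord_lt {n : ℕ} (r : ℝ) :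
    MeasurableSet {z : Fin n → ℝ | ∀ l, chord (z l) < r} := by
  rw [Set.ofPred_forall]
  exact MeasurableSet.iInter fun l =>
    measurableSet_lt (continuous_chord.measurable.comp (measurable_pi_apply l)) measurable_const

lemma μT_chord_lt_le (n : ℕ) (r : ℝ) :
    μT n {z | ∀ l, chord (z l) < r} ≤ ENNReal.ofReal r ^ n := by
  have : {z : Fin n → ℝ | ∀ l, chord (z l) < r} ∩ cube n =
      Set.univ.pi fun _ => Set.Ico (0 : ℝ) 1 ∩ {u | chord u < r} := by
    ext z
    simp only [cube, Set.mem_inter_iff, Set.mem_ofPred_eq, Set.mem_pi, Set.mem_univ,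
      forall_true_left]
    exact ⟨fun h l => ⟨h.2 l, h.1 l⟩, fun h => ⟨fun l => (h l).2, fun l => (h l).1⟩⟩
  rw [μT, Measure.restrict_apply (measurableSet_chord_lt r), this, volume_pi_pi]
  refine (Finset.prod_le_prod' fun _ _ => volume_chord_lt_le r).trans ?_
  simp

end chord

section kernel

variable {n : ℕ} {a : (Fin n → ℤ) → ℂ}

lemma support_dd_finite (ha : a.support.Finite) (l : Fin n) : (dd l a).support.Finite := by
  refine Set.Finite.subset
    ((ha.preimage (add_left_injective (Pi.single l 1)).injOn).union ha) ?_
  intro ξ hξ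
  by_contra h
  simp only [Set.mem_union, Set.mem_preimage, Function.mem_support, not_or, not_not] at h
  exact hξ (by simp [dd, h.1, h.2])

lemma support_dd_iterate_finite (ha : a.support.Finite) (l : Fin n) (N : ℕ) :
    ((dd l)^[N] a).support.Finite := by
  induction N with
  | zero => exact ha
  | succ N ih => rw [Function.iterate_succ_apply']; exact support_dd_finite ih l

lemma trig_dd (ha : a.support.Finite) (l : Fin n) (x : Fin n → ℝ) :
    trig (dd l a) x = (eChar x (-Pi.single l 1) - 1) * trig a x := by
  have h1 : Summable fun ξ => a ξ * eChar x ξ := by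
    refine summable_of_hasFiniteSupport (ha.subset ?_)
    exact Function.support_mul_subset_left _ _
  have h2 : Summable fun ξ => a (ξ + Pi.single l 1) * eChar x ξ := by
    refine summable_of_hasFiniteSupport
      ((ha.preimage (add_left_injective (Pi.single l 1)).injOn).subset ?_)
    exact Function.support_mul_subset_left _ _
  have h3 : ∑' ξ, a (ξ + Pi.single l 1) * eChar x ξ =
      eChar x (-Pi.single l 1) * ∑' ξ, a ξ * eChar x ξ := by
    rw [← tsum_mul_left, ← (Equiv.addRight (Pi.single l (1 : ℤ))).tsum_eq
      (fun ξ => eChar x (-Pi.single l 1) * (a ξ * eChar x ξ))]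
    congr 1; ext ξ
    simp only [Equiv.coe_addRight]
    have : eChar x ξ = eChar x (-Pi.single l 1) * eChar x (ξ + Pi.single l 1) := by
      rw [← eChar_add_right]; congr 1; abel
    rw [this]; ring
  simp only [trig, dd, sub_mul, one_mul]
  rw [h2.tsum_sub h1, h3]

lemma norm_eChar_single_sub_one (l : Fin n) (x : Fin n → ℝ) :
    ‖eChar x (-Pi.single l 1) - 1‖ = chord (x l) := by
  rw [← chord_neg, chord, eChar_eq_exp]
  congr 4
  rw [Finset.sum_eq_single l]
  · simp
  · intro b _ hb; simp [hb]
  · simp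

lemma norm_trig_dd_iterate (ha : a.support.Finite) (l : Fin n) (N : ℕ) (x : Fin n → ℝ) :
    ‖trig ((dd l)^[N] a) x‖ = chord (x l) ^ N * ‖trig a x‖ := by
  induction N with
  | zero => simp
  | succ N ih =>
    rw [Function.iterate_succ_apply', trig_dd (support_dd_iterate_finite ha l N), norm_mul, ih,
      norm_eChar_single_sub_one, pow_succ]
    ring

lemma setLIntegral_le_sqrt {α : Type*} [MeasurableSpace α] (μ : Measure α) {S : Set α}
    {F : α → ℝ≥0∞} (hF : AEMeasurable F μ) :
    ∫⁻ x in S, F x ∂μ ≤ μ S ^ (1 / 2 : ℝ) * (∫⁻ x, F x ^ 2 ∂μ) ^ (1 / 2 : ℝ) := by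
  have h := ENNReal.lintegral_mul_le_Lp_mul_Lq (μ.restrict S) Real.HolderConjugate.two_two
    (f := fun _ => 1) (g := F) aemeasurable_const hF.restrict
  simp only [Pi.mul_apply, one_mul, ENNReal.one_rpow, lintegral_const, Measure.restrict_apply_univ]
    at h
  refine h.trans ?_
  gcongr
  · exact Measure.restrict_le_self
  · exact (ENNReal.rpow_two _).le

lemma lintegral_trig_near_le (ha : a.support.Finite) {W : ℝ}
    (hW : ∑' ξ, ‖a ξ‖ₑ ^ 2 ≤ ENNReal.ofReal W ^ 2) {r : ℝ} (hr : 0 < r) :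
    ∫⁻ z in {z | ∀ l, chord (z l) < r}, ‖trig a z‖ₑ ∂μT n ≤
      ENNReal.ofReal (W * r ^ ((n : ℝ) / 2)) := by
  refine (setLIntegral_le_sqrt _ (continuous_trig ha).measurable.enorm.aemeasurable).trans ?_
  rw [lintegral_trig_sq ha]
  calc _ ≤ (ENNReal.ofReal r ^ n) ^ (1 / 2 : ℝ) * (ENNReal.ofReal W ^ 2) ^ (1 / 2 : ℝ) := by
        gcongr
        exact μT_chord_lt_le n r
    _ = ENNReal.ofReal (r ^ ((n : ℝ) / 2)) * ENNReal.ofReal W := by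
        rw [← ENNReal.rpow_natCast, ← ENNReal.rpow_natCast, ← ENNReal.rpow_mul, ← ENNReal.rpow_mul,
          ENNReal.ofReal_rpow_of_pos hr]
        norm_num
        rw [mul_one_div]
    _ = _ := by rw [← ENNReal.ofReal_mul (by positivity), mul_comm]

lemma lintegral_trig_shell_le (ha : a.support.Finite) (N : ℕ) {W : ℝ}
    (hW : ∀ l, ∑' ξ, ‖(dd l)^[N] a ξ‖ₑ ^ 2 ≤ ENNReal.ofReal W ^ 2) {r : ℝ} (hr : 0 < r) :
    ∫⁻ z in {z | (∀ l, chord (z l) < 2 * r) ∧ ∃ l, r ≤ chord (z l)}, ‖trig a z‖ₑ ∂μT n ≤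
      ENNReal.ofReal (n * (2 : ℝ) ^ ((n : ℝ) / 2) * W * r ^ ((n : ℝ) / 2 - N)) := by
  set S : Fin n → Set (Fin n → ℝ) := fun l =>
    {z | ∀ l, chord (z l) < 2 * r} ∩ {z | r ≤ chord (z l)} with hS
  have hSm : ∀ l, MeasurableSet (S l) := fun l => (measurableSet_chord_lt _).inter
    (measurableSet_le measurable_const (continuous_chord.measurable.comp (measurable_pi_apply l)))
  have hsub : {z : Fin n → ℝ | (∀ l, chord (z l) < 2 * r) ∧ ∃ l, r ≤ chord (z l)} ⊆ ⋃ l, S l := by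
    rintro z ⟨h1, l, h2⟩
    exact Set.mem_iUnion.2 ⟨l, h1, h2⟩
  have hl : ∀ l, ∫⁻ z in S l, ‖trig a z‖ₑ ∂μT n ≤
      ENNReal.ofReal ((2 : ℝ) ^ ((n : ℝ) / 2) * W * r ^ ((n : ℝ) / 2 - N)) := by
    intro l
    have hpt : ∀ z ∈ S l, ‖trig a z‖ₑ ≤
        ENNReal.ofReal (r ^ (-(N : ℝ))) * ‖trig ((dd l)^[N] a) z‖ₑ := by
      intro z hz
      rw [← ofReal_norm, ← ofReal_norm, norm_trig_dd_iterate ha, ← ENNReal.ofReal_mul (by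
          positivity)]
      refine ENNReal.ofReal_le_ofReal ?_
      have h1 : r ^ N ≤ chord (z l) ^ N := pow_le_pow_left₀ hr.le hz.2 N
      rw [Real.rpow_neg hr.le, Real.rpow_natCast, ← mul_assoc]
      refine le_mul_of_one_le_left (norm_nonneg _) ?_
      rw [inv_mul_eq_div, one_le_div (by positivity)]
      exact h1
    calc _ ≤ ∫⁻ z in S l, ENNReal.ofReal (r ^ (-(N : ℝ))) * ‖trig ((dd l)^[N] a) z‖ₑ ∂μT n :=
          setLIntegral_mono' (hSm l) hpt
      _ = ENNReal.ofReal (r ^ (-(N : ℝ))) * ∫⁻ z in S l, ‖trig ((dd l)^[N] a) z‖ₑ ∂μT n := by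
          rw [lintegral_const_mul' _ _ ENNReal.ofReal_ne_top]
      _ ≤ ENNReal.ofReal (r ^ (-(N : ℝ))) *
          ∫⁻ z in {z | ∀ l, chord (z l) < 2 * r}, ‖trig ((dd l)^[N] a) z‖ₑ ∂μT n := by
          gcongr
          exact Set.inter_subset_left
      _ ≤ ENNReal.ofReal (r ^ (-(N : ℝ))) * ENNReal.ofReal (W * (2 * r) ^ ((n : ℝ) / 2)) := by
          gcongr
          exact lintegral_trig_near_le (support_dd_iterate_finite ha l N) (hW l) (by positivity)
      _ = _ := by
          rw [← ENNReal.ofReal_mul (by positivity), Real.mul_rpow (by norm_num) hr.le,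
            sub_eq_neg_add, Real.rpow_add hr]
          congr 1; ring
  calc _ ≤ ∫⁻ z in ⋃ l, S l, ‖trig a z‖ₑ ∂μT n := lintegral_mono_set hsub
    _ ≤ ∑' l, ∫⁻ z in S l, ‖trig a z‖ₑ ∂μT n := lintegral_iUnion_le _ _
    _ ≤ ∑' l : Fin n, ENNReal.ofReal ((2 : ℝ) ^ ((n : ℝ) / 2) * W * r ^ ((n : ℝ) / 2 - N)) :=
        ENNReal.tsum_le_tsum hl
    _ = _ := by
        rw [tsum_fintype, Finset.sum_const, Finset.card_univ, Fintype.card_fin, nsmul_eq_mul,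
          ← ENNReal.ofReal_natCast, ← ENNReal.ofReal_mul (by positivity)]
        congr 1; ring

lemma lintegral_trig_far_le (ha : a.support.Finite) (N : ℕ) (hN : (n : ℝ) / 2 < N) {W : ℝ}
    (hW0 : 0 ≤ W) (hW : ∀ l, ∑' ξ, ‖(dd l)^[N] a ξ‖ₑ ^ 2 ≤ ENNReal.ofReal W ^ 2) {r : ℝ}
    (hr : 0 < r) :
    ∫⁻ z in {z | ∃ l, r ≤ chord (z l)}, ‖trig a z‖ₑ ∂μT n ≤
      ENNReal.ofReal (n * (2 : ℝ) ^ ((n : ℝ) / 2) * (1 - (2 : ℝ) ^ ((n : ℝ) / 2 - N))⁻¹ *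
        W * r ^ ((n : ℝ) / 2 - N)) := by
  set q : ℝ := (2 : ℝ) ^ ((n : ℝ) / 2 - N) with hq
  have hq0 : 0 < q := by positivity
  have hq1 : q < 1 := Real.rpow_lt_one_of_one_lt_of_neg (by norm_num) (by linarith)
  set S : ℕ → Set (Fin n → ℝ) := fun i =>
    {z | (∀ l, chord (z l) < 2 * (2 ^ i * r)) ∧ ∃ l, 2 ^ i * r ≤ chord (z l)}
  have hsub : {z : Fin n → ℝ | ∃ l, r ≤ chord (z l)} ⊆ ⋃ i, S i := by
    rintro z ⟨l, hl⟩
    have : (Finset.univ : Finset (Fin n)).Nonempty := ⟨l, Finset.mem_univ _⟩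
    obtain ⟨l₀, -, hmax⟩ := Finset.exists_max_image Finset.univ (fun l => chord (z l)) this
    have h1 : 1 ≤ chord (z l₀) / r := by
      rw [one_le_div hr]; exact hl.trans (hmax l (Finset.mem_univ _))
    obtain ⟨i, hi1, hi2⟩ := exists_nat_pow_near h1 (by norm_num : (1 : ℝ) < 2)
    rw [le_div_iff₀ hr] at hi1
    rw [div_lt_iff₀ hr] at hi2
    refine Set.mem_iUnion.2 ⟨i, fun l => (hmax l (Finset.mem_univ _)).trans_lt ?_, l₀, hi1⟩
    rw [pow_succ] at hi2; linarith
  set A : ℝ := n * (2 : ℝ) ^ ((n : ℝ) / 2) * W * r ^ ((n : ℝ) / 2 - N) with hA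
  have hA0 : 0 ≤ A := by positivity
  calc _ ≤ ∫⁻ z in ⋃ i, S i, ‖trig a z‖ₑ ∂μT n := lintegral_mono_set hsub
    _ ≤ ∑' i, ∫⁻ z in S i, ‖trig a z‖ₑ ∂μT n := lintegral_iUnion_le _ _
    _ ≤ ∑' i : ℕ, ENNReal.ofReal (A * q ^ i) := by
        refine ENNReal.tsum_le_tsum fun i => ?_
        refine (lintegral_trig_shell_le ha N hW (by positivity : 0 < 2 ^ i * r)).trans_eq ?_
        congr 1
        rw [Real.mul_rpow (by positivity) hr.le, ← Real.rpow_natCast 2 i, ← Real.rpow_mul (by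
            norm_num),
          mul_comm (i : ℝ), Real.rpow_mul (by norm_num), Real.rpow_natCast, ← hq, hA]
        ring
    _ = ENNReal.ofReal (A * (1 - q)⁻¹) := by
        rw [← ENNReal.ofReal_tsum_of_nonneg (fun i => by positivity)
          ((summable_geometric_of_lt_one hq0.le hq1).mul_left A), tsum_mul_left,
          tsum_geometric_of_lt_one hq0.le hq1]
    _ = _ := by rw [hA]; congr 1; ring

end kernel

/-- The index of the dyadic cube of generation `k` of the torus containing `x`. -/
def dyad {n : ℕ} (k : ℕ) (x : Fin n → ℝ) : Fin n → ℤ := fun l => ⌊2 ^ k * Int.fract (x l)⌋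

/-- The dyadic cube of generation `k` and index `i`, as a periodic set. -/
def dcube {n : ℕ} (k : ℕ) (i : Fin n → ℤ) : Set (Fin n → ℝ) := {x | dyad k x = i}

/-- The number of dyadic cubes of generation `k`. -/
def dnum (n k : ℕ) : ℝ≥0∞ := 2 ^ (k * n)

/-- Dyadic average of `F` at generation `k`. -/
def davg {n : ℕ} (k : ℕ) (F : (Fin n → ℝ) → ℝ≥0∞) (x : Fin n → ℝ) : ℝ≥0∞ :=
  dnum n k * ∫⁻ y in dcube k (dyad k x), F y ∂μT n

/-- Dyadic maximal function. -/
def dmax {n : ℕ} (F : (Fin n → ℝ) → ℝ≥0∞) (x : Fin n → ℝ) : ℝ≥0∞ := ⨆ k, davg k F x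

/-- Mean of `‖g y - g y'‖` over the dyadic cube of generation `k` containing `y`. -/
def ddist {n : ℕ} (k : ℕ) (g : (Fin n → ℝ) → ℂ) (y : Fin n → ℝ) : ℝ≥0∞ :=
  dnum n k * ∫⁻ y' in dcube k (dyad k y), ‖g y - g y'‖ₑ ∂μT n

/-- Mean oscillation of `g` over a dyadic cube. -/
def dosc {n : ℕ} (k : ℕ) (i : Fin n → ℤ) (g : (Fin n → ℝ) → ℂ) : ℝ≥0∞ :=
  dnum n k * ∫⁻ y in dcube k i, (dnum n k * ∫⁻ y' in dcube k i, ‖g y - g y'‖ₑ ∂μT n) ∂μT n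

section dyadic

variable {n : ℕ}

lemma dnum_ne_zero (n k : ℕ) : dnum n k ≠ 0 := by simp [dnum]

lemma dnum_ne_top (n k : ℕ) : dnum n k ≠ ∞ := by simp [dnum]

lemma dnum_succ (n k : ℕ) : dnum n (k + 1) = 2 ^ n * dnum n k := by
  rw [dnum, dnum, ← pow_add]; congr 1; ring

lemma measurable_dyad (k : ℕ) : Measurable (dyad k : (Fin n → ℝ) → _) := by
  unfold dyad
  refine measurable_pi_lambda _ fun l => Int.measurable_floor.comp ?_
  exact (measurable_fract.comp (measurable_pi_apply l)).const_mul _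

lemma measurableSet_dcube (k : ℕ) (i : Fin n → ℤ) : MeasurableSet (dcube k i) :=
  measurable_dyad k (measurableSet_singleton i)

@[simp] lemma mem_dcube {k : ℕ} {i : Fin n → ℤ} {x : Fin n → ℝ} : x ∈ dcube k i ↔ dyad k x = i :=
  Iff.rfl

lemma dyad_zero (x : Fin n → ℝ) : dyad 0 x = 0 := by
  ext l
  simp only [dyad, pow_zero, one_mul, Int.floor_fract, Pi.zero_apply]

lemma dyad_nonneg (k : ℕ) (x : Fin n → ℝ) (l : Fin n) : 0 ≤ dyad k x l :=
  Int.floor_nonneg.2 (mul_nonneg (by positivity) (Int.fract_nonneg _))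

lemma dyad_lt (k : ℕ) (x : Fin n → ℝ) (l : Fin n) : dyad k x l < 2 ^ k := by
  rw [dyad, Int.floor_lt]
  push_cast
  have := Int.fract_lt_one (x l)
  have h2 : (0 : ℝ) < 2 ^ k := by positivity
  nlinarith

lemma dyad_eq_div (k : ℕ) (x : Fin n → ℝ) (l : Fin n) : dyad k x l = dyad (k + 1) x l / 2 := by
  have h : (2 : ℝ) ^ k * Int.fract (x l) = (2 ^ (k + 1) * Int.fract (x l)) / (2 : ℕ) := by
    push_cast; rw [pow_succ]; ring
  simp only [dyad]
  rw [h, Int.floor_div_natCast]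
  rfl

lemma dyad_mono {k k' : ℕ} (hk : k ≤ k') {x y : Fin n → ℝ} (h : dyad k' x = dyad k' y) :
    dyad k x = dyad k y := by
  induction k', hk using Nat.le_induction with
  | base => exact h
  | succ m _ ih =>
    refine ih ?_
    ext l
    rw [dyad_eq_div, dyad_eq_div m y, h]

lemma abs_fract_sub_lt {k : ℕ} {x y : Fin n → ℝ} (h : dyad k x = dyad k y) (l : Fin n) :
    |Int.fract (x l) - Int.fract (y l)| < 2⁻¹ ^ k := by
  have h1 := Int.abs_sub_lt_one_of_floor_eq_floor (congrFun h l)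
  rw [← mul_sub, abs_mul, abs_of_pos (by positivity : (0 : ℝ) < 2 ^ k)] at h1
  rw [inv_pow, ← one_div, lt_div_iff₀ (by positivity)]
  linarith

lemma volume_dcube_inter (k : ℕ) (i : Fin n → ℤ) (hi : ∀ l, 0 ≤ i l ∧ i l < 2 ^ k) :
    μT n (dcube k i) = (dnum n k)⁻¹ := by
  rw [μT, Measure.restrict_apply (measurableSet_dcube k i)]
  have : dcube k i ∩ cube n =
      Set.univ.pi fun l => Set.Ico ((i l : ℝ) / 2 ^ k) ((i l + 1 : ℝ) / 2 ^ k) := by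
    ext x
    simp only [Set.mem_inter_iff, mem_dcube, cube, Set.mem_pi, Set.mem_univ, true_imp_iff,
      funext_iff, dyad, Int.floor_eq_iff, ← forall_and, Set.mem_Ico]
    refine forall_congr' fun l => ?_
    have h2 : (0 : ℝ) < 2 ^ k := by positivity
    rw [div_le_iff₀ h2, lt_div_iff₀ h2]
    have h0 : (0 : ℝ) ≤ i l := by exact_mod_cast (hi l).1
    have h1 : (i l : ℝ) + 1 ≤ 2 ^ k := by exact_mod_cast (hi l).2
    constructor
    · rintro ⟨⟨h3, h4⟩, h5⟩
      rw [Int.fract_eq_self.2 h5] at h3 h4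
      constructor <;> linarith
    · rintro ⟨h3, h4⟩
      have h5 : 0 ≤ x l ∧ x l < 1 := by
        constructor
        · by_contra hx; push Not at hx; nlinarith
        · by_contra hx; push Not at hx; nlinarith
      rw [Int.fract_eq_self.2 h5]
      exact ⟨⟨by linarith, by linarith⟩, h5⟩
  rw [this, Real.volume_pi_Ico]
  have h : ∀ l, ENNReal.ofReal ((i l + 1 : ℝ) / 2 ^ k - (i l : ℝ) / 2 ^ k) = (2 ^ k)⁻¹ := by
    intro l
    rw [← sub_div, add_sub_cancel_left, one_div, ENNReal.ofReal_inv_of_pos (by positivity),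
      ENNReal.ofReal_pow (by norm_num), ENNReal.ofReal_ofNat]
  rw [Finset.prod_congr rfl fun l _ => h l, Finset.prod_const, Finset.card_univ, Fintype.card_fin,
    dnum, pow_mul, ENNReal.inv_pow, ENNReal.inv_pow, ENNReal.inv_pow]

lemma μT_dcube_dyad (k : ℕ) (x : Fin n → ℝ) : μT n (dcube k (dyad k x)) = (dnum n k)⁻¹ :=
  volume_dcube_inter k _ fun l => ⟨dyad_nonneg k x l, dyad_lt k x l⟩

lemma lintegral_dyad (k : ℕ) (φ : (Fin n → ℤ) → ℝ≥0∞) :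
    ∫⁻ x, φ (dyad k x) ∂μT n = ∑' i, φ i * μT n (dcube k i) := by
  have := lintegral_map (μ := μT n) (f := φ) (g := dyad k) (measurable_of_countable _)
    (measurable_dyad k)
  rw [← this, lintegral_countable']
  congr 1; ext i
  rw [Measure.map_apply (measurable_dyad k) (measurableSet_singleton i)]
  rfl

lemma measurable_comp_dyad {β : Type*} [MeasurableSpace β] (k : ℕ) (φ : (Fin n → ℤ) → β) :
    Measurable fun x : Fin n → ℝ => φ (dyad k x) :=
  (measurable_of_countable φ).comp (measurable_dyad k)

lemma measurable_davg (k : ℕ) (F : (Fin n → ℝ) → ℝ≥0∞) : Measurable (davg k F) :=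
  measurable_comp_dyad k fun i => dnum n k * ∫⁻ y in dcube k i, F y ∂μT n

lemma measurable_dmax (F : (Fin n → ℝ) → ℝ≥0∞) : Measurable (dmax F) :=
  .iSup fun k => measurable_davg k F

lemma davg_congr {k : ℕ} {x y : Fin n → ℝ} (h : dyad k x = dyad k y) (F : (Fin n → ℝ) → ℝ≥0∞) :
    davg k F x = davg k F y := by rw [davg, davg, h]

lemma davg_mono {F G : (Fin n → ℝ) → ℝ≥0∞} (h : ∀ x, F x ≤ G x) (k : ℕ) (x : Fin n → ℝ) :
    davg k F x ≤ davg k G x := by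
  unfold davg; gcongr; exact h _

lemma davg_add {F G : (Fin n → ℝ) → ℝ≥0∞} (hF : Measurable F) (k : ℕ) (x : Fin n → ℝ) :
    davg k (fun x => F x + G x) x = davg k F x + davg k G x := by
  rw [davg, lintegral_add_left hF, mul_add]; rfl

lemma davg_const (c : ℝ≥0∞) (k : ℕ) (x : Fin n → ℝ) : davg k (fun _ => c) x = c := by
  rw [davg, setLIntegral_const, μT_dcube_dyad, mul_left_comm,
    ENNReal.mul_inv_cancel (dnum_ne_zero n k) (dnum_ne_top n k), mul_one]

lemma davg_congr_cube {F G : (Fin n → ℝ) → ℝ≥0∞} {k : ℕ} {x : Fin n → ℝ}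
    (h : ∀ y, dyad k y = dyad k x → F y = G y) : davg k F x = davg k G x := by
  rw [davg, davg, setLIntegral_congr_fun (measurableSet_dcube k _) h]

lemma davg_zero (F : (Fin n → ℝ) → ℝ≥0∞) (x : Fin n → ℝ) : davg 0 F x = ∫⁻ y, F y ∂μT n := by
  have : dcube 0 (dyad 0 x) = Set.univ := by ext y; simp [dyad_zero]
  rw [davg, this, Measure.restrict_univ, dnum, zero_mul, pow_zero, one_mul]

lemma davg_succ_le (k : ℕ) (F : (Fin n → ℝ) → ℝ≥0∞) (x : Fin n → ℝ) :
    davg (k + 1) F x ≤ 2 ^ n * davg k F x := by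
  rw [davg, davg, dnum_succ, mul_assoc]
  gcongr
  intro y hy
  exact dyad_mono (Nat.le_succ k) hy

lemma setLIntegral_davg {S : Set (Fin n → ℝ)} {k : ℕ}
    (hS : ∀ x y, dyad k x = dyad k y → x ∈ S → y ∈ S) (F : (Fin n → ℝ) → ℝ≥0∞) :
    ∫⁻ x in S, davg k F x ∂μT n = ∫⁻ x in S, F x ∂μT n := by
  set I : Set (Fin n → ℤ) := dyad k '' S with hI
  have hSI : S = ⋃ i : I, dcube k i := by
    ext x
    simp only [Set.mem_iUnion, mem_dcube]
    constructor
    · intro hx; exact ⟨⟨_, x, hx, rfl⟩, rfl⟩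
    · rintro ⟨⟨_, y, hy, rfl⟩, h⟩
      exact hS y x h.symm hy
  have hd : Pairwise (Function.onFun Disjoint fun i : I => dcube k (i : Fin n → ℤ)) := by
    intro i j hij
    refine Set.disjoint_left.2 fun x hx hy => hij ?_
    exact Subtype.ext (hx.symm.trans hy)
  rw [hSI, lintegral_iUnion (fun i => measurableSet_dcube k _) hd,
    lintegral_iUnion (fun i => measurableSet_dcube k _) hd]
  congr 1; ext ⟨_, y, hy, rfl⟩
  have : ∀ x ∈ dcube k (dyad k y), davg k F x = davg k F y := fun x hx => davg_congr hx F
  rw [setLIntegral_congr_fun (measurableSet_dcube k _) this, setLIntegral_const, μT_dcube_dyad,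
    davg, mul_right_comm, ENNReal.mul_inv_cancel (dnum_ne_zero n k) (dnum_ne_top n k), one_mul]

lemma lintegral_davg (k : ℕ) (F : (Fin n → ℝ) → ℝ≥0∞) :
    ∫⁻ x, davg k F x ∂μT n = ∫⁻ x, F x ∂μT n := by
  simpa using setLIntegral_davg (S := Set.univ) (k := k) (by simp) F

/-- First generation at which the dyadic average exceeds `t`. -/
def stopSet (F : (Fin n → ℝ) → ℝ≥0∞) (t : ℝ≥0∞) (k : ℕ) : Set (Fin n → ℝ) :=
  {x | t < davg k F x ∧ ∀ j < k, davg j F x ≤ t}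

lemma stop_saturated (F : (Fin n → ℝ) → ℝ≥0∞) (t : ℝ≥0∞) (k : ℕ) :
    ∀ x y, dyad k x = dyad k y → x ∈ stopSet F t k → y ∈ stopSet F t k := by
  rintro x y h ⟨h1, h2⟩
  refine ⟨by rwa [← davg_congr h], fun j hj => ?_⟩
  rw [← davg_congr (dyad_mono hj.le h)]
  exact h2 j hj

lemma measurableSet_of_saturated {S : Set (Fin n → ℝ)} {k : ℕ}
    (hS : ∀ x y, dyad k x = dyad k y → x ∈ S → y ∈ S) : MeasurableSet S := by
  have : S = dyad k ⁻¹' (dyad k '' S) := by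
    refine (Set.subset_preimage_image _ _).antisymm ?_
    rintro x ⟨y, hy, h⟩
    exact hS y x h hy
  rw [this]
  exact measurable_dyad k (Set.to_countable _).measurableSet

lemma measurableSet_stop (F : (Fin n → ℝ) → ℝ≥0∞) (t : ℝ≥0∞) (k : ℕ) :
    MeasurableSet (stopSet F t k) := measurableSet_of_saturated (stop_saturated F t k)

lemma disjoint_stop (F : (Fin n → ℝ) → ℝ≥0∞) (t : ℝ≥0∞) :
    Pairwise (Function.onFun Disjoint (stopSet F t)) := by
  intro k k' hk
  refine Set.disjoint_left.2 fun x hx hx' => ?_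
  rcases lt_or_gt_of_ne hk with h | h
  · exact absurd hx.1 (not_lt.2 (hx'.2 k h))
  · exact absurd hx'.1 (not_lt.2 (hx.2 k' h))

lemma iUnion_stop (F : (Fin n → ℝ) → ℝ≥0∞) (t : ℝ≥0∞) :
    ⋃ k, stopSet F t k = {x | t < dmax F x} := by
  classical
  ext x
  simp only [Set.mem_iUnion, Set.mem_ofPred_eq, dmax, lt_iSup_iff]
  constructor
  · rintro ⟨k, hk⟩; exact ⟨k, hk.1⟩
  · intro h
    refine ⟨Nat.find h, Nat.find_spec h, fun j hj => ?_⟩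
    exact not_lt.1 (Nat.find_min h hj)

lemma mul_μT_dmax_le (F : (Fin n → ℝ) → ℝ≥0∞) (t : ℝ≥0∞) :
    t * μT n {x | t < dmax F x} ≤ ∫⁻ x, F x ∂μT n := by
  rw [← iUnion_stop, measure_iUnion (disjoint_stop F t) (measurableSet_stop F t),
    ← ENNReal.tsum_mul_left]
  calc _ ≤ ∑' k, ∫⁻ x in stopSet F t k, F x ∂μT n := by
        refine ENNReal.tsum_le_tsum fun k => ?_
        rw [← setLIntegral_davg (stop_saturated F t k), ← setLIntegral_const]
        exact setLIntegral_mono' (measurableSet_stop F t k) fun x hx => hx.1.le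
    _ = ∫⁻ x in ⋃ k, stopSet F t k, F x ∂μT n :=
        (lintegral_iUnion (measurableSet_stop F t) (disjoint_stop F t) _).symm
    _ ≤ _ := setLIntegral_le_lintegral _ _

end dyadic

section sharp

variable {n : ℕ} {g : (Fin n → ℝ) → ℂ}

lemma measurable_ddist (hg : Measurable g) (k : ℕ) : Measurable (ddist k g) := by
  have h1 : ddist k g = fun y => dnum n k * ∫⁻ y', (if dyad k y' = dyad k y then 1 else 0) *
      ‖g y - g y'‖ₑ ∂μT n := by
    ext y
    rw [ddist, ← lintegral_indicator (measurableSet_dcube k _)]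
    congr 2; ext y'
    by_cases h : dyad k y' = dyad k y <;> simp [Set.indicator, h]
  rw [h1]
  refine Measurable.const_mul ?_ _
  have hm : Measurable fun z : (Fin n → ℝ) × (Fin n → ℝ) =>
      (if dyad k z.2 = dyad k z.1 then (1 : ℝ≥0∞) else 0) * ‖g z.1 - g z.2‖ₑ := by
    refine Measurable.mul (Measurable.ite ?_ measurable_const measurable_const) ?_
    · exact measurableSet_eq_fun ((measurable_dyad k).comp measurable_snd)
        ((measurable_dyad k).comp measurable_fst)
    · exact ((hg.comp measurable_fst).sub (hg.comp measurable_snd)).enorm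
  exact hm.lintegral_prod_right'

lemma davg_ddist (k : ℕ) (g : (Fin n → ℝ) → ℂ) (x : Fin n → ℝ) :
    davg k (ddist k g) x = dosc k (dyad k x) g := by
  rw [davg, dosc]
  congr 1
  refine setLIntegral_congr_fun (measurableSet_dcube k _) fun y hy => ?_
  rw [mem_dcube] at hy
  simp only [ddist, hy]

/-- Dyadic sharp maximal function. -/
def dsharp (g : (Fin n → ℝ) → ℂ) (x : Fin n → ℝ) : ℝ≥0∞ := ⨆ k, dosc k (dyad k x) g

lemma measurable_dsharp (g : (Fin n → ℝ) → ℂ) : Measurable (dsharp g) :=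
  .iSup fun k => measurable_comp_dyad k fun i => dosc k i g

lemma enorm_le_ddist_add (hg : Measurable g) (k : ℕ) (y : Fin n → ℝ) :
    ‖g y‖ₑ ≤ ddist k g y + davg k (fun y => ‖g y‖ₑ) y := by
  calc ‖g y‖ₑ = davg k (fun _ => ‖g y‖ₑ) y := (davg_const _ _ _).symm
    _ ≤ davg k (fun y' => ‖g y - g y'‖ₑ + ‖g y'‖ₑ) y := by
        refine davg_mono (fun y' => ?_) k y
        simpa using enorm_add_le (g y - g y') (g y')
    _ = _ := by
        rw [davg_add]
        · rfl
        · exact (measurable_const.sub hg).enorm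

lemma good_lambda_stop (hg : Measurable g) {t c : ℝ≥0∞} (ht : t ≠ ∞) (k : ℕ) :
    2 * t * μT n (stopSet (fun y => ‖g y‖ₑ) t (k + 1) ∩
      {x | 3 * t < dmax (fun y => ‖g y‖ₑ) x ∧ dsharp g x ≤ c * t}) ≤
      2 ^ n * (c * t) * μT n (stopSet (fun y => ‖g y‖ₑ) t (k + 1)) := by
  set G : (Fin n → ℝ) → ℝ≥0∞ := fun y => ‖g y‖ₑ
  set S := stopSet G t (k + 1) ∩ {x | dosc k (dyad k x) g ≤ c * t} with hS
  have hSs : ∀ x y, dyad (k + 1) x = dyad (k + 1) y → x ∈ S → y ∈ S := by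
    rintro x y h ⟨h1, h2⟩
    refine ⟨stop_saturated G t _ x y h h1, ?_⟩
    simp only [Set.mem_ofPred_eq] at h2 ⊢
    rwa [← dyad_mono (Nat.le_succ k) h]
  have hSm := measurableSet_of_saturated hSs
  set H := S.indicator (ddist k g)
  have hHm : Measurable H := (measurable_ddist hg k).indicator hSm
  have hsub : stopSet G t (k + 1) ∩ {x | 3 * t < dmax G x ∧ dsharp g x ≤ c * t} ⊆
      {x | 2 * t < dmax H x} := by
    rintro x ⟨hx, h3, hsh⟩
    have hxS : x ∈ S := ⟨hx, (le_iSup (fun k => dosc k (dyad k x) g) k).trans hsh⟩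
    obtain ⟨k', hk'⟩ := lt_iSup_iff.1 h3
    have hkk : k + 1 ≤ k' := by
      by_contra hlt
      push Not at hlt
      have := hx.2 k' hlt
      refine absurd (hk'.trans_le this) (not_lt.2 ?_)
      exact le_mul_of_one_le_left (zero_le) (by norm_num)
    change 2 * t < ⨆ k, davg k H x
    refine lt_iSup_iff.2 ⟨k', ?_⟩
    have h4 : davg k' G x ≤ davg k' H x + t := by
      calc davg k' G x ≤ davg k' (fun y => ddist k g y + davg k G y) x :=
            davg_mono (enorm_le_ddist_add hg k) k' x
        _ = davg k' (fun y => H y + davg k G x) x := by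
            refine davg_congr_cube fun y hy => ?_
            have h5 : dyad (k + 1) y = dyad (k + 1) x := dyad_mono hkk hy
            have hyS : y ∈ S := hSs x y h5.symm hxS
            rw [davg_congr (dyad_mono (Nat.le_succ k) h5), show H y = ddist k g y from
              Set.indicator_of_mem hyS _]
        _ = davg k' H x + davg k G x := by rw [davg_add hHm, davg_const]
        _ ≤ _ := by gcongr; exact hx.2 k (Nat.lt_succ_self k)
    have h6 := hk'.trans_le h4
    rw [show (3 : ℝ≥0∞) * t = 2 * t + t by ring] at h6
    exact (ENNReal.add_lt_add_iff_right ht).1 h6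
  calc _ ≤ 2 * t * μT n {x | 2 * t < dmax H x} := by gcongr
    _ ≤ ∫⁻ x, H x ∂μT n := mul_μT_dmax_le H _
    _ = ∫⁻ x in S, davg (k + 1) (ddist k g) x ∂μT n := by
        rw [lintegral_indicator hSm, setLIntegral_davg hSs]
    _ ≤ ∫⁻ x in S, 2 ^ n * (c * t) ∂μT n := by
        refine setLIntegral_mono' hSm fun x hx => ?_
        refine (davg_succ_le k _ x).trans ?_
        rw [davg_ddist]
        gcongr
        exact hx.2
    _ = 2 ^ n * (c * t) * μT n S := setLIntegral_const _ _
    _ ≤ _ := by gcongr; exact Set.inter_subset_left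

lemma good_lambda (hg : Measurable g) {t c : ℝ≥0∞} (ht : t ≠ ∞) (ht0 : t ≠ 0)
    (hgt : ∫⁻ y, ‖g y‖ₑ ∂μT n ≤ t) :
    μT n {x | 3 * t < dmax (fun y => ‖g y‖ₑ) x} ≤
      2 ^ n * c * μT n {x | t < dmax (fun y => ‖g y‖ₑ) x} + μT n {x | c * t < dsharp g x} := by
  set G : (Fin n → ℝ) → ℝ≥0∞ := fun y => ‖g y‖ₑ
  set A : Set (Fin n → ℝ) := {x | 3 * t < dmax G x ∧ dsharp g x ≤ c * t}
  have h0 : stopSet G t 0 = ∅ := by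
    ext x
    simp only [stopSet, Set.mem_ofPred_eq, davg_zero, Set.mem_empty_iff_false, iff_false, not_and]
    intro h; exact absurd hgt (not_le.2 h)
  have hAm : MeasurableSet A := ((measurableSet_lt measurable_const (measurable_dmax G))).inter
    (measurableSet_le (measurable_dsharp g) measurable_const)
  have hA : A = ⋃ k, stopSet G t k ∩ A := by
    rw [← Set.iUnion_inter, iUnion_stop, eq_comm, Set.inter_eq_right]
    intro x hx
    exact lt_of_le_of_lt (le_mul_of_one_le_left zero_le (by norm_num)) hx.1
  have hk : ∀ k, μT n (stopSet G t k ∩ A) ≤ 2 ^ n * c * μT n (stopSet G t k) := by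
    intro k
    cases k with
    | zero => simp [h0]
    | succ k =>
      have h := good_lambda_stop (c := c) hg ht k
      have h1 : t * μT n (stopSet G t (k + 1) ∩ A) ≤
          t * (2 ^ n * c * μT n (stopSet G t (k + 1))) := by
        calc _ ≤ 2 * t * μT n (stopSet G t (k + 1) ∩ A) := by
              gcongr; exact le_mul_of_one_le_left zero_le (by norm_num)
          _ ≤ _ := h
          _ = _ := by ring
      exact (ENNReal.mul_le_mul_iff_right ht0 ht).1 h1
  have hAle : μT n A ≤ 2 ^ n * c * μT n {x | t < dmax G x} := by
    rw [hA, ← iUnion_stop, measure_iUnion (disjoint_stop G t) (measurableSet_stop G t),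
      ← ENNReal.tsum_mul_left]
    exact (measure_iUnion_le _).trans (ENNReal.tsum_le_tsum hk)
  refine (measure_mono (t := A ∪ {x | c * t < dsharp g x}) ?_).trans
    ((measure_union_le _ _).trans (by gcongr))
  intro x hx
  rcases le_or_gt (dsharp g x) (c * t) with h | h
  · exact Or.inl ⟨hx, h⟩
  · exact Or.inr h

lemma lintegral_rpow_layercake {α : Type*} [MeasurableSpace α] (μ : Measure α) {F : α → ℝ≥0∞}
    (hF : Measurable F) (hfin : ∀ x, F x ≠ ∞) {p : ℝ} (hp : 0 < p) :
    ∫⁻ x, F x ^ p ∂μ =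
      ENNReal.ofReal p * ∫⁻ t in Set.Ioi (0 : ℝ),
        μ {x | ENNReal.ofReal t < F x} * ENNReal.ofReal (t ^ (p - 1)) := by
  have h := lintegral_rpow_eq_lintegral_meas_lt_mul μ (f := fun x => (F x).toReal)
    (ae_of_all _ fun x => ENNReal.toReal_nonneg) hF.ennreal_toReal.aemeasurable hp
  have h1 : ∀ x, ENNReal.ofReal ((F x).toReal ^ p) = F x ^ p := fun x => by
    rw [← ENNReal.ofReal_rpow_of_nonneg ENNReal.toReal_nonneg hp.le, ENNReal.ofReal_toReal (hfin x)]
  simp_rw [h1] at h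
  rw [h]
  congr 1
  refine setLIntegral_congr_fun measurableSet_Ioi fun t ht => ?_
  congr 2
  ext x
  exact (ENNReal.ofReal_lt_iff_lt_toReal (le_of_lt ht) (hfin x)).symm

lemma lintegral_rpow_layercake_mul {α : Type*} [MeasurableSpace α] (μ : Measure α) {F : α → ℝ≥0∞}
    (hF : Measurable F) (hfin : ∀ x, F x ≠ ∞) {p : ℝ} (hp : 0 < p) {c : ℝ≥0∞} (hc0 : c ≠ 0)
    (hc : c ≠ ∞) :
    (c⁻¹) ^ p * ∫⁻ x, F x ^ p ∂μ =
      ENNReal.ofReal p * ∫⁻ t in Set.Ioi (0 : ℝ),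
        μ {x | c * ENNReal.ofReal t < F x} * ENNReal.ofReal (t ^ (p - 1)) := by
  have h := lintegral_rpow_layercake μ (F := fun x => c⁻¹ * F x) (hF.const_mul _)
    (fun x => ENNReal.mul_ne_top (ENNReal.inv_ne_top.2 hc0) (hfin x)) hp
  simp_rw [ENNReal.mul_rpow_of_nonneg _ _ hp.le] at h
  rw [lintegral_const_mul' _ _
    (ENNReal.rpow_ne_top_of_nonneg hp.le (ENNReal.inv_ne_top.2 hc0))] at h
  rw [h]
  congr 3; ext t
  congr 3; ext x
  rw [mul_comm c⁻¹, ← div_eq_mul_inv, ENNReal.lt_div_iff_mul_lt (Or.inl hc0) (Or.inl hc), mul_comm]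

lemma dosc_le (hg : Measurable g) (k : ℕ) (x : Fin n → ℝ) :
    dosc k (dyad k x) g ≤ 2 * davg k (fun y => ‖g y‖ₑ) x := by
  rw [← davg_ddist]
  calc davg k (ddist k g) x ≤ davg k (fun y => ‖g y‖ₑ + davg k (fun y => ‖g y‖ₑ) y) x := by
        refine davg_mono (fun y => ?_) k x
        calc ddist k g y = davg k (fun y' => ‖g y - g y'‖ₑ) y := rfl
          _ ≤ davg k (fun y' => ‖g y‖ₑ + ‖g y'‖ₑ) y := davg_mono (fun y' => enorm_sub_le) k y
          _ = _ := by rw [davg_add measurable_const, davg_const]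
    _ = davg k (fun y => ‖g y‖ₑ) x + davg k (fun _ => davg k (fun y => ‖g y‖ₑ) x) x := by
        rw [davg_add hg.enorm]
        congr 1
        exact davg_congr_cube fun y hy => davg_congr hy _
    _ = _ := by rw [davg_const, two_mul]

lemma dsharp_le (hg : Measurable g) (x : Fin n → ℝ) :
    dsharp g x ≤ 2 * dmax (fun y => ‖g y‖ₑ) x :=
  iSup_le fun k => (dosc_le hg k x).trans (by
    gcongr; exact le_iSup (fun k => davg k (fun y => ‖g y‖ₑ) x) k)

lemma dmax_le {F : (Fin n → ℝ) → ℝ≥0∞} {B : ℝ≥0∞} (h : ∀ x, F x ≤ B) (x : Fin n → ℝ) :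
    dmax F x ≤ B :=
  iSup_le fun k => (davg_mono h k x).trans (davg_const B k x).le

lemma Bdd.exists_enorm_le {f : (Fin n → ℝ) → ℂ} (hf : Bdd f) :
    ∃ B : ℝ≥0∞, B ≠ ∞ ∧ ∀ x, ‖f x‖ₑ ≤ B := by
  obtain ⟨B, hB⟩ := hf.bound
  refine ⟨ENNReal.ofReal B, ENNReal.ofReal_ne_top, fun x => ?_⟩
  rw [← ofReal_norm]
  exact ENNReal.ofReal_le_ofReal (hB x)

lemma lintegral_dmax_rpow_le (n : ℕ) {p : ℝ} (hp : 0 < p) :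
    ∃ C : ℝ≥0∞, C ≠ ∞ ∧ ∀ g : (Fin n → ℝ) → ℂ, Bdd g →
      ∫⁻ x, dmax (fun y => ‖g y‖ₑ) x ^ p ∂μT n ≤
        C * ((∫⁻ x, ‖g x‖ₑ ∂μT n) ^ p + ∫⁻ x, dsharp g x ^ p ∂μT n) := by
  set c : ℝ≥0∞ := (2 ^ n)⁻¹ * (2⁻¹ * (3⁻¹) ^ p) with hc
  have h3 : (3⁻¹ : ℝ≥0∞) ≠ ∞ := by simp
  have h30 : (3⁻¹ : ℝ≥0∞) ≠ 0 := by simp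
  have hs0 : (3⁻¹ : ℝ≥0∞) ^ p ≠ 0 := by
    rw [Ne, ENNReal.rpow_eq_zero_iff]; push Not
    exact ⟨fun h => absurd h h30, fun h => absurd h h3⟩
  have hst : (3⁻¹ : ℝ≥0∞) ^ p ≠ ∞ := ENNReal.rpow_ne_top_of_nonneg hp.le h3
  have hc0 : c ≠ 0 := by
    refine mul_ne_zero (by simp) (mul_ne_zero (by simp) hs0)
  have hct : c ≠ ∞ := ENNReal.mul_ne_top (by simp) (ENNReal.mul_ne_top (by simp) hst)
  have h2c : 2 ^ n * c = 2⁻¹ * (3⁻¹ : ℝ≥0∞) ^ p := by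
    rw [hc, ← mul_assoc, ENNReal.mul_inv_cancel (by simp) (by simp), one_mul]
  refine ⟨2 * (3⁻¹ ^ p)⁻¹ * (1 + (c⁻¹) ^ p), ?_, ?_⟩
  · refine ENNReal.mul_ne_top (ENNReal.mul_ne_top (by simp) (ENNReal.inv_ne_top.2 hs0)) ?_
    exact ENNReal.add_ne_top.2 ⟨by simp, ENNReal.rpow_ne_top_of_nonneg hp.le (ENNReal.inv_ne_top.2
        hc0)⟩
  intro g hg
  obtain ⟨B, hBt, hB⟩ := hg.exists_enorm_le
  set G : (Fin n → ℝ) → ℝ≥0∞ := fun y => ‖g y‖ₑ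
  set M := dmax G
  have hMB : ∀ x, M x ≤ B := dmax_le hB
  have hMfin : ∀ x, M x ≠ ∞ := fun x => ne_top_of_le_ne_top hBt (hMB x)
  have hSfin : ∀ x, dsharp g x ≠ ∞ := fun x =>
    ne_top_of_le_ne_top (ENNReal.mul_ne_top (by simp) (hMfin x)) (dsharp_le hg.meas x)
  set l0 := ∫⁻ x, G x ∂μT n
  have hl0 : l0 ≠ ∞ := by
    refine ne_top_of_le_ne_top hBt ((lintegral_mono hB).trans ?_)
    simp
  have e1 := lintegral_rpow_layercake_mul (μT n) (measurable_dmax G) hMfin hp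
    (c := 3) (by simp) (by simp)
  have e2 := lintegral_rpow_layercake (μT n) (measurable_dmax G) hMfin hp
  have e3 := lintegral_rpow_layercake_mul (μT n) (measurable_dsharp g) hSfin hp hc0 hct
  have e4 := lintegral_rpow_layercake (μT n) (F := fun _ => l0) measurable_const (fun _ => hl0) hp
  rw [lintegral_const, measure_univ, mul_one] at e4
  have main : (3⁻¹ : ℝ≥0∞) ^ p * ∫⁻ x, M x ^ p ∂μT n ≤
      l0 ^ p + (2 ^ n * c * ∫⁻ x, M x ^ p ∂μT n + (c⁻¹) ^ p * ∫⁻ x, dsharp g x ^ p ∂μT n) := by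
    rw [e1, e2, e3, e4, mul_left_comm, ← mul_add, ← mul_add]
    gcongr
    rw [← lintegral_const_mul' _ _ (ENNReal.mul_ne_top (by simp) hct), ← lintegral_add_left,
      ← lintegral_add_left]
    · refine setLIntegral_mono' measurableSet_Ioi fun t ht => ?_
      rw [← mul_assoc, ← add_mul, ← add_mul]
      gcongr
      rcases lt_or_ge (ENNReal.ofReal t) l0 with h | h
      · refine le_add_right ?_
        have : {x : Fin n → ℝ | ENNReal.ofReal t < l0} = Set.univ := by ext; simp [h]
        rw [this]
        exact measure_mono (Set.subset_univ _)
      · refine le_add_left ?_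
        exact good_lambda hg.meas ENNReal.ofReal_ne_top (by simpa using ht) h
    · refine Measurable.mul ?_ (by fun_prop)
      refine Antitone.measurable ?_
      intro a b hab
      refine measure_mono fun x hx => ?_
      exact (ENNReal.ofReal_le_ofReal hab).trans_lt hx
    · refine Measurable.const_mul (Measurable.mul ?_ (by fun_prop)) _
      refine Antitone.measurable ?_
      intro a b hab
      refine measure_mono fun x hx => ?_
      exact (ENNReal.ofReal_le_ofReal hab).trans_lt hx
  set I := ∫⁻ x, M x ^ p ∂μT n
  have hI : I ≠ ∞ := by
    refine ne_top_of_le_ne_top (ENNReal.rpow_ne_top_of_nonneg hp.le hBt)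
      ((lintegral_mono fun x => ENNReal.rpow_le_rpow (hMB x) hp.le).trans ?_)
    simp
  rw [h2c] at main
  set s := (3⁻¹ : ℝ≥0∞) ^ p
  set J := ∫⁻ x, dsharp g x ^ p ∂μT n
  have h5 : s * I = 2⁻¹ * s * I + 2⁻¹ * s * I := by
    rw [← add_mul, ← add_mul, ENNReal.inv_two_add_inv_two, one_mul]
  have h6 : 2⁻¹ * s * I ≤ l0 ^ p + (c⁻¹) ^ p * J := by
    have : 2⁻¹ * s * I + 2⁻¹ * s * I ≤ 2⁻¹ * s * I + (l0 ^ p + (c⁻¹) ^ p * J) := by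
      rw [← h5]; refine main.trans_eq (by ring)
    exact (ENNReal.add_le_add_iff_left
      (ENNReal.mul_ne_top (ENNReal.mul_ne_top (by simp) hst) hI)).1 this
  calc I = 2 * s⁻¹ * (2⁻¹ * s * I) := by
        rw [show 2 * s⁻¹ * (2⁻¹ * s * I) = (2 * 2⁻¹) * (s * s⁻¹) * I by ring,
          ENNReal.mul_inv_cancel (by simp) (by simp), ENNReal.mul_inv_cancel hs0 hst, one_mul,
          one_mul]
    _ ≤ 2 * s⁻¹ * (l0 ^ p + (c⁻¹) ^ p * J) := by gcongr
    _ ≤ 2 * s⁻¹ * ((1 + (c⁻¹) ^ p) * (l0 ^ p + J)) := by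
        gcongr
        rw [show (1 + (c⁻¹) ^ p) * (l0 ^ p + J) =
          (l0 ^ p + (c⁻¹) ^ p * J) + (J + (c⁻¹) ^ p * l0 ^ p) by ring]
        exact le_self_add
    _ = _ := by ring

lemma enorm_le_dmax (hg : Continuous g) (hgp : ZPer g) (x : Fin n → ℝ) :
    ‖g x‖ₑ ≤ dmax (fun y => ‖g y‖ₑ) x := by
  have hfr : ∀ y : Fin n → ℝ, g (fun l => Int.fract (y l)) = g y := by
    intro y
    rw [← hgp (fun l => Int.fract (y l)) (fun l => ⌊y l⌋)]
    congr 1; ext l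
    exact Int.fract_add_floor _
  refine le_of_forall_lt fun a ha => ?_
  set z : Fin n → ℝ := fun l => Int.fract (x l) with hz
  rw [← hfr x] at ha
  obtain ⟨a', ha1, ha2⟩ := exists_between ha
  have hnb : ∀ᶠ y in nhds z, a' < ‖g y‖ₑ := hg.enorm.continuousAt.eventually_const_lt ha2
  obtain ⟨ε, hε, hball⟩ := Metric.eventually_nhds_iff.1 hnb
  obtain ⟨k, hk⟩ := exists_pow_lt_of_lt_one hε (by norm_num : (2⁻¹ : ℝ) < 1)
  refine lt_of_lt_of_le ha1 (le_trans ?_ (le_iSup (fun k => davg k (fun y => ‖g y‖ₑ) x) k))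
  rw [← davg_const a' k x]
  have : davg k (fun y => ‖g y‖ₑ) x = davg k (fun y => max a' ‖g y‖ₑ) x := by
    refine davg_congr_cube fun y hy => ?_
    refine (max_eq_right ?_).symm
    rw [← hfr y]
    refine (hball ?_).le
    rw [dist_pi_lt_iff hε]
    intro l
    exact (abs_fract_sub_lt hy l).trans hk
  rw [this]
  exact davg_mono (fun y => le_max_left _ _) k x

end sharp

section interpolation

variable {n : ℕ}

/-- The part of `f` where `‖f‖ ≤ t`. -/
def lowPart (f : (Fin n → ℝ) → ℂ) (t : ℝ) : (Fin n → ℝ) → ℂ :=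
  {x | ‖f x‖ₑ ≤ ENNReal.ofReal t}.indicator f

/-- The part of `f` where `‖f‖ > t`. -/
def highPart (f : (Fin n → ℝ) → ℂ) (t : ℝ) : (Fin n → ℝ) → ℂ :=
  {x | ENNReal.ofReal t < ‖f x‖ₑ}.indicator f

lemma Bdd.indicator {f : (Fin n → ℝ) → ℂ} (hf : Bdd f) {S : Set (Fin n → ℝ)}
    (hS : MeasurableSet S) : Bdd (S.indicator f) := by
  obtain ⟨B, hB⟩ := hf.bound
  exact ⟨hf.meas.indicator hS, B, fun x => (norm_indicator_le_norm_self _ _).trans (hB x)⟩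

lemma bdd_lowPart {f : (Fin n → ℝ) → ℂ} (hf : Bdd f) (t : ℝ) : Bdd (lowPart f t) :=
  hf.indicator (measurableSet_le hf.meas.enorm measurable_const)

lemma bdd_highPart {f : (Fin n → ℝ) → ℂ} (hf : Bdd f) (t : ℝ) : Bdd (highPart f t) :=
  hf.indicator (measurableSet_lt measurable_const hf.meas.enorm)

lemma lowPart_add_highPart (f : (Fin n → ℝ) → ℂ) (t : ℝ) : lowPart f t + highPart f t = f := by
  have : {x | ENNReal.ofReal t < ‖f x‖ₑ} = {x | ‖f x‖ₑ ≤ ENNReal.ofReal t}ᶜ := by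
    ext x; simp
  rw [lowPart, highPart, this, Set.indicator_self_add_compl]

lemma enorm_lowPart_le (f : (Fin n → ℝ) → ℂ) (t : ℝ) (x : Fin n → ℝ) :
    ‖lowPart f t x‖ₑ ≤ ENNReal.ofReal t := by
  by_cases h : ‖f x‖ₑ ≤ ENNReal.ofReal t
  · rw [lowPart, Set.indicator_of_mem (by exact h)]; exact h
  · rw [lowPart, Set.indicator_of_notMem (by exact h)]; simp

lemma lintegral_highPart_layercake {f : (Fin n → ℝ) → ℂ} (hf : Bdd f) {p : ℝ} (hp : 2 < p) :
    ENNReal.ofReal (p - 2) * ∫⁻ t in Set.Ioi (0 : ℝ),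
        (∫⁻ x, ‖highPart f t x‖ₑ ^ 2 ∂μT n) * ENNReal.ofReal (t ^ (p - 3)) =
      ∫⁻ x, ‖f x‖ₑ ^ p ∂μT n := by
  have h := lintegral_rpow_layercake ((μT n).withDensity fun x => ‖f x‖ₑ ^ 2) hf.meas.enorm
    (fun x => enorm_ne_top) (sub_pos.2 hp)
  rw [lintegral_withDensity_eq_lintegral_mul _ (hf.meas.enorm.pow_const 2)
    (hf.meas.enorm.pow_const _)] at h
  have e1 : ∀ x, ((fun x => ‖f x‖ₑ ^ 2) * fun x => ‖f x‖ₑ ^ (p - 2)) x = ‖f x‖ₑ ^ p := by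
    intro x
    simp only [Pi.mul_apply]
    rw [← ENNReal.rpow_two, ← ENNReal.rpow_add_of_nonneg _ _ (by norm_num) (by linarith)]
    congr 1; ring
  simp_rw [e1] at h
  rw [h]
  congr 1
  refine setLIntegral_congr_fun measurableSet_Ioi fun t ht => ?_
  have hS : MeasurableSet {x | ENNReal.ofReal t < ‖f x‖ₑ} :=
    measurableSet_lt measurable_const hf.meas.enorm
  rw [withDensity_apply _ hS, ← lintegral_indicator hS]
  congr 2
  · ext x
    by_cases hx : ENNReal.ofReal t < ‖f x‖ₑ
    · rw [highPart, Set.indicator_of_mem (by exact hx), Set.indicator_of_mem (by exact hx)]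
    · rw [highPart, Set.indicator_of_notMem (by exact hx), Set.indicator_of_notMem (by exact hx)]
      simp
  · rw [show p - 2 - 1 = p - 3 by ring]

lemma tsum_lintegral_le {ι α : Type*} [MeasurableSpace α] (μ : Measure α) (F : ι → α → ℝ≥0∞) :
    ∑' i, ∫⁻ x, F i x ∂μ ≤ ∫⁻ x, ∑' i, F i x ∂μ := by
  classical
  rw [ENNReal.tsum_eq_iSup_sum]
  refine iSup_le fun s => ?_
  have : ∑ i ∈ s, ∫⁻ x, F i x ∂μ ≤ ∫⁻ x, ∑ i ∈ s, F i x ∂μ := by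
    induction s using Finset.induction_on with
    | empty => simp
    | insert a s ha ih =>
      rw [Finset.sum_insert ha]
      simp_rw [Finset.sum_insert ha]
      exact (add_le_add_right ih _).trans (le_lintegral_add _ _)
  exact this.trans (lintegral_mono fun x => ENNReal.sum_le_tsum s)

lemma rpow_eq_lintegral_indicator {u : ℝ≥0∞} (hu : u ≠ ∞) {q : ℝ} (hq : 0 < q) :
    u ^ q = ENNReal.ofReal q * ∫⁻ t in Set.Ioi (0 : ℝ),
      {t : ℝ | ENNReal.ofReal t < u}.indicator 1 t * ENNReal.ofReal (t ^ (q - 1)) := by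
  have h := lintegral_rpow_layercake (μT 1) (F := fun _ => u) measurable_const (fun _ => hu) hq
  rw [lintegral_const, measure_univ, mul_one] at h
  rw [h]
  congr 3; ext t
  congr 1
  by_cases ht : ENNReal.ofReal t < u <;> simp [ht]

/-- Interpolation between a weighted `L²` bound and weighted sup bounds for a family of
sublinear functionals. -/
lemma tsum_interpolation {Y : Type*} (A : Y → ((Fin n → ℝ) → ℂ) → ℝ≥0∞) (v w : Y → ℝ≥0∞)
    (hw0 : ∀ y, w y ≠ 0) (hwt : ∀ y, w y ≠ ∞) (a : ℝ≥0∞)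
    (hsub : ∀ y f g, Bdd f → Bdd g → A y (f + g) ≤ A y f + A y g)
    (hL2 : ∀ f, Bdd f → ∑' y, v y * A y f ^ 2 ≤ a * ∫⁻ x, ‖f x‖ₑ ^ 2 ∂μT n)
    (hLinf : ∀ y f, Bdd f → ∀ B : ℝ≥0∞, B ≠ ∞ → (∀ x, ‖f x‖ₑ ≤ B) → w y * A y f ≤ B)
    {p : ℝ} (hp : 2 < p) {f : (Fin n → ℝ) → ℂ} (hf : Bdd f) :
    ∑' y, v y * w y ^ (p - 2) * A y f ^ p ≤
      4 * 2 ^ (p - 2) * a * ∫⁻ x, ‖f x‖ₑ ^ p ∂μT n := by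
  have hp2 : 0 < p - 2 := sub_pos.2 hp
  obtain ⟨B, hBt, hB⟩ := hf.exists_enorm_le
  set u : Y → ℝ≥0∞ := fun y => w y * A y f * 2⁻¹ with hu
  have hut : ∀ y, u y ≠ ∞ := fun y =>
    ENNReal.mul_ne_top (ne_top_of_le_ne_top hBt (hLinf y f hf B hBt hB)) (by simp)
  have hAt : ∀ y, A y f ≠ ∞ := fun y h => by
    have := hLinf y f hf B hBt hB
    rw [h, ENNReal.mul_top (hw0 y)] at this
    exact hBt (top_le_iff.1 this)
  have key : ∀ y t, ENNReal.ofReal t < u y → A y f ^ 2 ≤ 4 * A y (highPart f t) ^ 2 := by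
    intro y t ht
    have h1 : A y f ≤ A y (lowPart f t) + A y (highPart f t) := by
      conv_lhs => rw [← lowPart_add_highPart f t]
      exact hsub y _ _ (bdd_lowPart hf t) (bdd_highPart hf t)
    have h2 : w y * A y (lowPart f t) ≤ w y * (A y f * 2⁻¹) := by
      refine (hLinf y _ (bdd_lowPart hf t) _ ENNReal.ofReal_ne_top (enorm_lowPart_le f t)).trans ?_
      rw [← mul_assoc]; exact ht.le
    have h3 := (ENNReal.mul_le_mul_iff_right (hw0 y) (hwt y)).1 h2
    have h4 : A y f * 2⁻¹ + A y f * 2⁻¹ ≤ A y f * 2⁻¹ + A y (highPart f t) := by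
      rw [← mul_add, ENNReal.inv_two_add_inv_two, mul_one]
      exact h1.trans (by gcongr)
    have h5 := (ENNReal.add_le_add_iff_left (ENNReal.mul_ne_top (hAt y) (by simp))).1 h4
    have h6 : A y f ≤ 2 * A y (highPart f t) := by
      calc A y f = 2 * (A y f * 2⁻¹) := by
            rw [mul_left_comm, ENNReal.mul_inv_cancel (by simp) (by simp), mul_one]
        _ ≤ _ := by gcongr
    calc A y f ^ 2 ≤ (2 * A y (highPart f t)) ^ 2 := by gcongr
      _ = _ := by ring
  have hterm : ∀ y, v y * w y ^ (p - 2) * A y f ^ p = 2 ^ (p - 2) * (v y * A y f ^ 2 * u y ^ (p -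
      2)) := by
    intro y
    have e2 : A y f ^ p = A y f ^ 2 * A y f ^ (p - 2) := by
      rw [← ENNReal.rpow_two, ← ENNReal.rpow_add_of_nonneg _ _ (by norm_num) hp2.le]
      congr 1; ring
    have e3 : w y ^ (p - 2) * A y f ^ (p - 2) = 2 ^ (p - 2) * u y ^ (p - 2) := by
      rw [← ENNReal.mul_rpow_of_nonneg _ _ hp2.le, ← ENNReal.mul_rpow_of_nonneg _ _ hp2.le, hu]
      congr 1
      simp only
      rw [mul_left_comm, ENNReal.mul_inv_cancel (by simp) (by simp), mul_one]
    rw [e2, show v y * w y ^ (p - 2) * (A y f ^ 2 * A y f ^ (p - 2)) =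
      v y * A y f ^ 2 * (w y ^ (p - 2) * A y f ^ (p - 2)) by ring, e3]
    ring
  simp_rw [hterm]
  rw [ENNReal.tsum_mul_left]
  have hstep : ∀ y, v y * A y f ^ 2 * u y ^ (p - 2) ≤ ENNReal.ofReal (p - 2) *
      ∫⁻ t in Set.Ioi (0 : ℝ), 4 * (v y * A y (highPart f t) ^ 2) * ENNReal.ofReal (t ^ (p - 3)) :=
        by
    intro y
    rw [rpow_eq_lintegral_indicator (hut y) hp2, mul_left_comm]
    gcongr
    refine (lintegral_const_mul_le _ _).trans (lintegral_mono fun t => ?_)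
    rw [← mul_assoc, show p - 2 - 1 = p - 3 by ring]
    refine mul_le_mul' ?_ le_rfl
    by_cases ht : ENNReal.ofReal t < u y
    · rw [Set.indicator_of_mem (by exact ht), Pi.one_apply, mul_one, mul_left_comm]
      gcongr
      exact key y t ht
    · rw [Set.indicator_of_notMem (by exact ht), mul_zero]
      exact zero_le
  calc 2 ^ (p - 2) * ∑' y, v y * A y f ^ 2 * u y ^ (p - 2)
      ≤ 2 ^ (p - 2) * ∑' y, ENNReal.ofReal (p - 2) * ∫⁻ t in Set.Ioi (0 : ℝ),
          4 * (v y * A y (highPart f t) ^ 2) * ENNReal.ofReal (t ^ (p - 3)) := by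
        exact mul_le_mul' le_rfl (ENNReal.tsum_le_tsum hstep)
    _ ≤ 2 ^ (p - 2) * (ENNReal.ofReal (p - 2) * ∫⁻ t in Set.Ioi (0 : ℝ),
          ∑' y, 4 * (v y * A y (highPart f t) ^ 2) * ENNReal.ofReal (t ^ (p - 3))) := by
        rw [ENNReal.tsum_mul_left]
        gcongr
        exact tsum_lintegral_le _ _
    _ ≤ 2 ^ (p - 2) * (ENNReal.ofReal (p - 2) * ∫⁻ t in Set.Ioi (0 : ℝ),
          4 * a * ((∫⁻ x, ‖highPart f t x‖ₑ ^ 2 ∂μT n) * ENNReal.ofReal (t ^ (p - 3)))) := by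
        gcongr with t
        rw [ENNReal.tsum_mul_right, ENNReal.tsum_mul_left, ← mul_assoc, mul_assoc 4 a]
        gcongr
        exact hL2 _ (bdd_highPart hf t)
    _ ≤ 2 ^ (p - 2) * (ENNReal.ofReal (p - 2) * (4 * a * ∫⁻ t in Set.Ioi (0 : ℝ),
          (∫⁻ x, ‖highPart f t x‖ₑ ^ 2 ∂μT n) * ENNReal.ofReal (t ^ (p - 3)))) := by
        gcongr
        rw [lintegral_const_mul]
        refine Measurable.mul (Antitone.measurable fun s t hst => lintegral_mono fun x => ?_)
          (by fun_prop)
        gcongr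
        by_cases hx : ENNReal.ofReal t < ‖f x‖ₑ
        · have hx' : ENNReal.ofReal s < ‖f x‖ₑ := (ENNReal.ofReal_le_ofReal hst).trans_lt hx
          rw [highPart, highPart, Set.indicator_of_mem (by exact hx),
            Set.indicator_of_mem (by exact hx')]
        · rw [highPart, Set.indicator_of_notMem (by exact hx)]
          simp
    _ = 2 ^ (p - 2) * (4 * a * ∫⁻ x, ‖f x‖ₑ ^ p ∂μT n) := by
        rw [← lintegral_highPart_layercake hf hp]; ring
    _ = _ := by ring

/-- Marcinkiewicz interpolation between weak type `(2,2)` and strong type `(∞,∞)`. -/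
lemma lintegral_interpolation (G : ((Fin n → ℝ) → ℂ) → (Fin n → ℝ) → ℝ≥0∞) (a b : ℝ≥0∞)
    (hb0 : b ≠ 0) (hbt : b ≠ ∞) (hmeas : ∀ f, Bdd f → Measurable (G f))
    (hsub : ∀ f g x, Bdd f → Bdd g → G (f + g) x ≤ G f x + G g x)
    (hL2 : ∀ f, Bdd f → ∀ t : ℝ≥0∞, t ^ 2 * μT n {x | t < G f x} ≤ a * ∫⁻ x, ‖f x‖ₑ ^ 2 ∂μT n)
    (hLinf : ∀ f, Bdd f → ∀ B : ℝ≥0∞, B ≠ ∞ → (∀ x, ‖f x‖ₑ ≤ B) → ∀ x, G f x ≤ b * B)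
    {p : ℝ} (hp : 2 < p) {f : (Fin n → ℝ) → ℂ} (hf : Bdd f) :
    ∫⁻ x, G f x ^ p ∂μT n ≤
      (2 * b) ^ p * (ENNReal.ofReal p * (ENNReal.ofReal (p - 2))⁻¹ * (b⁻¹ ^ 2 * a)) *
        ∫⁻ x, ‖f x‖ₑ ^ p ∂μT n := by
  obtain ⟨B, hBt, hB⟩ := hf.exists_enorm_le
  have hp0 : 0 < p := by linarith
  have hfin : ∀ x, G f x ≠ ∞ := fun x =>
    ne_top_of_le_ne_top (ENNReal.mul_ne_top hbt hBt) (hLinf f hf B hBt hB x)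
  have h2b0 : 2 * b ≠ 0 := mul_ne_zero (by simp) hb0
  have h2bt : 2 * b ≠ ∞ := ENNReal.mul_ne_top (by simp) hbt
  have e1 := lintegral_rpow_layercake_mul (μT n) (hmeas f hf) hfin hp0 h2b0 h2bt
  have hpt : ∀ t ∈ Set.Ioi (0 : ℝ),
      μT n {x | 2 * b * ENNReal.ofReal t < G f x} * ENNReal.ofReal (t ^ (p - 1)) ≤
      b⁻¹ ^ 2 * a * ((∫⁻ x, ‖highPart f t x‖ₑ ^ 2 ∂μT n) * ENNReal.ofReal (t ^ (p - 3))) := by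
    intro t ht
    have ht0 : ENNReal.ofReal t ≠ 0 := by simpa using ht
    have hsubset : {x | 2 * b * ENNReal.ofReal t < G f x} ⊆
        {x | b * ENNReal.ofReal t < G (highPart f t) x} := by
      intro x hx
      have h1 : G f x ≤ G (lowPart f t) x + G (highPart f t) x := by
        conv_lhs => rw [← lowPart_add_highPart f t]
        exact hsub _ _ x (bdd_lowPart hf t) (bdd_highPart hf t)
      have h2 := hLinf _ (bdd_lowPart hf t) _ ENNReal.ofReal_ne_top (enorm_lowPart_le f t) x
      have h3 : b * ENNReal.ofReal t + b * ENNReal.ofReal t <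
          b * ENNReal.ofReal t + G (highPart f t) x := by
        refine lt_of_lt_of_le ?_ (h1.trans (by gcongr))
        rw [← two_mul, ← mul_assoc]; exact hx
      exact (ENNReal.add_lt_add_iff_left (ENNReal.mul_ne_top hbt ENNReal.ofReal_ne_top)).1 h3
    have h4 := hL2 _ (bdd_highPart hf t) (b * ENNReal.ofReal t)
    have e5 : ENNReal.ofReal (t ^ (p - 1)) = ENNReal.ofReal t ^ 2 * ENNReal.ofReal (t ^ (p - 3)) :=
        by
      rw [← ENNReal.ofReal_pow (le_of_lt ht), ← ENNReal.ofReal_mul (by positivity),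
        ← Real.rpow_natCast, ← Real.rpow_add ht]
      congr 2; push_cast; ring
    calc _ ≤ μT n {x | b * ENNReal.ofReal t < G (highPart f t) x} * ENNReal.ofReal (t ^ (p - 1)) :=
        by
          gcongr
      _ = b⁻¹ ^ 2 * ((b * ENNReal.ofReal t) ^ 2 *
          μT n {x | b * ENNReal.ofReal t < G (highPart f t) x}) * ENNReal.ofReal (t ^ (p - 3)) := by
          rw [e5]
          have : b⁻¹ ^ 2 * (b * ENNReal.ofReal t) ^ 2 = ENNReal.ofReal t ^ 2 := by
            rw [← mul_pow, ← mul_assoc, ENNReal.inv_mul_cancel hb0 hbt, one_mul]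
          rw [← mul_assoc (b⁻¹ ^ 2), this]; ring
      _ ≤ b⁻¹ ^ 2 * (a * ∫⁻ x, ‖highPart f t x‖ₑ ^ 2 ∂μT n) * ENNReal.ofReal (t ^ (p - 3)) := by
          gcongr
      _ = _ := by ring
  have hq0 : ENNReal.ofReal (p - 2) ≠ 0 := by simpa using hp
  have e3 : (2 * b)⁻¹ ^ p * ∫⁻ x, G f x ^ p ∂μT n ≤
      ENNReal.ofReal p * ((ENNReal.ofReal (p - 2))⁻¹ * (b⁻¹ ^ 2 * a)) * ∫⁻ x, ‖f x‖ₑ ^ p ∂μT n := by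
    rw [e1, mul_assoc]
    gcongr
    refine (setLIntegral_mono' measurableSet_Ioi hpt).trans ?_
    rw [← lintegral_highPart_layercake hf hp, lintegral_const_mul]
    · refine le_of_eq ?_
      set J := ∫⁻ t in Set.Ioi (0 : ℝ),
        (∫⁻ x, ‖highPart f t x‖ₑ ^ 2 ∂μT n) * ENNReal.ofReal (t ^ (p - 3))
      rw [show (ENNReal.ofReal (p - 2))⁻¹ * (b⁻¹ ^ 2 * a) * (ENNReal.ofReal (p - 2) * J) =
        ((ENNReal.ofReal (p - 2))⁻¹ * ENNReal.ofReal (p - 2)) * (b⁻¹ ^ 2 * a * J) by ring,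
        ENNReal.inv_mul_cancel hq0 ENNReal.ofReal_ne_top, one_mul]
    · refine Measurable.mul (Antitone.measurable fun s t hst => lintegral_mono fun x => ?_)
        (by fun_prop)
      gcongr
      by_cases hx : ENNReal.ofReal t < ‖f x‖ₑ
      · have hx' : ENNReal.ofReal s < ‖f x‖ₑ := (ENNReal.ofReal_le_ofReal hst).trans_lt hx
        rw [highPart, highPart, Set.indicator_of_mem (by exact hx),
          Set.indicator_of_mem (by exact hx')]
      · rw [highPart, Set.indicator_of_notMem (by exact hx)]
        simp
  have e4 : (2 * b) ^ p * (2 * b)⁻¹ ^ p = 1 := by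
    rw [← ENNReal.mul_rpow_of_nonneg _ _ hp0.le, ENNReal.mul_inv_cancel h2b0 h2bt, ENNReal.one_rpow]
  calc ∫⁻ x, G f x ^ p ∂μT n = (2 * b) ^ p * ((2 * b)⁻¹ ^ p * ∫⁻ x, G f x ^ p ∂μT n) := by
        rw [← mul_assoc, e4, one_mul]
    _ ≤ (2 * b) ^ p * (ENNReal.ofReal p * ((ENNReal.ofReal (p - 2))⁻¹ * (b⁻¹ ^ 2 * a)) *
          ∫⁻ x, ‖f x‖ₑ ^ p ∂μT n) := by gcongr
    _ = _ := by ring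

end interpolation

section oscillation

variable {n : ℕ} {g h : (Fin n → ℝ) → ℂ}

lemma dosc_empty {k : ℕ} {i : Fin n → ℤ} (hi : dcube k i = ∅) (g : (Fin n → ℝ) → ℂ) :
    dosc k i g = 0 := by simp [dosc, hi]

lemma dosc_mono_add (hg : Measurable g) {h f : (Fin n → ℝ) → ℂ}
    (hf : ∀ x, f x = g x + h x) (k : ℕ) (i : Fin n → ℤ) :
    dosc k i f ≤ dosc k i g + dosc k i h := by
  rcases (dcube k i).eq_empty_or_nonempty with he | ⟨x, rfl⟩
  · simp [dosc_empty he]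
  rw [← davg_ddist, ← davg_ddist, ← davg_ddist, ← davg_add (measurable_ddist hg k)]
  refine davg_mono (fun y => ?_) k x
  change davg k (fun y' => ‖f y - f y'‖ₑ) y ≤ davg k (fun y' => ‖g y - g y'‖ₑ) y +
    davg k (fun y' => ‖h y - h y'‖ₑ) y
  rw [← davg_add (F := fun y' => ‖g y - g y'‖ₑ) (measurable_const.sub hg).enorm]
  refine davg_mono (fun y' => ?_) k y
  rw [hf, hf, show g y + h y - (g y' + h y') = (g y - g y') + (h y - h y') by ring]
  exact enorm_add_le _ _

lemma dosc_zero (k : ℕ) (i : Fin n → ℤ) : dosc k i (fun _ => 0) = 0 := by simp [dosc]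

lemma dosc_sum_le {ι : Type*} (s : Finset ι) {G : ι → (Fin n → ℝ) → ℂ}
    (hG : ∀ j, Measurable (G j)) (k : ℕ) (i : Fin n → ℤ) :
    dosc k i (fun x => ∑ j ∈ s, G j x) ≤ ∑ j ∈ s, dosc k i (G j) := by
  classical
  induction s using Finset.induction_on with
  | empty => simp [dosc_zero]
  | insert a s ha ih =>
    rw [Finset.sum_insert ha]
    refine (dosc_mono_add (hG a) (h := fun x => ∑ j ∈ s, G j x)
      (fun x => Finset.sum_insert ha) k i).trans ?_
    exact add_le_add le_rfl ih

lemma dosc_le_of_le (hg : Measurable g) {k : ℕ} {i : Fin n → ℤ} {B : ℝ≥0∞}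
    (hB : ∀ x, dyad k x = i → ‖g x‖ₑ ≤ B) : dosc k i g ≤ 2 * B := by
  rcases (dcube k i).eq_empty_or_nonempty with he | ⟨x, rfl⟩
  · simp [dosc_empty he]
  refine (dosc_le hg k x).trans ?_
  gcongr
  rw [← davg_const B k x]
  have : davg k (fun y => ‖g y‖ₑ) x = davg k (fun y => min ‖g y‖ₑ B) x :=
    davg_congr_cube fun y hy => (min_eq_left (hB y hy)).symm
  rw [this]
  exact davg_mono (fun y => min_le_right _ _) k x

lemma davg_sq_le {F : (Fin n → ℝ) → ℝ≥0∞} (hF : Measurable F) (k : ℕ) (x : Fin n → ℝ) :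
    davg k F x ^ 2 ≤ davg k (fun y => F y ^ 2) x := by
  have h := setLIntegral_le_sqrt (μT n) (S := dcube k (dyad k x))
    (F := (dcube k (dyad k x)).indicator F)
    (hF.indicator (measurableSet_dcube k _)).aemeasurable
  have e1 : ∫⁻ y in dcube k (dyad k x), (dcube k (dyad k x)).indicator F y ∂μT n =
      ∫⁻ y in dcube k (dyad k x), F y ∂μT n :=
    setLIntegral_congr_fun (measurableSet_dcube k _) fun y hy => Set.indicator_of_mem hy _
  have e2 : ∫⁻ y, (dcube k (dyad k x)).indicator F y ^ 2 ∂μT n =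
      ∫⁻ y in dcube k (dyad k x), F y ^ 2 ∂μT n := by
    rw [← lintegral_indicator (measurableSet_dcube k _)]
    congr 1; ext y
    by_cases hy : y ∈ dcube k (dyad k x)
    · rw [Set.indicator_of_mem hy, Set.indicator_of_mem hy]
    · rw [Set.indicator_of_notMem hy, Set.indicator_of_notMem hy]; simp
  rw [e1, e2] at h
  have hsq : ∀ a : ℝ≥0∞, (a ^ (1 / 2 : ℝ)) ^ 2 = a := fun a => by
    rw [← ENNReal.rpow_two, ← ENNReal.rpow_mul]; norm_num
  have h2 := pow_le_pow_left' h 2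
  rw [mul_pow, hsq, hsq, μT_dcube_dyad] at h2
  calc davg k F x ^ 2 = dnum n k ^ 2 * (∫⁻ y in dcube k (dyad k x), F y ∂μT n) ^ 2 := by
        rw [davg, mul_pow]
    _ ≤ dnum n k ^ 2 * ((dnum n k)⁻¹ * ∫⁻ y in dcube k (dyad k x), F y ^ 2 ∂μT n) := by gcongr
    _ = (dnum n k * (dnum n k)⁻¹) * (dnum n k * ∫⁻ y in dcube k (dyad k x), F y ^ 2 ∂μT n) := by
        ring
    _ = _ := by
        rw [ENNReal.mul_inv_cancel (dnum_ne_zero n k) (dnum_ne_top n k), one_mul]; rfl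

lemma dosc_sq_le (hg : Measurable g) (k : ℕ) (x : Fin n → ℝ) :
    dosc k (dyad k x) g ^ 2 ≤ 4 * davg k (fun y => ‖g y‖ₑ ^ 2) x := by
  calc _ ≤ (2 * davg k (fun y => ‖g y‖ₑ) x) ^ 2 := by gcongr; exact dosc_le hg k x
    _ = 4 * davg k (fun y => ‖g y‖ₑ) x ^ 2 := by ring
    _ ≤ _ := by gcongr; exact davg_sq_le hg.enorm k x

lemma lintegral_dosc_sq_le (hg : Measurable g) (k : ℕ) :
    ∫⁻ x, dosc k (dyad k x) g ^ 2 ∂μT n ≤ 4 * ∫⁻ x, ‖g x‖ₑ ^ 2 ∂μT n := by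
  refine (lintegral_mono (dosc_sq_le hg k)).trans ?_
  rw [lintegral_const_mul' _ _ (by simp), lintegral_davg]

lemma dosc_sq_le_davg (hg : Measurable g) (k : ℕ) (x : Fin n → ℝ) :
    dosc k (dyad k x) g ^ 2 ≤
      davg k (fun y => davg k (fun y' => ‖g y - g y'‖ₑ ^ 2) y) x := by
  rw [← davg_ddist]
  refine (davg_sq_le (measurable_ddist hg k) k x).trans (davg_mono (fun y => ?_) k x)
  exact davg_sq_le (measurable_const.sub hg).enorm k y

lemma mem_cube {x : Fin n → ℝ} : x ∈ cube n ↔ ∀ l, 0 ≤ x l ∧ x l < 1 := by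
  simp [cube, Set.mem_pi]

lemma lintegral_dosc_sq_le_translation (hg : Measurable g) (k : ℕ) {A : ℝ≥0∞}
    (hA : ∀ v : Fin n → ℝ, (∀ l, |v l| < 2⁻¹ ^ k) →
      ∫⁻ y, ‖g (y + v) - g y‖ₑ ^ 2 ∂μT n ≤ A) :
    ∫⁻ x, dosc k (dyad k x) g ^ 2 ∂μT n ≤ 2 ^ n * A := by
  set P : Set (Fin n → ℝ) := Set.univ.pi fun _ => Set.Ioo (-(2⁻¹ ^ k)) (2⁻¹ ^ k) with hP
  have hPm : MeasurableSet P := MeasurableSet.univ_pi fun _ => measurableSet_Ioo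
  have hPmem : ∀ v, v ∈ P ↔ ∀ l, |v l| < 2⁻¹ ^ k := by
    intro v; simp [P, Set.mem_pi, abs_lt]
  have hPvol : volume P = 2 ^ n * (dnum n k)⁻¹ := by
    rw [hP, Real.volume_pi_Ioo]
    have : ENNReal.ofReal ((2⁻¹ : ℝ) ^ k - -(2⁻¹ : ℝ) ^ k) = 2 * (2⁻¹) ^ k := by
      rw [sub_neg_eq_add, ← two_mul, ENNReal.ofReal_mul (by norm_num),
        ENNReal.ofReal_pow (by norm_num), ENNReal.ofReal_inv_of_pos (by norm_num),
        ENNReal.ofReal_ofNat]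
    rw [Finset.prod_congr rfl fun l _ => this, Finset.prod_const, Finset.card_univ,
      Fintype.card_fin, mul_pow, ← pow_mul, dnum, ENNReal.inv_pow]
  have hm2 : Measurable fun z : (Fin n → ℝ) × (Fin n → ℝ) => ‖g (z.1 + z.2) - g z.1‖ₑ ^ 2 :=
    ((hg.comp (measurable_fst.add measurable_snd)).sub (hg.comp measurable_fst)).enorm.pow_const 2
  have hin : ∀ y ∈ cube n, ∫⁻ y' in dcube k (dyad k y), ‖g y - g y'‖ₑ ^ 2 ∂μT n ≤
      ∫⁻ v in P, ‖g (y + v) - g y‖ₑ ^ 2 := by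
    intro y hy
    rw [μT, Measure.restrict_restrict (measurableSet_dcube k _)]
    have hsub : dcube k (dyad k y) ∩ cube n ⊆ (fun y' => y' - y) ⁻¹' P := by
      rintro y' ⟨h1, h2⟩
      rw [Set.mem_preimage, hPmem]
      intro l
      have := abs_fract_sub_lt h1 l
      rwa [Int.fract_eq_self.2 (mem_cube.1 h2 l), Int.fract_eq_self.2 (mem_cube.1 hy l)] at this
    refine (lintegral_mono_set hsub).trans (le_of_eq ?_)
    have h3 := lintegral_sub_right_eq_self (μ := volume) (G := Fin n → ℝ)
      (fun v => P.indicator (fun v => ‖g (y + v) - g y‖ₑ ^ 2) v) y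
    rw [lintegral_indicator hPm] at h3
    have hmp : MeasurableSet ((fun y' : Fin n → ℝ => y' - y) ⁻¹' P) :=
      (measurable_id.sub_const y) hPm
    rw [← h3, ← lintegral_indicator hmp]
    congr 1; ext y'
    by_cases hy' : y' - y ∈ P
    · rw [Set.indicator_of_mem hy', Set.indicator_of_mem (by exact hy'), add_sub_cancel,
        ← enorm_neg, neg_sub]
    · rw [Set.indicator_of_notMem hy', Set.indicator_of_notMem (by exact hy')]
  calc ∫⁻ x, dosc k (dyad k x) g ^ 2 ∂μT n
      ≤ ∫⁻ x, davg k (fun y => davg k (fun y' => ‖g y - g y'‖ₑ ^ 2) y) x ∂μT n :=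
        lintegral_mono (dosc_sq_le_davg hg k)
    _ = ∫⁻ y, dnum n k * ∫⁻ y' in dcube k (dyad k y), ‖g y - g y'‖ₑ ^ 2 ∂μT n ∂μT n :=
        lintegral_davg k _
    _ = dnum n k * ∫⁻ y, ∫⁻ y' in dcube k (dyad k y), ‖g y - g y'‖ₑ ^ 2 ∂μT n ∂μT n :=
        lintegral_const_mul' _ _ (dnum_ne_top n k)
    _ ≤ dnum n k * ∫⁻ y, (∫⁻ v in P, ‖g (y + v) - g y‖ₑ ^ 2) ∂μT n := by
        gcongr 1
        exact setLIntegral_mono' (measurableSet_cube n) hin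
    _ = dnum n k * ∫⁻ v in P, ∫⁻ y, ‖g (y + v) - g y‖ₑ ^ 2 ∂μT n := by
        have hsw := lintegral_lintegral_swap (μ := μT n) (ν := volume.restrict P)
          (f := fun y v => ‖g (y + v) - g y‖ₑ ^ 2) hm2.aemeasurable
        rw [hsw]
    _ ≤ dnum n k * ∫⁻ v in P, A := by
        gcongr 1
        exact setLIntegral_mono' hPm fun v hv => hA v ((hPmem v).1 hv)
    _ = (dnum n k * (dnum n k)⁻¹) * (2 ^ n * A) := by
        rw [setLIntegral_const, hPvol]; ring
    _ = _ := by
        rw [ENNReal.mul_inv_cancel (dnum_ne_zero n k) (dnum_ne_top n k), one_mul]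

lemma norm_eChar_sub_one_le (v : Fin n → ℝ) (ξ : Fin n → ℤ) :
    ‖eChar v ξ - 1‖ ≤ 2 * π * ∑ l, |v l| * |(ξ l : ℝ)| := by
  have h : ‖eChar v ξ - 1‖ = chord (∑ l, v l * ξ l) := by
    rw [chord, eChar_eq_exp]
  rw [h]
  refine (chord_le _).trans ?_
  gcongr
  refine (Finset.abs_sum_le_sum_abs _ _).trans (Finset.sum_le_sum fun l _ => ?_)
  rw [abs_mul]

variable {a : (Fin n → ℤ) → ℂ} {f : (Fin n → ℝ) → ℂ}

/-- Oscillation of a function with frequencies bounded by `R` on cubes of side `2⁻ᵏ`. -/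
lemma lintegral_dosc_mult_sq_le (ha : a.support.Finite) (f : (Fin n → ℝ) → ℂ) {R : ℝ}
    (hsupp : ∀ ξ, a ξ ≠ 0 → ∀ l, |(ξ l : ℝ)| ≤ R) (k : ℕ) :
    ∫⁻ x, dosc k (dyad k x) (mult a f) ^ 2 ∂μT n ≤
      2 ^ n * (ENNReal.ofReal (2 * π * n * R * 2⁻¹ ^ k) ^ 2 *
        ∫⁻ x, ‖mult a f x‖ₑ ^ 2 ∂μT n) := by
  refine lintegral_dosc_sq_le_translation (continuous_mult ha f).measurable k fun v hv => ?_
  simp_rw [mult_add_sub ha]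
  rw [lintegral_mult_sq (ha.subset (Function.support_mul_subset_left _ _)), lintegral_mult_sq ha,
    ← ENNReal.tsum_mul_left]
  refine ENNReal.tsum_le_tsum fun ξ => ?_
  by_cases h0 : a ξ = 0
  · simp [h0]
  rw [enorm_mul, mul_pow, mul_comm (‖a ξ‖ₑ ^ 2), mul_assoc]
  gcongr
  rw [← ofReal_norm]
  refine ENNReal.ofReal_le_ofReal ((norm_eChar_sub_one_le v ξ).trans ?_)
  calc 2 * π * ∑ l, |v l| * |(ξ l : ℝ)| ≤ 2 * π * ∑ l : Fin n, 2⁻¹ ^ k * R := by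
        gcongr with l
        · exact (hv l).le
        · exact hsupp ξ h0 l
    _ = _ := by
        rw [Finset.sum_const, Finset.card_univ, Fintype.card_fin, nsmul_eq_mul]; ring

lemma zPer_norm_trig (b : (Fin n → ℤ) → ℂ) (S : Set (Fin n → ℝ)) (hS : ZPer S) :
    ZPer (S.indicator fun z => ‖trig b z‖ₑ) := by
  intro z v
  have h1 : (z + fun j => (v j : ℝ)) ∈ S ↔ z ∈ S := iff_of_eq (hS z v)
  have h2 := zPer_trig b z v
  by_cases hz : z ∈ S
  · rw [Set.indicator_of_mem hz, Set.indicator_of_mem (h1.2 hz), h2]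
  · rw [Set.indicator_of_notMem hz, Set.indicator_of_notMem (fun h => hz (h1.1 h))]

/-- Oscillation of a multiplier on a dyadic cube: splitting `f` into a part near the cube, handled
in `L²`, and a part at distance at least `r`, handled through the tail of the kernel. -/
lemma dosc_mult_le_near_add_far (ha : a.support.Finite) (hf : Bdd f) {W : ℝ} (hW0 : 0 ≤ W)
    (hW : ∀ ξ, ‖a ξ‖ₑ ≤ ENNReal.ofReal W) {B : ℝ≥0∞} (hB : ∀ x, ‖f x‖ₑ ≤ B) (k : ℕ)
    (x₀ : Fin n → ℝ) {r : ℝ} (hr : 0 < r) :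
    dosc k (dyad k x₀) (mult a f) ≤
      (ENNReal.ofReal (2 * W * (2 ^ k * r + 2 * π) ^ ((n : ℝ) / 2)) +
        2 * ∫⁻ z in {z | ∃ l, r ≤ chord (z l)}, ‖trig a z‖ₑ ∂μT n) * B := by
  set R : ℝ := r + 2 * π * 2⁻¹ ^ k with hR
  have hR0 : 0 < R := by positivity
  set P : Set (Fin n → ℝ) := {y | ∀ l, chord (x₀ l - y l) < R} with hPdef
  have hPm : MeasurableSet P := by
    rw [hPdef, Set.ofPred_forall]
    exact MeasurableSet.iInter fun l => measurableSet_lt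
      (continuous_chord.comp (continuous_const.sub (continuous_apply l))).measurable
      measurable_const
  set F : Set (Fin n → ℝ) := {z | ∃ l, r ≤ chord (z l)} with hF
  have hFm : MeasurableSet F := by
    rw [hF, Set.ofPred_exists]
    exact MeasurableSet.iUnion fun l => measurableSet_le measurable_const
      (continuous_chord.comp (continuous_apply l)).measurable
  have hFper : ZPer F := by
    intro z v
    change (∃ l, r ≤ chord (z l + v l)) = (∃ l, r ≤ chord (z l))
    simp_rw [chord_add_int]
  have hPμ : μT n P ≤ ENNReal.ofReal R ^ n := by
    refine le_trans (le_of_eq ?_) (μT_chord_lt_le n R)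
    set Q : Set (Fin n → ℝ) := {z | ∀ l, chord (z l) < R} with hQ
    have hQm : MeasurableSet Q := by
      rw [hQ, Set.ofPred_forall]
      exact MeasurableSet.iInter fun l => measurableSet_lt
        (continuous_chord.comp (continuous_apply l)).measurable measurable_const
    have hQper : ZPer (Q.indicator fun _ => (1 : ℝ≥0∞)) := by
      intro z v
      have h1 : (z + fun j => (v j : ℝ)) ∈ Q ↔ z ∈ Q := by
        change (∀ l, chord (z l + v l) < R) ↔ ∀ l, chord (z l) < R
        simp_rw [chord_add_int]
      by_cases hz : z ∈ Q
      · rw [Set.indicator_of_mem hz, Set.indicator_of_mem (h1.2 hz)]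
      · rw [Set.indicator_of_notMem hz, Set.indicator_of_notMem (fun h => hz (h1.1 h))]
    have h2 := lintegral_cube_sub hQper x₀
    have h3 : (fun x => Q.indicator (fun _ => (1 : ℝ≥0∞)) (x₀ - x)) =
        P.indicator fun _ => 1 := by
      ext y
      by_cases hy : y ∈ P
      · rw [Set.indicator_of_mem hy, Set.indicator_of_mem (by exact hy)]
      · rw [Set.indicator_of_notMem hy, Set.indicator_of_notMem (by exact hy)]
    rw [h3, lintegral_indicator hPm, lintegral_indicator hQm] at h2
    simpa using h2
  set f₁ := P.indicator f with hf₁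
  set f₂ := Pᶜ.indicator f with hf₂
  have hb₁ : Bdd f₁ := hf.indicator hPm
  have hb₂ : Bdd f₂ := hf.indicator hPm.compl
  have hsplit : ∀ x, mult a f x = mult a f₁ x + mult a f₂ x := by
    intro x
    rw [← mult_add ha hb₁ hb₂, hf₁, hf₂, Set.indicator_self_add_compl]
  have hnear : dosc k (dyad k x₀) (mult a f₁) ≤
      ENNReal.ofReal (2 * W * (2 ^ k * r + 2 * π) ^ ((n : ℝ) / 2)) * B := by
    have h1 : dosc k (dyad k x₀) (mult a f₁) ^ 2 ≤
        4 * (dnum n k * (ENNReal.ofReal W ^ 2 * (B ^ 2 * ENNReal.ofReal R ^ n))) := by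
      refine (dosc_sq_le (continuous_mult ha f₁).measurable k x₀).trans ?_
      gcongr
      rw [davg]
      gcongr
      refine (setLIntegral_le_lintegral _ _).trans ((lintegral_mult_sq_le ha hb₁ hW).trans ?_)
      gcongr
      calc ∫⁻ x, ‖f₁ x‖ₑ ^ 2 ∂μT n ≤ ∫⁻ x, P.indicator (fun _ => B ^ 2) x ∂μT n := by
            refine lintegral_mono fun x => ?_
            by_cases hx : x ∈ P
            · rw [hf₁, Set.indicator_of_mem hx, Set.indicator_of_mem hx]
              gcongr; exact hB x
            · rw [hf₁, Set.indicator_of_notMem hx]; simp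
        _ = B ^ 2 * μT n P := by rw [lintegral_indicator hPm, setLIntegral_const]
        _ ≤ _ := by gcongr
    have h2 : 4 * (dnum n k * (ENNReal.ofReal W ^ 2 * (B ^ 2 * ENNReal.ofReal R ^ n))) =
        (ENNReal.ofReal (2 * W * (2 ^ k * r + 2 * π) ^ ((n : ℝ) / 2)) * B) ^ 2 := by
      have e1 : dnum n k = ENNReal.ofReal (2 ^ k) ^ n := by
        rw [dnum, ENNReal.ofReal_pow (by norm_num), ← pow_mul]; norm_num
      have e2 : (2 : ℝ) ^ k * R = 2 ^ k * r + 2 * π := by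
        rw [hR, inv_pow]; field_simp
      have e3 : ENNReal.ofReal ((2 ^ k * r + 2 * π) ^ ((n : ℝ) / 2)) ^ 2 =
          ENNReal.ofReal (2 ^ k * r + 2 * π) ^ n := by
        rw [← ENNReal.ofReal_pow (by positivity), ← ENNReal.ofReal_pow (by positivity),
          ← Real.rpow_natCast, ← Real.rpow_mul (by positivity), ← Real.rpow_natCast _ n]
        congr 2; push_cast; ring
      rw [ENNReal.ofReal_mul (by positivity), mul_pow, mul_pow, e3, ← e2,
        ENNReal.ofReal_mul (by positivity : (0 : ℝ) ≤ 2 ^ k), e1,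
        ENNReal.ofReal_mul (by norm_num : (0 : ℝ) ≤ 2), ENNReal.ofReal_ofNat]
      ring
    rw [h2] at h1
    exact (ENNReal.pow_le_pow_left_iff (by norm_num)).1 h1
  have hfar : dosc k (dyad k x₀) (mult a f₂) ≤
      2 * ((∫⁻ z in F, ‖trig a z‖ₑ ∂μT n) * B) := by
    refine dosc_le_of_le (continuous_mult ha f₂).measurable fun x hx => ?_
    refine (enorm_mult_le ha hb₂ x).trans ?_
    have hpt : ∀ y, ‖trig a (x - y)‖ₑ * ‖f₂ y‖ₑ ≤
        F.indicator (fun z => ‖trig a z‖ₑ) (x - y) * B := by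
      intro y
      by_cases hy : y ∈ P
      · rw [hf₂, Set.indicator_of_notMem (by simpa using hy)]; simp
      · have hmem : x - y ∈ F := by
          simp only [hPdef, Set.mem_ofPred_eq, not_forall, not_lt] at hy
          obtain ⟨l, hl⟩ := hy
          refine ⟨l, ?_⟩
          have h1 : chord (x₀ l - x l) ≤ 2 * π * 2⁻¹ ^ k := by
            have e : x₀ l - x l = (Int.fract (x₀ l) - Int.fract (x l)) +
                ((⌊x₀ l⌋ - ⌊x l⌋ : ℤ) : ℝ) := by
              push_cast [Int.fract]; ring
            rw [e, chord_add_int]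
            refine (chord_le _).trans ?_
            gcongr
            exact (abs_fract_sub_lt hx.symm l).le
          have h2 := chord_add_le (x₀ l - x l) (x l - y l)
          rw [sub_add_sub_cancel] at h2
          rw [Pi.sub_apply]
          linarith
        rw [Set.indicator_of_mem hmem]
        gcongr
        exact (enorm_indicator_le_enorm_self _ _).trans (hB y)
    refine (lintegral_mono hpt).trans ?_
    have hmeas : Measurable fun y => F.indicator (fun z => ‖trig a z‖ₑ) (x - y) :=
      ((continuous_trig ha).measurable.enorm.indicator hFm).comp (measurable_const.sub
        measurable_id)
    rw [lintegral_mul_const _ hmeas, lintegral_cube_sub (zPer_norm_trig a F hFper) x,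
      lintegral_indicator hFm]
  refine (dosc_mono_add (continuous_mult ha f₁).measurable hsplit k _).trans ?_
  rw [add_mul, mul_assoc (2 : ℝ≥0∞)]
  exact add_le_add hnear hfar

end oscillation

/-- The real power `2 ^ t` as an extended nonnegative number. -/
def E2 (t : ℝ) : ℝ≥0∞ := ENNReal.ofReal (2 ^ t)

lemma E2_add (s t : ℝ) : E2 (s + t) = E2 s * E2 t := by
  rw [E2, E2, E2, Real.rpow_add two_pos, ENNReal.ofReal_mul (by positivity)]

@[simp] lemma E2_zero : E2 0 = 1 := by simp [E2]

lemma E2_ne_zero (t : ℝ) : E2 t ≠ 0 := by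
  rw [E2, Ne, ENNReal.ofReal_eq_zero, not_le]; positivity

lemma E2_ne_top (t : ℝ) : E2 t ≠ ∞ := ENNReal.ofReal_ne_top

lemma E2_rpow (s t : ℝ) : E2 s ^ t = E2 (s * t) := by
  rw [E2, E2, ENNReal.ofReal_rpow_of_pos (by positivity), Real.rpow_mul (by norm_num)]

lemma E2_pow (s : ℝ) (k : ℕ) : E2 s ^ k = E2 (s * k) := by
  rw [← ENNReal.rpow_natCast, E2_rpow]

lemma E2_mono {s t : ℝ} (h : s ≤ t) : E2 s ≤ E2 t :=
  ENNReal.ofReal_le_ofReal (Real.rpow_le_rpow_of_exponent_le (by norm_num) h)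

lemma one_le_E2 {t : ℝ} (h : 0 ≤ t) : 1 ≤ E2 t := by
  rw [← E2_zero]; exact E2_mono h

lemma ofReal_mul_two_rpow {L : ℝ} (hL : 0 ≤ L) (t : ℝ) :
    ENNReal.ofReal (L * 2 ^ t) = ENNReal.ofReal L * E2 t := ENNReal.ofReal_mul hL

lemma E2_neg_mul_self (t : ℝ) : E2 (-t) * E2 t = 1 := by rw [← E2_add]; simp

lemma tsum_E2_ne_top {δ : ℝ} (hδ : 0 < δ) : ∑' s : ℕ, E2 (-(δ * s)) ≠ ∞ := by
  have : ∀ s : ℕ, E2 (-(δ * s)) = E2 (-δ) ^ s := fun s => by rw [E2_pow]; congr 1; ring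
  simp_rw [this]
  rw [ENNReal.tsum_geometric, Ne, ENNReal.inv_eq_top, tsub_eq_zero_iff_le, not_le, E2,
    ENNReal.ofReal_lt_one]
  exact Real.rpow_lt_one_of_one_lt_of_neg (by norm_num) (by linarith)

lemma tsum_rpow_le {q : ℝ} (hq : 0 < q) (θ : ℝ) (x : ℕ → ℝ≥0∞) :
    (∑' s, x s) ^ q ≤ (∑' s : ℕ, E2 (-(θ / q * s))) ^ q * ∑' s : ℕ, E2 (θ * s) * x s ^ q := by
  set S := ∑' s : ℕ, E2 (θ * s) * x s ^ q with hS
  have h1 : ∀ s, x s ≤ E2 (-(θ / q * s)) * S ^ (1 / q) := by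
    intro s
    have h2 : E2 (θ * s) * x s ^ q ≤ S := ENNReal.le_tsum (f := fun s : ℕ => E2 (θ * s) * x s ^ q) s
    have h3 := ENNReal.rpow_le_rpow h2 (by positivity : 0 ≤ 1 / q)
    rw [ENNReal.mul_rpow_of_nonneg _ _ (by positivity), ← ENNReal.rpow_mul,
      mul_one_div_cancel hq.ne', ENNReal.rpow_one, E2_rpow] at h3
    calc x s = E2 (-(θ * s * (1 / q))) * (E2 (θ * s * (1 / q)) * x s) := by
          rw [← mul_assoc, E2_neg_mul_self, one_mul]
      _ ≤ E2 (-(θ * s * (1 / q))) * S ^ (1 / q) := mul_le_mul' le_rfl h3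
      _ = _ := by congr 2; ring
  calc (∑' s, x s) ^ q ≤ (∑' s : ℕ, E2 (-(θ / q * s)) * S ^ (1 / q)) ^ q := by
        gcongr; exact h1 _
    _ = _ := by
        rw [ENNReal.tsum_mul_right, ENNReal.mul_rpow_of_nonneg _ _ hq.le, ← ENNReal.rpow_mul,
          one_div_mul_cancel hq.ne', ENNReal.rpow_one]

lemma tsum_sum_range_rpow_le {q : ℝ} (hq : 0 < q) (θ : ℝ) (x : ℕ → ℕ → ℝ≥0∞) :
    ∑' k, (∑ j ∈ Finset.range k, x k j) ^ q ≤ (∑' s : ℕ, E2 (-(θ / q * s))) ^ q *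
      ∑' s : ℕ, ∑' j : ℕ, E2 (θ * s) * x (j + s + 1) j ^ q := by
  classical
  have h1 : ∀ k, ∑ j ∈ Finset.range k, x k j = ∑' s, if s < k then x k (k - 1 - s) else 0 := by
    intro k
    rw [← Finset.sum_range_reflect, tsum_eq_sum (s := Finset.range k)]
    · exact Finset.sum_congr rfl fun s hs => by rw [if_pos (Finset.mem_range.1 hs)]
    · intro s hs
      rw [if_neg (by simpa using hs)]
  calc _ ≤ ∑' k, (∑' s : ℕ, E2 (-(θ / q * s))) ^ q *
        ∑' s : ℕ, E2 (θ * s) * (if s < k then x k (k - 1 - s) else 0) ^ q :=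
        ENNReal.tsum_le_tsum fun k => by rw [h1]; exact tsum_rpow_le hq θ _
    _ = (∑' s : ℕ, E2 (-(θ / q * s))) ^ q *
        ∑' s : ℕ, ∑' k, E2 (θ * s) * (if s < k then x k (k - 1 - s) else 0) ^ q := by
        rw [ENNReal.tsum_mul_left, ENNReal.tsum_comm]
    _ = _ := by
        congr 1
        refine tsum_congr fun s => ?_
        have hinj : Function.Injective fun j : ℕ => j + s + 1 := fun a b h => by simpa using h
        rw [← hinj.tsum_eq]
        · refine tsum_congr fun j => ?_
          rw [if_pos (by omega), show j + s + 1 - 1 - s = j by omega]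
        · intro k hk
          by_cases hs : s < k
          · exact ⟨k - 1 - s, by simp only; omega⟩
          · simp [hs, hq] at hk

section

variable {n : ℕ}

/-- A finite family of frequency-localized symbols satisfying, uniformly, the estimates of a
Littlewood-Paley decomposition of a symbol of order `-m` and type `ρ`. -/
structure SymFam (n : ℕ) (ρ m L : ℝ) (K : ℕ) (a : ℕ → (Fin n → ℤ) → ℂ) : Prop where
  fin : ∀ j, (a j).support.Finite
  zero : ∀ j, K ≤ j → a j = 0
  freq : ∀ j ξ, a j ξ ≠ 0 → ∀ l, |(ξ l : ℝ)| ≤ 2 ^ (j + 1)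
  overlap : ∀ ξ, ∑' j : ℕ, E2 (j * m) * ‖a j ξ‖ₑ ≤ ENNReal.ofReal L
  size : ∀ j : ℕ, ∑' ξ, ‖a j ξ‖ₑ ^ 2 ≤ ENNReal.ofReal (L * 2 ^ (j * ((n : ℝ) / 2 - m))) ^ 2
  diff : ∀ (j : ℕ) l, ∑' ξ, ‖(dd l)^[n / 2 + 1] (a j) ξ‖ₑ ^ 2 ≤
    ENNReal.ofReal (L * 2 ^ (j * ((n : ℝ) / 2 - m - ρ * (n / 2 + 1 : ℕ)))) ^ 2

lemma half_lt_natDiv (n : ℕ) : (n : ℝ) / 2 + 1 / 2 ≤ (n / 2 + 1 : ℕ) := by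
  have : n ≤ 2 * (n / 2) + 1 := by omega
  have h : (n : ℝ) ≤ 2 * (n / 2 : ℕ) + 1 := by exact_mod_cast this
  push_cast
  linarith

/-- The constant in the estimate of the tail of a kernel. -/
def tailC (n : ℕ) : ℝ :=
  n * (2 : ℝ) ^ ((n : ℝ) / 2) * (1 - (2 : ℝ) ^ ((n : ℝ) / 2 - (n / 2 + 1 : ℕ)))⁻¹

lemma tailC_nonneg (n : ℕ) : 0 ≤ tailC n := by
  have h : (2 : ℝ) ^ ((n : ℝ) / 2 - (n / 2 + 1 : ℕ)) ≤ 1 :=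
    Real.rpow_le_one_of_one_le_of_nonpos (by norm_num) (by linarith [half_lt_natDiv n])
  unfold tailC
  have : 0 ≤ 1 - (2 : ℝ) ^ ((n : ℝ) / 2 - (n / 2 + 1 : ℕ)) := by linarith
  positivity

namespace SymFam

variable {ρ m L : ℝ} {K : ℕ} {a : ℕ → (Fin n → ℤ) → ℂ}

lemma enorm_le (h : SymFam n ρ m L K a) (hL : 0 ≤ L) (j : ℕ) (ξ : Fin n → ℤ) :
    ‖a j ξ‖ₑ ≤ ENNReal.ofReal (L * 2 ^ (-(j * m))) := by
  have h1 : E2 (j * m) * ‖a j ξ‖ₑ ≤ ENNReal.ofReal L :=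
    (ENNReal.le_tsum (f := fun j : ℕ => E2 (j * m) * ‖a j ξ‖ₑ) j).trans (h.overlap ξ)
  rw [ofReal_mul_two_rpow hL]
  calc ‖a j ξ‖ₑ = (E2 (j * m) * ‖a j ξ‖ₑ) * E2 (-(j * m)) := by
        rw [mul_right_comm, mul_comm (E2 _), E2_neg_mul_self, one_mul]
    _ ≤ _ := mul_le_mul' h1 le_rfl

lemma enorm_sum_le (h : SymFam n ρ m L K a) (hm : 0 ≤ m) (s : Finset ℕ) (ξ : Fin n → ℤ) :
    ‖(∑ j ∈ s, a j) ξ‖ₑ ≤ ENNReal.ofReal L := by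
  rw [Finset.sum_apply]
  refine (_root_.enorm_sum_le _ _).trans (le_trans ?_ (h.overlap ξ))
  refine le_trans (Finset.sum_le_sum fun j _ => ?_) (ENNReal.sum_le_tsum s)
  exact le_mul_of_one_le_left zero_le (one_le_E2 (by positivity))

lemma support_sum_finite (h : SymFam n ρ m L K a) (s : Finset ℕ) :
    (∑ j ∈ s, a j).support.Finite := by
  refine (s.finite_toSet.biUnion fun j _ => h.fin j).subset fun ξ hξ => ?_
  rw [Function.mem_support, Finset.sum_apply] at hξ
  obtain ⟨j, hj, hne⟩ := Finset.exists_ne_zero_of_sum_ne_zero hξ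
  exact Set.mem_biUnion hj hne

lemma tsum_lintegral_sq_le (h : SymFam n ρ m L K a) {f : (Fin n → ℝ) → ℂ} (hf : Bdd f) :
    ∑' j : ℕ, E2 (2 * (j * m)) * ∫⁻ x, ‖mult (a j) f x‖ₑ ^ 2 ∂μT n ≤
      ENNReal.ofReal L ^ 2 * ∫⁻ x, ‖f x‖ₑ ^ 2 ∂μT n := by
  simp_rw [lintegral_mult_sq (h.fin _), ← ENNReal.tsum_mul_left]
  rw [ENNReal.tsum_comm]
  calc _ ≤ ∑' ξ, ENNReal.ofReal L ^ 2 * ‖fc f ξ‖ₑ ^ 2 := by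
        refine ENNReal.tsum_le_tsum fun ξ => ?_
        have h1 : ∀ j : ℕ, E2 (2 * (j * m)) * (‖a j ξ‖ₑ ^ 2 * ‖fc f ξ‖ₑ ^ 2) =
            (E2 (j * m) * ‖a j ξ‖ₑ) * (E2 (j * m) * ‖a j ξ‖ₑ) * ‖fc f ξ‖ₑ ^ 2 := by
          intro j
          rw [two_mul, E2_add]; ring
        simp_rw [h1]
        rw [ENNReal.tsum_mul_right]
        refine mul_le_mul' ?_ le_rfl
        calc _ ≤ ∑' j : ℕ, (E2 (j * m) * ‖a j ξ‖ₑ) * ENNReal.ofReal L :=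
              ENNReal.tsum_le_tsum fun j => mul_le_mul' le_rfl
                ((ENNReal.le_tsum (f := fun j : ℕ => E2 (j * m) * ‖a j ξ‖ₑ) j).trans (h.overlap ξ))
          _ ≤ _ := by
              rw [ENNReal.tsum_mul_right, sq]
              exact mul_le_mul' (h.overlap ξ) le_rfl
    _ ≤ _ := by
        rw [ENNReal.tsum_mul_left]
        exact mul_le_mul' le_rfl (tsum_fc_sq_le hf)

lemma far_le (h : SymFam n ρ m L K a) (hL : 0 ≤ L) (j : ℕ) (t : ℝ) :
    ∫⁻ z in {z | ∃ l, (2 : ℝ) ^ t ≤ chord (z l)}, ‖trig (a j) z‖ₑ ∂μT n ≤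
      ENNReal.ofReal (tailC n * L) * E2 (j * ((n : ℝ) / 2 - m - ρ * (n / 2 + 1 : ℕ)) +
        t * ((n : ℝ) / 2 - (n / 2 + 1 : ℕ))) := by
  refine (lintegral_trig_far_le (h.fin j) (n / 2 + 1) (by linarith [half_lt_natDiv n])
    (by positivity) (h.diff j) (by positivity)).trans (le_of_eq ?_)
  have := tailC_nonneg n
  rw [← ofReal_mul_two_rpow (by positivity)]
  congr 1
  rw [← Real.rpow_mul (by norm_num), Real.rpow_add two_pos]
  unfold tailC; ring

/-- The `L¹` norm of the kernels. -/
lemma lintegral_trig_le (h : SymFam n ρ m L K a) (hL : 0 ≤ L) (j : ℕ) :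
    ∫⁻ z, ‖trig (a j) z‖ₑ ∂μT n ≤
      ENNReal.ofReal ((1 + tailC n) * L) * E2 (j * ((n : ℝ) * (1 - ρ) / 2 - m)) := by
  have hC := tailC_nonneg n
  set t : ℝ := -(j * ρ)
  have hsub : (Set.univ : Set (Fin n → ℝ)) ⊆ {z | ∀ l, chord (z l) < (2 : ℝ) ^ t} ∪
      {z | ∃ l, (2 : ℝ) ^ t ≤ chord (z l)} := by
    intro z _
    by_cases hz : ∀ l, chord (z l) < (2 : ℝ) ^ t
    · exact Or.inl hz
    · push Not at hz
      exact Or.inr hz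
  rw [← setLIntegral_univ]
  refine (lintegral_mono_set hsub).trans ((lintegral_union_le _ _ _).trans ?_)
  rw [add_mul 1, one_mul, ENNReal.ofReal_add hL (by positivity), add_mul]
  refine add_le_add ?_ ?_
  · refine (lintegral_trig_near_le (h.fin j) (h.size j)
      (by positivity)).trans (le_of_eq ?_)
    rw [← ofReal_mul_two_rpow hL, mul_assoc, ← Real.rpow_mul (by norm_num),
      ← Real.rpow_add two_pos]
    congr 3
    simp only [t]; ring
  · refine (h.far_le hL j t).trans (le_of_eq ?_)
    congr 2
    simp only [t]; ring

lemma enorm_mult_le (h : SymFam n ρ m L K a) (hL : 0 ≤ L) {f : (Fin n → ℝ) → ℂ} (hf : Bdd f)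
    {B : ℝ≥0∞} (hB : ∀ x, ‖f x‖ₑ ≤ B) (j : ℕ) (x : Fin n → ℝ) :
    ‖mult (a j) f x‖ₑ ≤
      ENNReal.ofReal ((1 + tailC n) * L) * E2 (j * ((n : ℝ) * (1 - ρ) / 2 - m)) * B := by
  refine (_root_.enorm_mult_le (h.fin j) hf x).trans ?_
  calc _ ≤ ∫⁻ y, ‖trig (a j) (x - y)‖ₑ * B ∂μT n :=
        lintegral_mono fun y => mul_le_mul' le_rfl (hB y)
    _ = (∫⁻ y, ‖trig (a j) y‖ₑ ∂μT n) * B := by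
        have hm : Measurable fun y => ‖trig (a j) (x - y)‖ₑ :=
          ((continuous_trig (h.fin j)).comp (continuous_const.sub continuous_id)).measurable.enorm
        have hper : ZPer fun z => ‖trig (a j) z‖ₑ := fun z v => by
          change ‖trig (a j) (z + fun j => (v j : ℝ))‖ₑ = ‖trig (a j) z‖ₑ
          rw [zPer_trig (a j) z v]
        rw [lintegral_mul_const _ hm, lintegral_cube_sub hper x]
    _ ≤ _ := mul_le_mul' (h.lintegral_trig_le hL j) le_rfl

end SymFam

end

section

variable {n : ℕ}

lemma tsum_dcube (κ : ℕ → ℕ → ℕ) (Φ : ℕ → ℕ → ℝ≥0∞) (ψ : ℝ≥0∞ → ℝ≥0∞)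
    (g : ℕ → ℕ → (Fin n → ℝ) → ℂ) :
    ∑' y : ℕ × ℕ × (Fin n → ℤ), μT n (dcube (κ y.1 y.2.1) y.2.2) * Φ y.1 y.2.1 *
        ψ (dosc (κ y.1 y.2.1) y.2.2 (g y.1 y.2.1)) =
      ∑' j, ∑' s, Φ j s * ∫⁻ x, ψ (dosc (κ j s) (dyad (κ j s) x) (g j s)) ∂μT n := by
  rw [ENNReal.tsum_prod (f := fun j (z : ℕ × (Fin n → ℤ)) => μT n (dcube (κ j z.1) z.2) * Φ j z.1 *
    ψ (dosc (κ j z.1) z.2 (g j z.1)))]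
  refine tsum_congr fun j => ?_
  rw [ENNReal.tsum_prod (f := fun s i => μT n (dcube (κ j s) i) * Φ j s *
    ψ (dosc (κ j s) i (g j s)))]
  refine tsum_congr fun s => ?_
  rw [lintegral_dyad (κ j s) fun i => ψ (dosc (κ j s) i (g j s)), ← ENNReal.tsum_mul_left]
  exact tsum_congr fun i => by ring

lemma dosc_mult_add_le {a : (Fin n → ℤ) → ℂ} (ha : a.support.Finite) {f g : (Fin n → ℝ) → ℂ}
    (hf : Bdd f) (hg : Bdd g) (k : ℕ) (i : Fin n → ℤ) :
    dosc k i (mult a (f + g)) ≤ dosc k i (mult a f) + dosc k i (mult a g) :=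
  dosc_mono_add (continuous_mult ha f).measurable (mult_add ha hf hg) k i

namespace SymFam

variable {ρ m L : ℝ} {K : ℕ} {a : ℕ → (Fin n → ℤ) → ℂ}

/-- The constant in `SymFam.tsum_low_sq_le`. -/
def lowC (n : ℕ) (L : ℝ) : ℝ≥0∞ :=
  2 ^ n * ENNReal.ofReal (2 * π * n) ^ 2 * (∑' s : ℕ, E2 (-(1 * s))) * ENNReal.ofReal L ^ 2

lemma lowC_ne_top (n : ℕ) (L : ℝ) : lowC n L ≠ ∞ := by
  unfold lowC
  exact ENNReal.mul_ne_top (ENNReal.mul_ne_top (by finiteness) (tsum_E2_ne_top one_pos))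
    (by finiteness)

lemma tsum_low_sq_le (h : SymFam n ρ m L K a) {f : (Fin n → ℝ) → ℂ} (hf : Bdd f) :
    ∑' j : ℕ, ∑' s : ℕ, E2 (2 * (j * m) + s) *
        ∫⁻ x, dosc (j + s + 1) (dyad (j + s + 1) x) (mult (a j) f) ^ 2 ∂μT n ≤
      lowC n L * ∫⁻ x, ‖f x‖ₑ ^ 2 ∂μT n := by
  have h1 : ∀ j s : ℕ, E2 (2 * (j * m) + s) *
        ∫⁻ x, dosc (j + s + 1) (dyad (j + s + 1) x) (mult (a j) f) ^ 2 ∂μT n ≤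
      (2 ^ n * ENNReal.ofReal (2 * π * n) ^ 2 * (E2 (2 * (j * m)) *
        ∫⁻ x, ‖mult (a j) f x‖ₑ ^ 2 ∂μT n)) * E2 (-(1 * s)) := by
    intro j s
    have h2 := lintegral_dosc_mult_sq_le (h.fin j) f (h.freq j) (j + s + 1)
    have h3 : ENNReal.ofReal (2 * π * n * 2 ^ (j + 1) * 2⁻¹ ^ (j + s + 1)) =
        ENNReal.ofReal (2 * π * n) * E2 (-s) := by
      rw [E2, ← ENNReal.ofReal_mul (by positivity)]
      congr 1
      rw [Real.rpow_neg (by norm_num), Real.rpow_natCast, inv_pow,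
        show j + s + 1 = (j + 1) + s by ring, pow_add _ (j + 1) s]
      field_simp
    rw [h3] at h2
    refine (mul_le_mul' le_rfl h2).trans (le_of_eq ?_)
    have h4 : E2 (2 * (j * m) + s) * E2 (-s) ^ 2 = E2 (2 * (j * m)) * E2 (-(1 * s)) := by
      rw [E2_pow, ← E2_add, ← E2_add]; congr 1; push_cast; ring
    calc _ = 2 ^ n * ENNReal.ofReal (2 * π * n) ^ 2 * (∫⁻ x, ‖mult (a j) f x‖ₑ ^ 2 ∂μT n) *
          (E2 (2 * (j * m) + s) * E2 (-s) ^ 2) := by ring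
      _ = _ := by rw [h4]; ring
  calc _ ≤ ∑' j : ℕ, ∑' s : ℕ, (2 ^ n * ENNReal.ofReal (2 * π * n) ^ 2 * (E2 (2 * (j * m)) *
        ∫⁻ x, ‖mult (a j) f x‖ₑ ^ 2 ∂μT n)) * E2 (-(1 * s)) :=
        ENNReal.tsum_le_tsum fun j => ENNReal.tsum_le_tsum (h1 j)
    _ = 2 ^ n * ENNReal.ofReal (2 * π * n) ^ 2 * (∑' j : ℕ, E2 (2 * (j * m)) *
        ∫⁻ x, ‖mult (a j) f x‖ₑ ^ 2 ∂μT n) * ∑' s : ℕ, E2 (-(1 * s)) := by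
        simp_rw [ENNReal.tsum_mul_left, ENNReal.tsum_mul_right, ENNReal.tsum_mul_left]
    _ ≤ 2 ^ n * ENNReal.ofReal (2 * π * n) ^ 2 *
        (ENNReal.ofReal L ^ 2 * ∫⁻ x, ‖f x‖ₑ ^ 2 ∂μT n) * ∑' s : ℕ, E2 (-(1 * s)) := by
        refine mul_le_mul' (mul_le_mul' le_rfl (h.tsum_lintegral_sq_le hf)) le_rfl
    _ = _ := by unfold lowC; ring

/-- Cancellation of the weights in the interpolation argument. -/
lemma weight_eq {M c : ℝ≥0∞} {x y z q : ℝ} (hq : 0 ≤ q)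
    (hxyz : x + y * q = z) :
    M * E2 x * (E2 y * c⁻¹) ^ q = (c⁻¹) ^ q * (M * E2 z) := by
  rw [ENNReal.mul_rpow_of_nonneg _ _ hq, E2_rpow, ← hxyz, E2_add]
  ring

lemma exists_low_rpow_le (n : ℕ) {ρ m L p : ℝ} (hL : 0 < L) (hp : 2 < p)
    (hm : p * m = (p - 2) * (n * (1 - ρ) / 2)) :
    ∃ C : ℝ≥0∞, C ≠ ∞ ∧ ∀ K a, SymFam n ρ m L K a → ∀ f, Bdd f →
      ∑' j : ℕ, ∑' s : ℕ, E2 (1 * s) *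
        ∫⁻ x, dosc (j + s + 1) (dyad (j + s + 1) x) (mult (a j) f) ^ p ∂μT n ≤
      C * ∫⁻ x, ‖f x‖ₑ ^ p ∂μT n := by
  have hT := tailC_nonneg n
  set c : ℝ≥0∞ := 2 * ENNReal.ofReal ((1 + tailC n) * L) with hc
  have hc0 : c ≠ 0 := mul_ne_zero (by simp) (by
    rw [Ne, ENNReal.ofReal_eq_zero, not_le]; positivity)
  have hct : c ≠ ∞ := by finiteness
  have hp2 : 0 < p - 2 := by linarith
  have hcp0 : c⁻¹ ^ (p - 2) ≠ 0 := by
    rw [Ne, ENNReal.rpow_eq_zero_iff]; simp [hct, hc0]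
  have hcpt : c⁻¹ ^ (p - 2) ≠ ∞ := ENNReal.rpow_ne_top_of_nonneg hp2.le (by simp [hc0])
  refine ⟨(c⁻¹ ^ (p - 2))⁻¹ * (4 * 2 ^ (p - 2) * lowC n L), ?_, ?_⟩
  · refine ENNReal.mul_ne_top (by simpa using hcp0) (ENNReal.mul_ne_top ?_ (lowC_ne_top n L))
    exact ENNReal.mul_ne_top (by simp) (ENNReal.rpow_ne_top_of_nonneg hp2.le (by simp))
  intro K a h f hf
  have key := tsum_interpolation (n := n) (Y := ℕ × ℕ × (Fin n → ℤ))
    (fun y f => dosc (y.1 + y.2.1 + 1) y.2.2 (mult (a y.1) f))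
    (fun y => μT n (dcube (y.1 + y.2.1 + 1) y.2.2) * E2 (2 * (y.1 * m) + y.2.1))
    (fun y => E2 (y.1 * (m - n * (1 - ρ) / 2)) * c⁻¹)
    (fun y => mul_ne_zero (E2_ne_zero _) (by simpa using hct))
    (fun y => ENNReal.mul_ne_top (E2_ne_top _) (by simpa using hc0)) (lowC n L)
    (fun y f g hf hg => dosc_mult_add_le (h.fin _) hf hg _ _)
    (fun f hf => by
      rw [tsum_dcube (fun j s => j + s + 1) (fun j s => E2 (2 * (j * m) + s)) (fun t => t ^ 2)
        (fun j s => mult (a j) f)]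
      exact h.tsum_low_sq_le hf)
    (fun y f hf B hBt hB => by
      have h1 : dosc (y.1 + y.2.1 + 1) y.2.2 (mult (a y.1) f) ≤ _ :=
        dosc_le_of_le (continuous_mult (h.fin y.1) f).measurable
          (fun x _ => h.enorm_mult_le hL.le hf hB y.1 x)
      refine (mul_le_mul' le_rfl h1).trans (le_of_eq ?_)
      calc _ = (c⁻¹ * c) * (E2 (-(y.1 * (n * (1 - ρ) / 2 - m))) *
            E2 (y.1 * (n * (1 - ρ) / 2 - m))) * B := by
            rw [show (y.1 : ℝ) * (m - n * (1 - ρ) / 2) = -(y.1 * (n * (1 - ρ) / 2 - m)) by ring, hc]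
            ring
        _ = B := by rw [ENNReal.inv_mul_cancel hc0 hct, E2_neg_mul_self, one_mul, one_mul])
    hp hf
  have e : ∀ y : ℕ × ℕ × (Fin n → ℤ),
      μT n (dcube (y.1 + y.2.1 + 1) y.2.2) * E2 (2 * (y.1 * m) + y.2.1) *
        (E2 (y.1 * (m - n * (1 - ρ) / 2)) * c⁻¹) ^ (p - 2) *
        dosc (y.1 + y.2.1 + 1) y.2.2 (mult (a y.1) f) ^ p =
      c⁻¹ ^ (p - 2) * (μT n (dcube (y.1 + y.2.1 + 1) y.2.2) * E2 (1 * y.2.1) *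
        dosc (y.1 + y.2.1 + 1) y.2.2 (mult (a y.1) f) ^ p) := by
    intro y
    rw [weight_eq hp2.le (z := 1 * y.2.1)]
    · ring
    · linear_combination (y.1 : ℝ) * hm
  simp_rw [e] at key
  rw [ENNReal.tsum_mul_left, tsum_dcube (fun j s => j + s + 1) (fun j s => E2 (1 * s))
    (fun t => t ^ p) (fun j s => mult (a j) f)] at key
  rw [mul_assoc (c⁻¹ ^ (p - 2))⁻¹]
  rwa [← ENNReal.mul_le_iff_le_inv hcp0 hcpt]

/-- Off-diagonal decay exponent in the high-frequency part. -/
lemma high_local_le {n : ℕ} (hn : 1 ≤ n) {ρ τ : ℝ} (hρ : ρ ≤ 1) (hτ0 : 0 ≤ τ)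
    (hτ : (n : ℝ) * (1 - ρ) / 2 - 1 / 4 ≤ τ) (k s : ℕ) :
    ((2 : ℝ) ^ k * 2 ^ (-(((k + s : ℕ) : ℝ) * ρ) + s / 2 : ℝ) + 2 * π) ^ ((n : ℝ) / 2) ≤
      (1 + 2 * π) ^ ((n : ℝ) / 2) * 2 ^ (k * ((n : ℝ) * (1 - ρ) / 2) + s * τ) := by
  have hn' : (1 : ℝ) ≤ n := by exact_mod_cast hn
  set E : ℝ := k * ((n : ℝ) * (1 - ρ) / 2) + s * τ with hE
  have hρ' : 0 ≤ 1 - ρ := by linarith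
  have hE0 : 0 ≤ E := by positivity
  have h1 : (1 : ℝ) ≤ 2 ^ (E * (2 / n)) :=
    Real.one_le_rpow (by norm_num) (by positivity)
  have h2 : (2 : ℝ) ^ k * 2 ^ (-(((k + s : ℕ) : ℝ) * ρ) + s / 2 : ℝ) ≤ 2 ^ (E * (2 / n)) := by
    rw [← Real.rpow_natCast, ← Real.rpow_add two_pos]
    refine Real.rpow_le_rpow_of_exponent_le (by norm_num) ?_
    rw [hE, ← sub_nonneg]
    have e : (k * ((n : ℝ) * (1 - ρ) / 2) + s * τ) * (2 / n) -
        (k + (-(((k + s : ℕ) : ℝ) * ρ) + s / 2)) =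
        s * (τ - (n * (1 - ρ) / 2 - n / 4)) * (2 / n) := by
      push_cast; field_simp; ring
    rw [e]
    have : 0 ≤ τ - (n * (1 - ρ) / 2 - n / 4) := by linarith
    positivity
  have h3 : (2 : ℝ) ^ k * 2 ^ (-(((k + s : ℕ) : ℝ) * ρ) + s / 2 : ℝ) + 2 * π ≤
      (1 + 2 * π) * 2 ^ (E * (2 / n)) := by
    rw [add_mul, one_mul]
    exact add_le_add h2 (le_mul_of_one_le_right (by positivity) h1)
  refine (Real.rpow_le_rpow (by positivity) h3 (by positivity)).trans (le_of_eq ?_)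
  rw [Real.mul_rpow (by positivity) (by positivity), ← Real.rpow_mul (by norm_num)]
  congr 2
  field_simp

lemma exists_high_rpow_le {n : ℕ} (hn : 1 ≤ n) {ρ m L p : ℝ} (hL : 0 < L) (hp : 2 < p)
    (hρ : ρ < 1) (hm : p * m = (p - 2) * (n * (1 - ρ) / 2)) :
    ∃ δ : ℝ, 0 < δ ∧ ∃ C : ℝ≥0∞, C ≠ ∞ ∧ ∀ K a, SymFam n ρ m L K a → ∀ f, Bdd f →
      ∑' k : ℕ, ∑' s : ℕ, E2 (δ * s) *
        ∫⁻ x, dosc k (dyad k x) (mult (a (k + s)) f) ^ p ∂μT n ≤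
      C * ∫⁻ x, ‖f x‖ₑ ^ p ∂μT n := by
  have hT := tailC_nonneg n
  have hn' : (1 : ℝ) ≤ n := by exact_mod_cast hn
  set D : ℝ := n * (1 - ρ) / 2 with hD
  have hD0 : 0 < D := by
    have : 0 < 1 - ρ := by linarith
    positivity
  set τ : ℝ := max 0 (D - 1 / 4) with hτ
  have hτ0 : 0 ≤ τ := le_max_left _ _
  have hτ1 : D - 1 / 4 ≤ τ := le_max_right _ _
  have hτD : τ < D := max_lt hD0 (by linarith)
  have hp2 : 0 < p - 2 := by linarith
  set δ : ℝ := (p - 2) * (D - τ) / 2 with hδ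
  have hδ0 : 0 < δ := by
    have : 0 < D - τ := by linarith
    positivity
  set A : ℝ := 2 * L * (1 + 2 * π) ^ ((n : ℝ) / 2) with hA
  have hA0 : 0 < A := by positivity
  set c : ℝ≥0∞ := ENNReal.ofReal A + 2 * ENNReal.ofReal (tailC n * L) with hc
  have hc0 : c ≠ 0 := by
    have : ENNReal.ofReal A ≠ 0 := by rw [Ne, ENNReal.ofReal_eq_zero, not_le]; exact hA0
    intro h0
    exact this (add_eq_zero.1 h0).1
  have hct : c ≠ ∞ := by finiteness
  have hcp0 : c⁻¹ ^ (p - 2) ≠ 0 := by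
    rw [Ne, ENNReal.rpow_eq_zero_iff]; simp [hct, hc0]
  have hcpt : c⁻¹ ^ (p - 2) ≠ ∞ := ENNReal.rpow_ne_top_of_nonneg hp2.le (by simp [hc0])
  set Sδ : ℝ≥0∞ := ∑' s : ℕ, E2 (-(δ * s)) with hSδ
  have hSt : Sδ ≠ ∞ := tsum_E2_ne_top hδ0
  refine ⟨δ, hδ0, (c⁻¹ ^ (p - 2))⁻¹ * (4 * 2 ^ (p - 2) * (4 * Sδ * ENNReal.ofReal L ^ 2)), ?_, ?_⟩
  · refine ENNReal.mul_ne_top (by simpa using hcp0) (ENNReal.mul_ne_top ?_ (by finiteness))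
    exact ENNReal.mul_ne_top (by simp) (ENNReal.rpow_ne_top_of_nonneg hp2.le (by simp))
  intro K a h f hf
  have key := tsum_interpolation (n := n) (Y := ℕ × ℕ × (Fin n → ℤ))
    (fun y f => dosc y.1 y.2.2 (mult (a (y.1 + y.2.1)) f))
    (fun y => μT n (dcube y.1 y.2.2) * E2 (2 * ((y.1 + y.2.1 : ℕ) * m) - δ * y.2.1))
    (fun y => E2 ((y.1 + y.2.1 : ℕ) * m - y.1 * D - y.2.1 * τ) * c⁻¹)
    (fun y => mul_ne_zero (E2_ne_zero _) (by simpa using hct))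
    (fun y => ENNReal.mul_ne_top (E2_ne_top _) (by simpa using hc0))
    (4 * Sδ * ENNReal.ofReal L ^ 2)
    (fun y f g hf hg => dosc_mult_add_le (h.fin _) hf hg _ _)
    (fun f hf => by
      rw [tsum_dcube (fun k s => k) (fun k s => E2 (2 * ((k + s : ℕ) * m) - δ * s)) (fun t => t ^ 2)
        (fun k s => mult (a (k + s)) f), ENNReal.tsum_comm]
      calc _ ≤ ∑' s : ℕ, 4 * E2 (-(δ * s)) *
            (ENNReal.ofReal L ^ 2 * ∫⁻ x, ‖f x‖ₑ ^ 2 ∂μT n) := by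
            refine ENNReal.tsum_le_tsum fun s => ?_
            have hinj : Function.Injective fun k : ℕ => k + s := add_left_injective s
            refine le_trans ?_ (mul_le_mul' le_rfl ((ENNReal.tsum_comp_le_tsum_of_injective hinj
              (fun j : ℕ => E2 (2 * (j * m)) * ∫⁻ x, ‖mult (a j) f x‖ₑ ^ 2 ∂μT n)).trans
              (h.tsum_lintegral_sq_le hf)))
            rw [← ENNReal.tsum_mul_left]
            refine ENNReal.tsum_le_tsum fun k => ?_
            refine (mul_le_mul' le_rfl (lintegral_dosc_sq_le
              (continuous_mult (h.fin (k + s)) f).measurable k)).trans (le_of_eq ?_)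
            rw [sub_eq_add_neg, E2_add]
            ring
        _ = _ := by rw [ENNReal.tsum_mul_right, ENNReal.tsum_mul_left]; ring)
    (fun y f hf B hBt hB => by
      obtain ⟨k, s, i⟩ := y
      rcases (dcube k i).eq_empty_or_nonempty with he | ⟨x₀, rfl⟩
      · simp [dosc_empty he]
      simp only
      set t : ℝ := -(((k + s : ℕ) : ℝ) * ρ) + s / 2 with ht
      have h1 := dosc_mult_le_near_add_far (h.fin (k + s)) hf (by positivity)
        (h.enorm_le hL.le (k + s)) hB k x₀ (r := (2 : ℝ) ^ t) (by positivity)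
      have h2 : ENNReal.ofReal (2 * (L * 2 ^ (-(((k + s : ℕ) : ℝ) * m))) *
          (2 ^ k * 2 ^ t + 2 * π) ^ ((n : ℝ) / 2)) ≤
          ENNReal.ofReal A * E2 (-((k + s : ℕ) * m - k * D - s * τ)) := by
        rw [← ofReal_mul_two_rpow hA0.le]
        refine ENNReal.ofReal_le_ofReal ?_
        refine (mul_le_mul_of_nonneg_left (high_local_le hn hρ.le hτ0 hτ1 k s)
          (by positivity)).trans (le_of_eq ?_)
        rw [show -(((k + s : ℕ) : ℝ) * m - k * D - s * τ) =
          -(((k + s : ℕ) : ℝ) * m) + (k * D + s * τ) by ring,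
          Real.rpow_add two_pos (-(((k + s : ℕ) : ℝ) * m)), hA, hD]
        ring
      have h3 : ∫⁻ z in {z | ∃ l, (2 : ℝ) ^ t ≤ chord (z l)}, ‖trig (a (k + s)) z‖ₑ ∂μT n ≤
          ENNReal.ofReal (tailC n * L) * E2 (-((k + s : ℕ) * m - k * D - s * τ)) := by
        refine (h.far_le hL.le (k + s) t).trans (mul_le_mul' le_rfl (E2_mono ?_))
        have hN := half_lt_natDiv n
        set N : ℝ := ((n / 2 + 1 : ℕ) : ℝ)
        rw [← sub_nonneg]
        have e : -(((k + s : ℕ) : ℝ) * m - k * D - s * τ) -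
            (((k + s : ℕ) : ℝ) * (n / 2 - m - ρ * N) + t * (n / 2 - N)) =
            s * ((τ - (D - 1 / 4)) + 1 / 2 * (N - (n / 2 + 1 / 2))) := by
          rw [ht, hD]; push_cast; ring
        rw [e]
        have : 0 ≤ τ - (D - 1 / 4) := by linarith
        have : 0 ≤ N - (n / 2 + 1 / 2) := by linarith
        positivity
      set e := ((k + s : ℕ) : ℝ) * m - k * D - s * τ with he
      calc _ ≤ E2 e * c⁻¹ * ((ENNReal.ofReal A * E2 (-e) +
            2 * (ENNReal.ofReal (tailC n * L) * E2 (-e))) * B) :=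
            mul_le_mul' le_rfl (h1.trans (mul_le_mul' (add_le_add h2 (mul_le_mul' le_rfl h3))
                le_rfl))
        _ = (c⁻¹ * c) * (E2 (-e) * E2 e) * B := by rw [hc]; ring
        _ = B := by rw [ENNReal.inv_mul_cancel hc0 hct, E2_neg_mul_self, one_mul, one_mul])
    hp hf
  have e : ∀ y : ℕ × ℕ × (Fin n → ℤ),
      μT n (dcube y.1 y.2.2) * E2 (2 * ((y.1 + y.2.1 : ℕ) * m) - δ * y.2.1) *
        (E2 ((y.1 + y.2.1 : ℕ) * m - y.1 * D - y.2.1 * τ) * c⁻¹) ^ (p - 2) *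
        dosc y.1 y.2.2 (mult (a (y.1 + y.2.1)) f) ^ p =
      c⁻¹ ^ (p - 2) * (μT n (dcube y.1 y.2.2) * E2 (δ * y.2.1) *
        dosc y.1 y.2.2 (mult (a (y.1 + y.2.1)) f) ^ p) := by
    intro y
    rw [weight_eq hp2.le (z := δ * y.2.1)]
    · ring
    · rw [hδ]; push_cast; linear_combination ((y.1 : ℝ) + y.2.1) * hm
  simp_rw [e] at key
  rw [ENNReal.tsum_mul_left, tsum_dcube (fun k s => k) (fun k s => E2 (δ * s))
    (fun t => t ^ p) (fun k s => mult (a (k + s)) f)] at key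
  rw [mul_assoc (c⁻¹ ^ (p - 2))⁻¹]
  rwa [← ENNReal.mul_le_iff_le_inv hcp0 hcpt]

end SymFam

end

section

variable {n : ℕ}

lemma measurable_dosc_dyad (k : ℕ) (g : (Fin n → ℝ) → ℂ) :
    Measurable fun x => dosc k (dyad k x) g :=
  measurable_comp_dyad k fun i => dosc k i g

lemma tsum_lintegral_low_le {q : ℝ} (hq : 0 < q) (θ : ℝ) (g : ℕ → (Fin n → ℝ) → ℂ) :
    ∑' k, ∫⁻ x, (∑ j ∈ Finset.range k, dosc k (dyad k x) (g j)) ^ q ∂μT n ≤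
      (∑' s : ℕ, E2 (-(θ / q * s))) ^ q * ∑' j : ℕ, ∑' s : ℕ, E2 (θ * s) *
        ∫⁻ x, dosc (j + s + 1) (dyad (j + s + 1) x) (g j) ^ q ∂μT n := by
  rw [← lintegral_tsum]
  · refine (lintegral_mono fun x => tsum_sum_range_rpow_le hq θ
      fun k j => dosc k (dyad k x) (g j)).trans (le_of_eq ?_)
    have hm : ∀ s j : ℕ, Measurable fun x =>
        E2 (θ * s) * dosc (j + s + 1) (dyad (j + s + 1) x) (g j) ^ q :=
      fun s j => ((measurable_dosc_dyad _ _).pow_const q).const_mul _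
    rw [lintegral_const_mul _ (Measurable.tsum fun s => Measurable.tsum (hm s)),
      lintegral_tsum fun s => (Measurable.tsum (hm s)).aemeasurable]
    congr 1
    rw [ENNReal.tsum_comm (f := fun j s : ℕ => _)]
    refine tsum_congr fun s => ?_
    rw [lintegral_tsum fun j => (hm s j).aemeasurable]
    exact tsum_congr fun j => lintegral_const_mul _ ((measurable_dosc_dyad _ _).pow_const q)
  · exact fun k => ((Finset.measurable_fun_sum _ fun j _ =>
      measurable_dosc_dyad k (g j)).pow_const q).aemeasurable

lemma lintegral_iSup_rpow_le {q : ℝ} (hq : 0 < q) {F : ℕ → (Fin n → ℝ) → ℝ≥0∞}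
    (hF : ∀ k, Measurable (F k)) :
    ∫⁻ x, (⨆ k, F k x) ^ q ∂μT n ≤ ∑' k, ∫⁻ x, F k x ^ q ∂μT n := by
  rw [← lintegral_tsum fun k => ((hF k).pow_const q).aemeasurable]
  refine lintegral_mono fun x => ?_
  rw [← ENNReal.rpow_le_rpow_iff (inv_pos.2 hq), ENNReal.rpow_rpow_inv hq.ne']
  refine iSup_le fun k => ?_
  rw [← ENNReal.rpow_le_rpow_iff hq, ENNReal.rpow_inv_rpow hq.ne']
  exact ENNReal.le_tsum (f := fun k => F k x ^ q) k

lemma dosc_neg (k : ℕ) (i : Fin n → ℤ) (g : (Fin n → ℝ) → ℂ) :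
    dosc k i (fun x => - g x) = dosc k i g := by
  have : ∀ x y, ‖-g x - -g y‖ₑ = ‖g x - g y‖ₑ := fun x y => by
    rw [← enorm_neg, neg_sub, neg_sub_neg, ← enorm_neg, neg_sub]
  simp only [dosc, this]

namespace SymFam

variable {ρ m L : ℝ} {K : ℕ} {a : ℕ → (Fin n → ℤ) → ℂ} {f : (Fin n → ℝ) → ℂ}

lemma mult_sum_eq (h : SymFam n ρ m L K a) (s : Finset ℕ) (x : Fin n → ℝ) :
    mult (∑ j ∈ s, a j) f x = ∑ j ∈ s, mult (a j) f x := by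
  rw [show (∑ j ∈ s, a j) = fun ξ => ∑ j ∈ s, a j ξ from funext fun ξ => Finset.sum_apply ξ s a]
  exact mult_sum s h.fin f x

lemma measurable_mult (h : SymFam n ρ m L K a) (j : ℕ) : Measurable (mult (a j) f) :=
  (continuous_mult (h.fin j) f).measurable

lemma mult_zero (h : SymFam n ρ m L K a) {j : ℕ} (hj : K ≤ j) : mult (a j) f = fun _ => 0 := by
  ext x; simp [h.zero j hj, mult, trig]

/-- Splitting the oscillation into low and high frequencies. -/
lemma dosc_le_low_add_high (h : SymFam n ρ m L K a) (k : ℕ) (i : Fin n → ℤ) :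
    dosc k i (mult (∑ j ∈ Finset.range K, a j) f) ≤
      ∑ j ∈ Finset.range k, dosc k i (mult (a j) f) + ∑' s, dosc k i (mult (a (k + s)) f) := by
  have h1 : mult (∑ j ∈ Finset.range K, a j) f =
      fun x => ∑ j ∈ Finset.range K, mult (a j) f x := by
    ext x; exact h.mult_sum_eq _ x
  rw [h1]
  refine (dosc_sum_le _ (fun j => h.measurable_mult j) k i).trans
    ((ENNReal.sum_le_tsum _).trans (le_of_eq ?_))
  rw [← ENNReal.summable.sum_add_tsum_nat_add' (k := k)]
  simp_rw [add_comm k]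

/-- The low-frequency maximal function. -/
def lowMax (a : ℕ → (Fin n → ℤ) → ℂ) (f : (Fin n → ℝ) → ℂ) (x : Fin n → ℝ) : ℝ≥0∞ :=
  ⨆ k, ∑ j ∈ Finset.range k, dosc k (dyad k x) (mult (a j) f)

/-- The high-frequency part of the operator at scale `k`. -/
def tailSym (K : ℕ) (a : ℕ → (Fin n → ℤ) → ℂ) (k : ℕ) : (Fin n → ℤ) → ℂ :=
  ∑ j ∈ Finset.Ico k K, a j

/-- The high-frequency maximal function. -/
def highMax (K : ℕ) (a : ℕ → (Fin n → ℤ) → ℂ) (f : (Fin n → ℝ) → ℂ) (x : Fin n → ℝ) : ℝ≥0∞ :=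
  ⨆ k, dosc k (dyad k x) (mult (tailSym K a k) f)

lemma lintegral_lowMax_rpow_le {q : ℝ} (hq : 0 < q) :
    ∫⁻ x, lowMax a f x ^ q ∂μT n ≤
      (∑' s : ℕ, E2 (-(1 / q * s))) ^ q * ∑' j : ℕ, ∑' s : ℕ, E2 (1 * s) *
        ∫⁻ x, dosc (j + s + 1) (dyad (j + s + 1) x) (mult (a j) f) ^ q ∂μT n :=
  (lintegral_iSup_rpow_le hq fun k => Finset.measurable_fun_sum _ fun _ _ =>
    measurable_dosc_dyad k _).trans (tsum_lintegral_low_le hq 1 fun j => mult (a j) f)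

lemma sum_range_eq (h : SymFam n ρ m L K a) (k : ℕ) (x : Fin n → ℝ) :
    mult (∑ j ∈ Finset.range K, a j) f x =
      ∑ j ∈ Finset.range k, mult (a j) f x + mult (tailSym K a k) f x := by
  rw [tailSym, h.mult_sum_eq, h.mult_sum_eq]
  rcases le_total k K with hk | hk
  · rw [Finset.sum_range_add_sum_Ico _ hk]
  · rw [Finset.Ico_eq_empty_of_le hk, Finset.sum_empty, add_zero,
      ← Finset.sum_range_add_sum_Ico _ hk]
    rw [Finset.sum_eq_zero (s := Finset.Ico K k), add_zero]
    intro j hj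
    rw [h.mult_zero (Finset.mem_Ico.1 hj).1]

lemma dsharp_le_lowMax_add_highMax (h : SymFam n ρ m L K a) (x : Fin n → ℝ) :
    dsharp (mult (∑ j ∈ Finset.range K, a j) f) x ≤ lowMax a f x + highMax K a f x := by
  refine iSup_le fun k => ?_
  refine (dosc_mono_add (g := fun x => ∑ j ∈ Finset.range k, mult (a j) f x)
    (Finset.measurable_fun_sum _ fun j _ => h.measurable_mult j)
    (fun x => h.sum_range_eq k x) k _).trans (add_le_add ?_ ?_)
  · exact (dosc_sum_le _ (fun j => h.measurable_mult j) k _).trans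
      (le_iSup (fun k => ∑ j ∈ Finset.range k, dosc k (dyad k x) (mult (a j) f)) k)
  · exact le_iSup (fun k => dosc k (dyad k x) (mult (tailSym K a k) f)) k

lemma highMax_le (h : SymFam n ρ m L K a) (x : Fin n → ℝ) :
    highMax K a f x ≤ dsharp (mult (∑ j ∈ Finset.range K, a j) f) x + lowMax a f x := by
  refine iSup_le fun k => ?_
  refine (dosc_mono_add (h := fun x => -∑ j ∈ Finset.range k, mult (a j) f x)
    (continuous_mult (h.support_sum_finite (Finset.range K)) f).measurable
    (fun x => by rw [h.sum_range_eq k x]; ring) k _).trans (add_le_add ?_ ?_)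
  · exact le_iSup (fun k => dosc k (dyad k x) (mult (∑ j ∈ Finset.range K, a j) f)) k
  · rw [dosc_neg]
    exact (dosc_sum_le _ (fun j => h.measurable_mult j) k _).trans
      (le_iSup (fun k => ∑ j ∈ Finset.range k, dosc k (dyad k x) (mult (a j) f)) k)

lemma measurable_lowMax : Measurable (lowMax a f) :=
  Measurable.iSup fun k => Finset.measurable_fun_sum _ fun _ _ => measurable_dosc_dyad k _

lemma measurable_highMax : Measurable (highMax K a f) :=
  Measurable.iSup fun k => measurable_dosc_dyad k _

/-- Chebyshev's inequality for the square. -/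
lemma sq_mul_meas_le {F : (Fin n → ℝ) → ℝ≥0∞} (hF : Measurable F) (t : ℝ≥0∞) :
    t ^ 2 * μT n {x | t < F x} ≤ ∫⁻ x, F x ^ 2 ∂μT n := by
  refine le_trans ?_ (mul_meas_ge_le_lintegral (hF.pow_const 2) (t ^ 2))
  refine mul_le_mul' le_rfl (measure_mono fun x hx => ?_)
  exact pow_le_pow_left' (le_of_lt (show t < F x from hx)) 2

lemma sq_mul_μT_dsharp_le {g : (Fin n → ℝ) → ℂ} (hg : Measurable g) (t : ℝ≥0∞) :
    t ^ 2 * μT n {x | t < dsharp g x} ≤ 4 * ∫⁻ x, ‖g x‖ₑ ^ 2 ∂μT n := by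
  have hsub : {x | t < dsharp g x} ⊆ {x | t ^ 2 * 4⁻¹ < dmax (fun y => ‖g y‖ₑ ^ 2) x} := by
    intro x hx
    obtain ⟨k, hk⟩ := lt_iSup_iff.1 (show t < ⨆ k, dosc k (dyad k x) g from hx)
    have h1 : t ^ 2 < 4 * davg k (fun y => ‖g y‖ₑ ^ 2) x :=
      lt_of_lt_of_le (ENNReal.pow_lt_pow_left two_ne_zero hk) (dosc_sq_le hg k x)
    have h2 : t ^ 2 * 4⁻¹ < davg k (fun y => ‖g y‖ₑ ^ 2) x := by
      rw [← div_eq_mul_inv]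
      exact ENNReal.div_lt_of_lt_mul' h1
    exact lt_of_lt_of_le h2 (le_iSup (fun k => davg k (fun y => ‖g y‖ₑ ^ 2) x) k)
  calc t ^ 2 * μT n {x | t < dsharp g x}
      ≤ 4 * (t ^ 2 * 4⁻¹ * μT n {x | t ^ 2 * 4⁻¹ < dmax (fun y => ‖g y‖ₑ ^ 2) x}) := by
        have : (4 : ℝ≥0∞) * 4⁻¹ = 1 := ENNReal.mul_inv_cancel (by simp) (by simp)
        rw [← mul_assoc, mul_left_comm, this, mul_one]
        exact mul_le_mul' le_rfl (measure_mono hsub)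
    _ ≤ _ := mul_le_mul' le_rfl (mul_μT_dmax_le _ _)

end SymFam

end

section

variable {n : ℕ}

lemma tsum_E2_rpow_ne_top {δ q : ℝ} (hδ : 0 < δ) (hq : 0 < q) :
    (∑' s : ℕ, E2 (-(δ * s))) ^ q ≠ ∞ :=
  ENNReal.rpow_ne_top_of_nonneg hq.le (tsum_E2_ne_top hδ)

namespace SymFam

/-- The sharp function estimate when `ρ < 1`. -/
lemma exists_dsharp_rpow_le_of_lt {n : ℕ} (hn : 1 ≤ n) {ρ m L p : ℝ} (hL : 0 < L) (hp : 2 < p)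
    (hρ : ρ < 1) (hm : p * m = (p - 2) * (n * (1 - ρ) / 2)) :
    ∃ C : ℝ≥0∞, C ≠ ∞ ∧ ∀ K a, SymFam n ρ m L K a → ∀ f, Bdd f →
      ∫⁻ x, dsharp (mult (∑ j ∈ Finset.range K, a j) f) x ^ p ∂μT n ≤
        C * ∫⁻ x, ‖f x‖ₑ ^ p ∂μT n := by
  have hp0 : 0 < p := by linarith
  obtain ⟨C₁, hC₁, h1⟩ := exists_low_rpow_le n hL hp hm
  obtain ⟨δ, hδ, C₂, hC₂, h2⟩ := exists_high_rpow_le hn hL hp hρ hm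
  refine ⟨2 ^ (p - 1) * ((∑' s : ℕ, E2 (-(1 / p * s))) ^ p * C₁ +
    (∑' s : ℕ, E2 (-(δ / p * s))) ^ p * C₂), ?_, ?_⟩
  · refine ENNReal.mul_ne_top (ENNReal.rpow_ne_top_of_nonneg (by linarith) (by simp))
      (ENNReal.add_ne_top.2 ⟨ENNReal.mul_ne_top (tsum_E2_rpow_ne_top (by positivity) hp0) hC₁,
      ENNReal.mul_ne_top (tsum_E2_rpow_ne_top (by positivity) hp0) hC₂⟩)
  intro K a h f hf
  have hlm : ∀ k, Measurable fun x => ∑ j ∈ Finset.range k, dosc k (dyad k x) (mult (a j) f) :=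
    fun k => Finset.measurable_fun_sum _ fun j _ => measurable_dosc_dyad k _
  calc ∫⁻ x, dsharp (mult (∑ j ∈ Finset.range K, a j) f) x ^ p ∂μT n
      ≤ ∑' k, ∫⁻ x, dosc k (dyad k x) (mult (∑ j ∈ Finset.range K, a j) f) ^ p ∂μT n :=
        lintegral_iSup_rpow_le hp0 fun k => measurable_dosc_dyad k _
    _ ≤ ∑' k, 2 ^ (p - 1) *
          (∫⁻ x, (∑ j ∈ Finset.range k, dosc k (dyad k x) (mult (a j) f)) ^ p ∂μT n +
          ∫⁻ x, (∑' s, dosc k (dyad k x) (mult (a (k + s)) f)) ^ p ∂μT n) := by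
        refine ENNReal.tsum_le_tsum fun k => ?_
        rw [← lintegral_add_left ((hlm k).pow_const p), ← lintegral_const_mul' _ _
          (ENNReal.rpow_ne_top_of_nonneg (by linarith) (by simp))]
        refine lintegral_mono fun x => ?_
        exact (ENNReal.rpow_le_rpow (h.dosc_le_low_add_high k _) hp0.le).trans
          (ENNReal.rpow_add_le_mul_rpow_add_rpow _ _ (by linarith))
    _ = 2 ^ (p - 1) *
          (∑' k, ∫⁻ x, (∑ j ∈ Finset.range k, dosc k (dyad k x) (mult (a j) f)) ^ p ∂μT n +
          ∑' k, ∫⁻ x, (∑' s, dosc k (dyad k x) (mult (a (k + s)) f)) ^ p ∂μT n) := by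
        rw [ENNReal.tsum_mul_left, ENNReal.tsum_add]
    _ ≤ _ := by
        rw [mul_assoc, add_mul, mul_assoc, mul_assoc]
        refine mul_le_mul' le_rfl (add_le_add ?_ ?_)
        · exact (tsum_lintegral_low_le hp0 1 fun j => mult (a j) f).trans
            (mul_le_mul' le_rfl (h1 K a h f hf))
        · refine le_trans ?_ (mul_le_mul' le_rfl (h2 K a h f hf))
          rw [← ENNReal.tsum_mul_left]
          refine ENNReal.tsum_le_tsum fun k => ?_
          have hmk : ∀ s : ℕ, Measurable fun x =>
              E2 (δ * s) * dosc k (dyad k x) (mult (a (k + s)) f) ^ p :=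
            fun s => ((measurable_dosc_dyad _ _).pow_const p).const_mul _
          refine (lintegral_mono fun x => tsum_rpow_le hp0 δ
            fun s => dosc k (dyad k x) (mult (a (k + s)) f)).trans (le_of_eq ?_)
          rw [lintegral_const_mul _ (Measurable.tsum hmk),
            lintegral_tsum fun s => (hmk s).aemeasurable]
          congr 1
          exact tsum_congr fun s => lintegral_const_mul _ ((measurable_dosc_dyad _ _).pow_const p)

/-- The constant in `SymFam.lintegral_lowMax_sq_le`. -/
def lowMaxC (n : ℕ) (L : ℝ) : ℝ≥0∞ :=
  (∑' s : ℕ, E2 (-(1 / 2 * s))) ^ (2 : ℝ) * lowC n L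

lemma lintegral_lowMax_sq_le {ρ L : ℝ} {K : ℕ} {a : ℕ → (Fin n → ℤ) → ℂ}
    (h : SymFam n ρ 0 L K a) {f : (Fin n → ℝ) → ℂ} (hf : Bdd f) :
    ∫⁻ x, lowMax a f x ^ 2 ∂μT n ≤ lowMaxC n L * ∫⁻ x, ‖f x‖ₑ ^ 2 ∂μT n := by
  have h1 := lintegral_lowMax_rpow_le (n := n) (a := a) (f := f) (q := 2) two_pos
  simp only [ENNReal.rpow_ofNat, one_mul] at h1
  have h2 := h.tsum_low_sq_le hf
  simp only [mul_zero, zero_add] at h2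
  refine h1.trans ?_
  rw [lowMaxC, mul_assoc, ENNReal.rpow_ofNat]
  exact mul_le_mul' le_rfl h2

lemma highMax_weak_le {ρ L : ℝ} {K : ℕ} {a : ℕ → (Fin n → ℤ) → ℂ}
    (h : SymFam n ρ 0 L K a) {f : (Fin n → ℝ) → ℂ} (hf : Bdd f) (t : ℝ≥0∞) :
    t ^ 2 * μT n {x | t < highMax K a f x} ≤
      4 * (4 * ENNReal.ofReal L ^ 2 + lowMaxC n L) * ∫⁻ x, ‖f x‖ₑ ^ 2 ∂μT n := by
  set T := mult (∑ j ∈ Finset.range K, a j) f with hT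
  have hfin := h.support_sum_finite (Finset.range K)
  have hsub : {x | t < highMax K a f x} ⊆ {x | t / 2 < dsharp T x} ∪ {x | t / 2 < lowMax a f x} :=
      by
    intro x hx
    by_contra hcon
    simp only [Set.mem_union, Set.mem_ofPred_eq, not_or, not_lt] at hcon
    have h1 := (h.highMax_le (f := f) x).trans (add_le_add hcon.1 hcon.2)
    rw [ENNReal.add_halves] at h1
    exact absurd (show t < highMax K a f x from hx) (not_lt.2 h1)
  have ht : t ^ 2 = 4 * (t / 2) ^ 2 := by
    rw [ENNReal.div_eq_inv_mul, mul_pow, ← mul_assoc, ← ENNReal.inv_pow,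
      show (2 : ℝ≥0∞) ^ 2 = 4 by norm_num, ENNReal.mul_inv_cancel (by simp) (by simp), one_mul]
  calc t ^ 2 * μT n {x | t < highMax K a f x}
      ≤ 4 * ((t / 2) ^ 2 * μT n {x | t / 2 < dsharp T x} +
          (t / 2) ^ 2 * μT n {x | t / 2 < lowMax a f x}) := by
        rw [ht, mul_assoc, ← mul_add]
        exact mul_le_mul' le_rfl (mul_le_mul' le_rfl
          ((measure_mono hsub).trans (measure_union_le _ _)))
    _ ≤ 4 * (4 * (ENNReal.ofReal L ^ 2 * ∫⁻ x, ‖f x‖ₑ ^ 2 ∂μT n) +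
          lowMaxC n L * ∫⁻ x, ‖f x‖ₑ ^ 2 ∂μT n) := by
        refine mul_le_mul' le_rfl (add_le_add ?_ ?_)
        · exact (sq_mul_μT_dsharp_le (continuous_mult hfin f).measurable _).trans
            (mul_le_mul' le_rfl (lintegral_mult_sq_le hfin hf (h.enorm_sum_le le_rfl _)))
        · exact (sq_mul_meas_le measurable_lowMax _).trans (h.lintegral_lowMax_sq_le hf)
    _ = _ := by ring

/-- The bound for the `L^∞` norm of `SymFam.highMax`. -/
def highC (n : ℕ) (L : ℝ) : ℝ≥0∞ :=
  ENNReal.ofReal (2 * L * (1 + 2 * π) ^ ((n : ℝ) / 2)) +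
    2 * (ENNReal.ofReal (tailC n * L) *
      ∑' s : ℕ, E2 (-(((n / 2 + 1 : ℕ) - (n : ℝ) / 2) * s)))

lemma highC_ne_top (n : ℕ) (L : ℝ) : highC n L ≠ ∞ := by
  have h1 := tsum_E2_ne_top (δ := (n / 2 + 1 : ℕ) - (n : ℝ) / 2) (by linarith [half_lt_natDiv n])
  unfold highC
  exact ENNReal.add_ne_top.2 ⟨by simp, ENNReal.mul_ne_top (by simp)
    (ENNReal.mul_ne_top (by simp) h1)⟩

lemma trig_tailSym {ρ m L : ℝ} {K : ℕ} {a : ℕ → (Fin n → ℤ) → ℂ}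
    (h : SymFam n ρ m L K a) (k : ℕ) (z : Fin n → ℝ) :
    trig (tailSym K a k) z = ∑ j ∈ Finset.Ico k K, trig (a j) z := by
  rw [← trig_sum _ h.fin]
  congr 1; ext ξ; rw [tailSym, Finset.sum_apply]

lemma highMax_le_of_bound {L : ℝ} (hL : 0 < L) {K : ℕ} {a : ℕ → (Fin n → ℤ) → ℂ}
    (h : SymFam n 1 0 L K a) {f : (Fin n → ℝ) → ℂ} (hf : Bdd f) {B : ℝ≥0∞}
    (hB : ∀ x, ‖f x‖ₑ ≤ B) (x : Fin n → ℝ) : highMax K a f x ≤ highC n L * B := by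
  refine iSup_le fun k => ?_
  refine (dosc_mult_le_near_add_far (h.support_sum_finite _) hf hL.le
    (h.enorm_sum_le le_rfl _) hB k x (r := 2 ^ (-(k : ℝ))) (by positivity)).trans ?_
  refine mul_le_mul' ?_ le_rfl
  have h1 : (2 : ℝ) ^ k * 2 ^ (-(k : ℝ)) = 1 := by
    rw [← Real.rpow_natCast, ← Real.rpow_add two_pos, add_neg_cancel, Real.rpow_zero]
  rw [h1, highC]
  refine add_le_add le_rfl (mul_le_mul' le_rfl ?_)
  change ∫⁻ z in _, ‖trig (tailSym K a k) z‖ₑ ∂μT n ≤ _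
  set S : Set (Fin n → ℝ) := {z | ∃ l, (2 : ℝ) ^ (-(k : ℝ)) ≤ chord (z l)}
  calc ∫⁻ z in S, ‖trig (tailSym K a k) z‖ₑ ∂μT n
      ≤ ∫⁻ z in S, ∑ j ∈ Finset.Ico k K, ‖trig (a j) z‖ₑ ∂μT n := by
        refine lintegral_mono fun z => ?_
        rw [h.trig_tailSym]
        exact _root_.enorm_sum_le _ _
    _ = ∑ j ∈ Finset.Ico k K, ∫⁻ z in S, ‖trig (a j) z‖ₑ ∂μT n :=
        lintegral_finsetSum _ fun j _ => (continuous_trig (h.fin j)).measurable.enorm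
    _ ≤ ∑ j ∈ Finset.Ico k K, ENNReal.ofReal (tailC n * L) *
          E2 (-(((n / 2 + 1 : ℕ) - (n : ℝ) / 2) * (j - k : ℕ))) := by
        refine Finset.sum_le_sum fun j hj => (h.far_le hL.le j _).trans (le_of_eq ?_)
        rw [Nat.cast_sub (Finset.mem_Ico.1 hj).1]
        congr 2; ring
    _ ≤ _ := by
        rw [← Finset.mul_sum, Finset.sum_Ico_eq_sum_range]
        refine mul_le_mul' le_rfl ?_
        simp only [add_tsub_cancel_left]
        exact ENNReal.sum_le_tsum _

/-- The sharp function estimate when `ρ = 1`. -/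
lemma exists_dsharp_rpow_le_of_eq (n : ℕ) {L p : ℝ} (hL : 0 < L) (hp : 2 < p) :
    ∃ C : ℝ≥0∞, C ≠ ∞ ∧ ∀ K a, SymFam n 1 0 L K a → ∀ f, Bdd f →
      ∫⁻ x, dsharp (mult (∑ j ∈ Finset.range K, a j) f) x ^ p ∂μT n ≤
        C * ∫⁻ x, ‖f x‖ₑ ^ p ∂μT n := by
  have hp0 : 0 < p := by linarith
  obtain ⟨C₁, hC₁, h1⟩ := exists_low_rpow_le (ρ := 1) (m := 0) n hL hp (by ring)
  set b := highC n L
  have hb0 : b ≠ 0 := by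
    have : ENNReal.ofReal (2 * L * (1 + 2 * π) ^ ((n : ℝ) / 2)) ≠ 0 := by
      rw [Ne, ENNReal.ofReal_eq_zero, not_le]; positivity
    intro h0
    exact this (add_eq_zero.1 h0).1
  have hbt : b ≠ ∞ := highC_ne_top n L
  set A : ℝ≥0∞ := 4 * (4 * ENNReal.ofReal L ^ 2 + lowMaxC n L) with hA
  have hAt : A ≠ ∞ := by
    refine ENNReal.mul_ne_top (by simp) (ENNReal.add_ne_top.2 ⟨by finiteness, ?_⟩)
    exact ENNReal.mul_ne_top (tsum_E2_rpow_ne_top (by positivity) two_pos) (lowC_ne_top n L)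
  set C₂ := (2 * b) ^ p * (ENNReal.ofReal p * (ENNReal.ofReal (p - 2))⁻¹ * (b⁻¹ ^ 2 * A))
  have hC₂ : C₂ ≠ ∞ := by
    refine ENNReal.mul_ne_top (ENNReal.rpow_ne_top_of_nonneg hp0.le (by finiteness))
      (ENNReal.mul_ne_top (ENNReal.mul_ne_top (by simp) ?_) (ENNReal.mul_ne_top ?_ hAt))
    · simpa using hp
    · exact ENNReal.pow_ne_top (by simpa using hb0)
  refine ⟨2 ^ (p - 1) * ((∑' s : ℕ, E2 (-(1 / p * s))) ^ p * C₁ + C₂), ?_, ?_⟩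
  · exact ENNReal.mul_ne_top (ENNReal.rpow_ne_top_of_nonneg (by linarith) (by simp))
      (ENNReal.add_ne_top.2 ⟨ENNReal.mul_ne_top (tsum_E2_rpow_ne_top (by positivity) hp0) hC₁, hC₂⟩)
  intro K a h f hf
  calc ∫⁻ x, dsharp (mult (∑ j ∈ Finset.range K, a j) f) x ^ p ∂μT n
      ≤ ∫⁻ x, 2 ^ (p - 1) * (lowMax a f x ^ p + highMax K a f x ^ p) ∂μT n :=
        lintegral_mono fun x => (ENNReal.rpow_le_rpow (h.dsharp_le_lowMax_add_highMax x)
          hp0.le).trans (ENNReal.rpow_add_le_mul_rpow_add_rpow _ _ (by linarith))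
    _ = 2 ^ (p - 1) * (∫⁻ x, lowMax a f x ^ p ∂μT n + ∫⁻ x, highMax K a f x ^ p ∂μT n) := by
        rw [lintegral_const_mul' _ _ (ENNReal.rpow_ne_top_of_nonneg (by linarith) (by simp)),
          lintegral_add_left (measurable_lowMax.pow_const p)]
    _ ≤ _ := by
        rw [mul_assoc, add_mul, mul_assoc]
        refine mul_le_mul' le_rfl (add_le_add ?_ ?_)
        · exact (lintegral_lowMax_rpow_le hp0).trans (mul_le_mul' le_rfl (h1 K a h f hf))
        · refine lintegral_interpolation (fun f => highMax K a f) A b hb0 hbt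
            (fun f _ => measurable_highMax) ?_ (fun f hf t => h.highMax_weak_le hf t)
            (fun f hf B _ hB x => h.highMax_le_of_bound hL hf hB x) hp hf
          intro f g x hf hg
          refine iSup_le fun k => (dosc_mult_add_le (h.support_sum_finite _) hf hg k _).trans
            (add_le_add ?_ ?_)
          · exact le_iSup (fun k => dosc k (dyad k x) (mult (tailSym K a k) f)) k
          · exact le_iSup (fun k => dosc k (dyad k x) (mult (tailSym K a k) g)) k

end SymFam

lemma lintegral_rpow_le_lintegral_rpow {q p : ℝ} (hq : 0 < q) (hqp : q ≤ p)
    {F : (Fin n → ℝ) → ℝ≥0∞} (hF : Measurable F) :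
    (∫⁻ x, F x ^ q ∂μT n) ^ (1 / q) ≤ (∫⁻ x, F x ^ p ∂μT n) ^ (1 / p) := by
  have := eLpNorm'_le_eLpNorm'_of_exponent_le (μ := μT n) (f := F) hq hqp hF.aestronglyMeasurable
  simpa [eLpNorm'] using this

/-- The `L^p` estimate for `p > 2`. -/
theorem SymFam.exists_lintegral_mult_rpow_le {n : ℕ} (hn : 1 ≤ n) {ρ m L p : ℝ} (hρ0 : 0 ≤ ρ)
    (hρ : ρ ≤ 1) (hL : 0 < L) (hp : 2 < p) (hm : p * m = (p - 2) * (n * (1 - ρ) / 2)) :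
    ∃ C : ℝ≥0∞, C ≠ ∞ ∧ ∀ K a, SymFam n ρ m L K a → ∀ f, Bdd f →
      ∫⁻ x, ‖mult (∑ j ∈ Finset.range K, a j) f x‖ₑ ^ p ∂μT n ≤
        C * ∫⁻ x, ‖f x‖ₑ ^ p ∂μT n := by
  have hp0 : 0 < p := by linarith
  have hm0 : 0 ≤ m := by
    have h1 : 0 ≤ p * m := by
      rw [hm]
      have : 0 ≤ 1 - ρ := by linarith
      have : 0 ≤ p - 2 := by linarith
      positivity
    exact nonneg_of_mul_nonneg_right h1 hp0
  obtain ⟨C₀, hC₀, h0⟩ := lintegral_dmax_rpow_le n hp0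
  obtain ⟨C₁, hC₁, h1⟩ : ∃ C : ℝ≥0∞, C ≠ ∞ ∧ ∀ K a, SymFam n ρ m L K a → ∀ f, Bdd f →
      ∫⁻ x, dsharp (mult (∑ j ∈ Finset.range K, a j) f) x ^ p ∂μT n ≤
        C * ∫⁻ x, ‖f x‖ₑ ^ p ∂μT n := by
    rcases hρ.lt_or_eq with hlt | rfl
    · exact SymFam.exists_dsharp_rpow_le_of_lt hn hL hp hlt hm
    · obtain rfl : m = 0 := by
        have : p * m = 0 := by rw [hm]; ring
        exact (mul_eq_zero.1 this).resolve_left hp0.ne'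
      exact SymFam.exists_dsharp_rpow_le_of_eq n hL hp
  refine ⟨C₀ * (ENNReal.ofReal L ^ p + C₁), ENNReal.mul_ne_top hC₀ (ENNReal.add_ne_top.2
    ⟨ENNReal.rpow_ne_top_of_nonneg hp0.le (by simp), hC₁⟩), fun K a h f hf => ?_⟩
  have hfin := h.support_sum_finite (Finset.range K)
  set T := mult (∑ j ∈ Finset.range K, a j) f with hT
  have hTc : Continuous T := continuous_mult hfin f
  have hmean : (∫⁻ x, ‖T x‖ₑ ∂μT n) ^ p ≤ ENNReal.ofReal L ^ p * ∫⁻ x, ‖f x‖ₑ ^ p ∂μT n := by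
    have e1 := lintegral_rpow_le_lintegral_rpow (n := n) one_pos one_le_two hTc.measurable.enorm
    have e2 := lintegral_mult_sq_le hfin hf (h.enorm_sum_le hm0 (Finset.range K))
    have e3 := lintegral_rpow_le_lintegral_rpow (n := n) two_pos hp.le hf.meas.enorm
    simp only [ENNReal.rpow_one, div_one, ENNReal.rpow_ofNat] at e1 e3
    have e4 : ∫⁻ x, ‖T x‖ₑ ∂μT n ≤
        ENNReal.ofReal L * (∫⁻ x, ‖f x‖ₑ ^ p ∂μT n) ^ (1 / p) := by
      refine e1.trans ((ENNReal.rpow_le_rpow e2 (by norm_num)).trans ?_)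
      rw [ENNReal.mul_rpow_of_nonneg _ _ (by norm_num), ← ENNReal.rpow_ofNat,
        ← ENNReal.rpow_mul]
      norm_num
      exact mul_le_mul' le_rfl (by simpa using e3)
    refine (ENNReal.rpow_le_rpow e4 hp0.le).trans (le_of_eq ?_)
    rw [ENNReal.mul_rpow_of_nonneg _ _ hp0.le, ← ENNReal.rpow_mul, one_div,
      inv_mul_cancel₀ hp0.ne', ENNReal.rpow_one]
  calc ∫⁻ x, ‖T x‖ₑ ^ p ∂μT n ≤ ∫⁻ x, dmax (fun y => ‖T y‖ₑ) x ^ p ∂μT n :=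
        lintegral_mono fun x => ENNReal.rpow_le_rpow
          (enorm_le_dmax hTc (zPer_mult _ f) x) hp0.le
    _ ≤ C₀ * ((∫⁻ x, ‖T x‖ₑ ∂μT n) ^ p + ∫⁻ x, dsharp T x ^ p ∂μT n) := h0 T (bdd_mult hfin f)
    _ ≤ _ := by
        rw [mul_assoc, add_mul]
        exact mul_le_mul' le_rfl (add_le_add hmean (h1 K a h f hf))

end

section lines

variable {n : ℕ}

lemma flatMap_replicate_single (l : Fin n) (i : ℕ) (s : List (Fin n)) (hs : s.Nodup) :
    (s.flatMap fun j => List.replicate ((Pi.single l i : Fin n → ℕ) j) j) =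
      if l ∈ s then List.replicate i l else [] := by
  induction s with
  | nil => simp
  | cons b s ih =>
    rw [List.nodup_cons] at hs
    rw [List.flatMap_cons, ih hs.2]
    by_cases hb : l = b
    · subst hb
      simp [hs.1]
    · simp [hb]

lemma mIdxList_single (l : Fin n) (i : ℕ) : mIdxList (Pi.single l i) = List.replicate i l := by
  rw [mIdxList, flatMap_replicate_single l i _ (List.nodup_finRange n)]
  simp

lemma pdM_single (l : Fin n) (i : ℕ) (G : (Fin n → ℝ) → ℂ) :
    pdM (Pi.single l i) G = (pd l)^[i] G := by
  rw [pdM, mIdxList_single]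
  induction i with
  | zero => rfl
  | succ i ih => rw [List.replicate_succ, List.foldr_cons, ih, Function.iterate_succ_apply']

lemma contDiff_pd_iterate (l : Fin n) {G : (Fin n → ℝ) → ℂ} (hG : ContDiff ℝ (⊤ : ℕ∞) G) (i : ℕ) :
    ContDiff ℝ (⊤ : ℕ∞) ((pd l)^[i] G) := by
  induction i with
  | zero => exact hG
  | succ i ih =>
    rw [Function.iterate_succ_apply']
    exact (ih.fderiv_right (m := (⊤ : ℕ∞)) (by simp)).clm_apply contDiff_const

/-- Iterated derivatives along a coordinate line are pure partial derivatives. -/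
lemma iteratedDeriv_update {G : (Fin n → ℝ) → ℂ} (hG : ContDiff ℝ (⊤ : ℕ∞) G) (x : Fin n → ℝ)
    (l : Fin n) (i : ℕ) :
    iteratedDeriv i (fun s => G (Function.update x l s)) =
      fun s => (pd l)^[i] G (Function.update x l s) := by
  induction i with
  | zero => simp
  | succ i ih =>
    rw [iteratedDeriv_succ, ih]
    ext s
    rw [Function.iterate_succ_apply']
    have h1 : DifferentiableAt ℝ ((pd l)^[i] G) (Function.update x l s) :=
      ((contDiff_pd_iterate l hG i).differentiable (by simp)) _
    exact (h1.hasFDerivAt.comp_hasDerivAt s (hasDerivAt_update x l s)).deriv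

/-- Differences are bounded by derivatives. -/
lemma norm_fwdDiff_iterate_le (N : ℕ) {φ : ℝ → ℂ} (hφ : ContDiff ℝ (⊤ : ℕ∞) φ) {M : ℝ}
    (hM : ∀ t, ‖iteratedDeriv N φ t‖ ≤ M) (t : ℝ) : ‖(fwdDiff (1 : ℝ))^[N] φ t‖ ≤ M := by
  induction N generalizing φ with
  | zero => simpa using hM t
  | succ N ih =>
    rw [Function.iterate_succ_apply]
    have hφ1 : ContDiff ℝ (⊤ : ℕ∞) fun t => φ (t + 1) := hφ.comp (contDiff_id.add contDiff_const)
    have hle : ((N : ℕ) : WithTop ℕ∞) ≤ ((⊤ : ℕ∞) : WithTop ℕ∞) := by exact_mod_cast le_top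
    refine ih (hφ1.sub hφ) fun s => ?_
    have e1 : iteratedDeriv N (fwdDiff (1 : ℝ) φ) s =
        iteratedDeriv N φ (s + 1) - iteratedDeriv N φ s := by
      change iteratedDeriv N (fun t => φ (t + 1) - φ t) s = _
      rw [iteratedDeriv_fun_sub ((hφ1.of_le hle).contDiffAt) ((hφ.of_le hle).contDiffAt),
        iteratedDeriv_comp_add_const]
    change ‖iteratedDeriv N (fwdDiff (1 : ℝ) φ) s‖ ≤ M
    rw [e1]
    have hd : Differentiable ℝ (iteratedDeriv N φ) :=
      hφ.differentiable_iteratedDeriv N (by exact_mod_cast WithTop.coe_lt_top N)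
    have := Convex.norm_image_sub_le_of_norm_deriv_le (s := Set.univ) (C := M) (x := s) (y := s + 1)
      (fun t _ => hd t) (fun t _ => by rw [← iteratedDeriv_succ]; exact hM t) convex_univ
      trivial trivial
    simpa using this

lemma dd_iterate_eq_fwdDiff (l : Fin n) (a : (Fin n → ℤ) → ℂ) (φ : ℝ → ℂ) (ξ : Fin n → ℤ) (t : ℝ)
    (h : ∀ k : ℕ, a (ξ + Pi.single l (k : ℤ)) = φ (t + k)) (N k : ℕ) :
    (dd l)^[N] a (ξ + Pi.single l (k : ℤ)) = (fwdDiff (1 : ℝ))^[N] φ (t + k) := by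
  induction N generalizing k with
  | zero => exact h k
  | succ N ih =>
    rw [Function.iterate_succ_apply', Function.iterate_succ_apply', dd, fwdDiff, ← ih k,
      add_assoc t, ← Nat.cast_add_one, ← ih (k + 1), add_assoc, ← Pi.single_add]
    push_cast; rfl

lemma castZ_add_single (ξ : Fin n → ℤ) (l : Fin n) (k : ℕ) :
    castZ (ξ + Pi.single l (k : ℤ)) = Function.update (castZ ξ) l ((ξ l : ℝ) + k) := by
  ext j
  by_cases h : j = l
  · subst h; simp [castZ]
  · simp [castZ, h]

lemma norm_dd_iterate_le (l : Fin n) {G : (Fin n → ℝ) → ℂ} (hG : ContDiff ℝ (⊤ : ℕ∞) G) (N : ℕ)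
    {M : ℝ} (ξ : Fin n → ℤ)
    (hM : ∀ t, ‖iteratedDeriv N (fun s => G (Function.update (castZ ξ) l s)) t‖ ≤ M) :
    ‖(dd l)^[N] (fun ξ => G (castZ ξ)) ξ‖ ≤ M := by
  have h := dd_iterate_eq_fwdDiff l (fun ξ => G (castZ ξ))
    (fun s => G (Function.update (castZ ξ) l s)) ξ (ξ l) (fun k => by rw [castZ_add_single]) N 0
  simp only [Nat.cast_zero, Pi.single_zero, add_zero] at h
  rw [h]
  exact norm_fwdDiff_iterate_le N (hG.comp (contDiff_update _ _ l)) hM _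

lemma abs_le_jbR (x : Fin n → ℝ) (l : Fin n) : |x l| ≤ jbR x := by
  rw [jbR, ← Real.sqrt_sq_eq_abs]
  refine Real.sqrt_le_sqrt ?_
  have := Finset.single_le_sum (f := fun j => x j ^ 2) (fun j _ => sq_nonneg _) (Finset.mem_univ l)
  linarith

lemma one_le_jbR (x : Fin n → ℝ) : 1 ≤ jbR x := by
  rw [jbR, Real.one_le_sqrt]
  have : 0 ≤ ∑ j, x j ^ 2 := Finset.sum_nonneg fun j _ => sq_nonneg _
  linarith

end lines

section cutoff

variable {n : ℕ}

/-- A smooth cut-off function of one variable. -/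
def bump : ContDiffBump (0 : ℝ) := ⟨1, 2, one_pos, one_lt_two⟩

/-- The cut-off function `bump`, with complex values. -/
def chi1 (t : ℝ) : ℂ := (bump t : ℂ)

lemma contDiff_chi1 : ContDiff ℝ (⊤ : ℕ∞) chi1 :=
  Complex.ofRealCLM.contDiff.comp bump.contDiff

lemma norm_chi1_le (t : ℝ) : ‖chi1 t‖ ≤ 1 := by
  rw [chi1, Complex.norm_real, Real.norm_of_nonneg bump.nonneg]
  exact bump.le_one

lemma chi1_eq_one {t : ℝ} (h : |t| ≤ 1) : chi1 t = 1 := by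
  rw [chi1, bump.one_of_mem_closedBall (by simpa [bump] using h)]; simp

lemma chi1_eq_zero {t : ℝ} (h : 2 ≤ |t|) : chi1 t = 0 := by
  rw [chi1, bump.zero_of_le_dist (by simpa [bump] using h)]; simp

lemma exists_norm_iteratedDeriv_chi1_le (N : ℕ) :
    ∃ M : ℝ, 1 ≤ M ∧ ∀ i ≤ N, ∀ t, ‖iteratedDeriv i chi1 t‖ ≤ M := by
  have hsupp : HasCompactSupport chi1 :=
    bump.hasCompactSupport.comp_left (g := fun t : ℝ => (t : ℂ)) (by simp)
  have h : ∀ i : ℕ, ∃ M : ℝ, ∀ t, ‖iteratedDeriv i chi1 t‖ ≤ M := by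
    intro i
    obtain ⟨M, hM⟩ := (contDiff_chi1.continuous_iteratedFDeriv (m := i)
      (by exact_mod_cast le_top)).bounded_above_of_compact_support (hsupp.iteratedFDeriv i)
    exact ⟨M, fun t => by rw [← norm_iteratedFDeriv_eq_norm_iteratedDeriv]; exact hM t⟩
  choose M hM using h
  refine ⟨1 + ∑ i ∈ Finset.range (N + 1), |M i|, ?_, fun i hi t => ?_⟩
  · have : 0 ≤ ∑ i ∈ Finset.range (N + 1), |M i| := Finset.sum_nonneg fun i _ => abs_nonneg _
    linarith
  · have := Finset.single_le_sum (f := fun i => |M i|) (fun j _ => abs_nonneg _)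
      (Finset.mem_range.2 (Nat.lt_succ_of_le hi))
    linarith [hM i t, le_abs_self (M i)]

/-- The cut-off function to the cube of size `2 ^ J`. -/
def chi (J : ℕ) (x : Fin n → ℝ) : ℂ := ∏ l, chi1 ((2 ^ J)⁻¹ * x l)

lemma contDiff_chi (J : ℕ) : ContDiff ℝ (⊤ : ℕ∞) (chi J : (Fin n → ℝ) → ℂ) :=
  contDiff_prod fun l _ => contDiff_chi1.comp (contDiff_const.mul (contDiff_apply ℝ ℝ l))

lemma norm_chi_le (J : ℕ) (x : Fin n → ℝ) : ‖chi J x‖ ≤ 1 := by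
  rw [chi, norm_prod]
  exact Finset.prod_le_one (fun _ _ => norm_nonneg _) fun _ _ => norm_chi1_le _

lemma chi_eq_one {J : ℕ} {x : Fin n → ℝ} (h : ∀ l, |x l| ≤ 2 ^ J) : chi J x = 1 := by
  refine Finset.prod_eq_one fun l _ => chi1_eq_one ?_
  rw [abs_mul, abs_of_pos (by positivity), inv_mul_le_iff₀ (by positivity), mul_one]
  exact h l

lemma chi_eq_zero {J : ℕ} {x : Fin n → ℝ} {l : Fin n} (h : 2 ^ (J + 1) ≤ |x l|) :
    chi J x = 0 := by
  refine Finset.prod_eq_zero (Finset.mem_univ l) (chi1_eq_zero ?_)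
  rw [abs_mul, abs_of_pos (by positivity), le_inv_mul_iff₀ (by positivity), ← pow_succ]
  exact h

lemma chi_update (J : ℕ) (x : Fin n → ℝ) (l : Fin n) (s : ℝ) :
    chi J (Function.update x l s) =
      (∏ j ∈ Finset.univ.erase l, chi1 ((2 ^ J)⁻¹ * x j)) * chi1 ((2 ^ J)⁻¹ * s) := by
  rw [chi, ← Finset.prod_erase_mul _ _ (Finset.mem_univ l), Function.update_self]
  congr 1
  refine Finset.prod_congr rfl fun j hj => ?_
  rw [Function.update_of_ne (Finset.ne_of_mem_erase hj)]

lemma norm_iteratedDeriv_chi_le {M : ℝ} {N : ℕ}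
    (hM : ∀ i ≤ N, ∀ t, ‖iteratedDeriv i chi1 t‖ ≤ M) (J : ℕ) (x : Fin n → ℝ) (l : Fin n) {i : ℕ}
    (hi : i ≤ N) (t : ℝ) :
    ‖iteratedDeriv i (fun s => chi J (Function.update x l s)) t‖ ≤ M * ((2 ^ J)⁻¹) ^ i := by
  simp only [chi_update]
  have hle : ((i : ℕ) : WithTop ℕ∞) ≤ ((⊤ : ℕ∞) : WithTop ℕ∞) := by exact_mod_cast le_top
  have hc : ContDiff ℝ i fun s : ℝ => chi1 ((2 ^ J)⁻¹ * s) :=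
    (contDiff_chi1.of_le hle).comp (contDiff_const.mul contDiff_id)
  rw [iteratedDeriv_const_mul _ hc.contDiffAt,
    iteratedDeriv_comp_const_smul (contDiff_chi1.of_le hle), norm_mul, norm_smul]
  have h1 : ‖∏ j ∈ Finset.univ.erase l, chi1 ((2 ^ J)⁻¹ * x j)‖ ≤ 1 := by
    rw [norm_prod]
    exact Finset.prod_le_one (fun _ _ => norm_nonneg _) fun _ _ => norm_chi1_le _
  rw [norm_pow, Real.norm_of_nonneg (by positivity)]
  calc _ ≤ 1 * (((2 ^ J)⁻¹) ^ i * M) := by gcongr; exact hM i hi _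
    _ = _ := by ring

/-- The Littlewood-Paley decomposition. -/
def lpPiece : ℕ → (Fin n → ℝ) → ℂ
  | 0 => chi 0
  | J + 1 => fun x => chi (J + 1) x - chi J x

lemma contDiff_lpPiece (j : ℕ) : ContDiff ℝ (⊤ : ℕ∞) (lpPiece j : (Fin n → ℝ) → ℂ) := by
  cases j with
  | zero => exact contDiff_chi 0
  | succ J => exact (contDiff_chi (J + 1)).sub (contDiff_chi J)

lemma sum_lpPiece (K : ℕ) (x : Fin n → ℝ) :
    ∑ j ∈ Finset.range (K + 1), lpPiece j x = chi K x := by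
  induction K with
  | zero => simp [lpPiece]
  | succ K ih => rw [Finset.sum_range_succ, ih, lpPiece]; ring

lemma lpPiece_eq_zero_of_le {j : ℕ} {x : Fin n → ℝ} {l : Fin n} (h : 2 ^ (j + 1) ≤ |x l|) :
    lpPiece j x = 0 := by
  cases j with
  | zero => exact chi_eq_zero h
  | succ J =>
    have : (2 : ℝ) ^ (J + 1) ≤ |x l| := le_trans (by gcongr <;> norm_num) h
    simp only [lpPiece]
    rw [chi_eq_zero h, chi_eq_zero this, sub_zero]

lemma lpPiece_eq_zero_of_lt {j : ℕ} {x : Fin n → ℝ} (h : ∀ l, |x l| ≤ 2 ^ j) :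
    lpPiece (j + 1) x = 0 := by
  simp only [lpPiece]
  rw [chi_eq_one h, chi_eq_one fun l => (h l).trans (by gcongr <;> norm_num), sub_self]

lemma norm_iteratedDeriv_lpPiece_le {M : ℝ} {N : ℕ} (hM0 : 0 ≤ M)
    (hM : ∀ i ≤ N, ∀ t, ‖iteratedDeriv i chi1 t‖ ≤ M) (j : ℕ) (x : Fin n → ℝ) (l : Fin n) {i : ℕ}
    (hi : i ≤ N) (t : ℝ) :
    ‖iteratedDeriv i (fun s => lpPiece j (Function.update x l s)) t‖ ≤
      2 * M * 2 ^ N * ((2 ^ j)⁻¹) ^ i := by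
  have h2 : (1 : ℝ) ≤ 2 ^ N := one_le_pow₀ (by norm_num)
  cases j with
  | zero =>
    refine (norm_iteratedDeriv_chi_le hM 0 x l hi t).trans ?_
    refine mul_le_mul_of_nonneg_right ?_ (by positivity)
    nlinarith
  | succ J =>
    have hle : ((i : ℕ) : WithTop ℕ∞) ≤ ((⊤ : ℕ∞) : WithTop ℕ∞) := by exact_mod_cast le_top
    have hc : ∀ J, ContDiffAt ℝ i (fun s => chi J (Function.update x l s)) t := fun J =>
      (((contDiff_chi J).comp (contDiff_update _ x l)).of_le hle).contDiffAt
    simp only [lpPiece]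
    rw [iteratedDeriv_fun_sub (hc _) (hc _)]
    refine (norm_sub_le _ _).trans ((add_le_add (norm_iteratedDeriv_chi_le hM (J + 1) x l hi t)
      (norm_iteratedDeriv_chi_le hM J x l hi t)).trans ?_)
    have h3 : ((2 ^ J : ℝ)⁻¹) ^ i = 2 ^ i * ((2 ^ (J + 1))⁻¹) ^ i := by
      rw [← mul_pow, pow_succ]; congr 1; field_simp
    have h4 : (2 : ℝ) ^ i ≤ 2 ^ N := pow_le_pow_right₀ (by norm_num) hi
    rw [h3]
    have h5 : (0 : ℝ) ≤ ((2 ^ (J + 1))⁻¹) ^ i := by positivity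
    nlinarith [mul_nonneg hM0 h5]

end cutoff

section pieces

variable {n : ℕ}

lemma norm_iteratedDeriv_piece_le {σ : (Fin n → ℝ) → ℂ} (hσ : ContDiff ℝ (⊤ : ℕ∞) σ)
    {C m ρ M : ℝ} (hC : 0 ≤ C) (hm : 0 ≤ m) (hρ0 : 0 ≤ ρ) (hρ : ρ ≤ 1) {N : ℕ}
    (hbd : ∀ l, ∀ i ≤ N, ∀ x, ‖(pd l)^[i] σ x‖ ≤ C * jbR x ^ (-m - ρ * i))
    (hM0 : 0 ≤ M) (hM : ∀ i ≤ N, ∀ t, ‖iteratedDeriv i chi1 t‖ ≤ M)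
    (j : ℕ) (x : Fin n → ℝ) (l : Fin n) {i : ℕ} (hi : i ≤ N) (t : ℝ) :
    ‖iteratedDeriv i (fun s => σ (Function.update x l s) * lpPiece j (Function.update x l s)) t‖ ≤
      2 ^ N * (C * 2 ^ (m + N) * (2 * M * 2 ^ N)) * 2 ^ (-(j * (m + ρ * i))) := by
  set y := Function.update x l t with hy
  by_cases hcase : (2 : ℝ) ^ j ≤ 2 * jbR y
  · have hle : ((i : ℕ) : WithTop ℕ∞) ≤ ((⊤ : ℕ∞) : WithTop ℕ∞) := by exact_mod_cast le_top
    have c1 : ContDiffAt ℝ i (fun s => σ (Function.update x l s)) t :=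
      ((hσ.comp (contDiff_update _ x l)).of_le hle).contDiffAt
    have c2 : ContDiffAt ℝ i (fun s => lpPiece j (Function.update x l s)) t :=
      (((contDiff_lpPiece j).comp (contDiff_update _ x l)).of_le hle).contDiffAt
    rw [iteratedDeriv_fun_mul c1 c2]
    have hj1 := one_le_jbR y
    have hterm : ∀ k ∈ Finset.range (i + 1),
        ‖((i.choose k : ℕ) : ℂ) * iteratedDeriv k (fun s => σ (Function.update x l s)) t *
          iteratedDeriv (i - k) (fun s => lpPiece j (Function.update x l s)) t‖ ≤
        (i.choose k) * ((C * 2 ^ (m + N) * (2 * M * 2 ^ N)) * 2 ^ (-(j * (m + ρ * i)))) := by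
      intro k hk
      have hki : k ≤ i := Nat.lt_succ_iff.1 (Finset.mem_range.1 hk)
      have hkN : (k : ℝ) ≤ N := by exact_mod_cast hki.trans hi
      have hρk : ρ * k ≤ k := mul_le_of_le_one_left (by positivity) hρ
      have hρk0 : 0 ≤ ρ * k := by positivity
      have b1 : ‖iteratedDeriv k (fun s => σ (Function.update x l s)) t‖ ≤
          C * 2 ^ (m + N) * 2 ^ (-(j * (m + ρ * k))) := by
        rw [iteratedDeriv_update hσ]
        refine (hbd l k (hki.trans hi) _).trans ?_
        rw [mul_assoc]
        refine mul_le_mul_of_nonneg_left ?_ hC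
        have e1 : (2 : ℝ) ^ ((j : ℝ) - 1) ≤ jbR y := by
          rw [Real.rpow_sub_one (by norm_num), Real.rpow_natCast]
          linarith
        calc jbR y ^ (-m - ρ * k) ≤ ((2 : ℝ) ^ ((j : ℝ) - 1)) ^ (-m - ρ * k) :=
              Real.rpow_le_rpow_of_nonpos (by positivity) e1 (by linarith)
          _ = 2 ^ (m + ρ * k) * 2 ^ (-(j * (m + ρ * k))) := by
              rw [← Real.rpow_mul (by norm_num), ← Real.rpow_add two_pos]
              congr 1; ring
          _ ≤ _ := by gcongr <;> linarith
      have b2 := norm_iteratedDeriv_lpPiece_le hM0 hM j x l ((Nat.sub_le i k).trans hi) t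
      have b3 : ((2 ^ j : ℝ)⁻¹) ^ (i - k) = 2 ^ (-(j * ((i : ℝ) - k))) := by
        rw [Real.rpow_neg (by norm_num), Real.rpow_mul (by norm_num), Real.rpow_natCast,
          ← Nat.cast_sub hki, Real.rpow_natCast, inv_pow]
      rw [b3] at b2
      have b4 : (2 : ℝ) ^ (-(j * (m + ρ * k))) * 2 ^ (-(j * ((i : ℝ) - k))) ≤
          2 ^ (-(j * (m + ρ * i))) := by
        rw [← Real.rpow_add two_pos]
        refine Real.rpow_le_rpow_of_exponent_le (by norm_num) ?_
        have hik : (k : ℝ) ≤ i := by exact_mod_cast hki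
        have : ρ * (i - k) ≤ (i : ℝ) - k := mul_le_of_le_one_left (by linarith) hρ
        have h6 : (j : ℝ) * (ρ * (i - k)) ≤ j * ((i : ℝ) - k) :=
          mul_le_mul_of_nonneg_left this (by positivity)
        linarith
      rw [norm_mul, norm_mul, Complex.norm_natCast, mul_assoc]
      refine mul_le_mul_of_nonneg_left ?_ (by positivity)
      calc _ ≤ (C * 2 ^ (m + N) * 2 ^ (-(j * (m + ρ * k)))) *
            (2 * M * 2 ^ N * 2 ^ (-(j * ((i : ℝ) - k)))) :=
            mul_le_mul b1 b2 (norm_nonneg _) (by positivity)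
        _ = (C * 2 ^ (m + N) * (2 * M * 2 ^ N)) *
            (2 ^ (-(j * (m + ρ * k))) * 2 ^ (-(j * ((i : ℝ) - k)))) := by ring
        _ ≤ _ := mul_le_mul_of_nonneg_left b4 (by positivity)
    refine (norm_sum_le_of_le _ hterm).trans ?_
    rw [← Finset.sum_mul, ← Nat.cast_sum, Nat.sum_range_choose, mul_assoc (2 ^ N : ℝ)]
    push_cast
    exact mul_le_mul_of_nonneg_right (pow_le_pow_right₀ (by norm_num) hi) (by positivity)
  · push Not at hcase
    have hz : (fun s => σ (Function.update x l s) * lpPiece j (Function.update x l s)) =ᶠ[nhds t]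
        fun _ => 0 := by
      cases j with
      | zero =>
        have := one_le_jbR y
        rw [pow_zero] at hcase; linarith
      | succ J =>
        have hopen : IsOpen {s : ℝ | ∀ l', |Function.update x l s l'| < 2 ^ J} := by
          rw [Set.ofPred_forall]
          refine isOpen_iInter_of_finite fun l' => isOpen_lt ?_ continuous_const
          exact (((continuous_apply l').comp (contDiff_update (𝕜 := ℝ) 0 x l).continuous)).abs
        filter_upwards [hopen.mem_nhds (show ∀ l', |Function.update x l t l'| < 2 ^ J from
          fun l' => by
            have := abs_le_jbR y l'
            rw [pow_succ] at hcase
            rw [← hy]; linarith)] with s hs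
        rw [lpPiece_eq_zero_of_lt fun l' => (hs l').le, mul_zero]
    rw [hz.iteratedDeriv_eq]
    have : iteratedDeriv i (fun _ : ℝ => (0 : ℂ)) t = 0 := by
      simp
    rw [this, norm_zero]
    positivity

lemma dd_iterate_eq_zero (l : Fin n) {a : (Fin n → ℤ) → ℂ} {R : ℕ}
    (h : ∀ ξ l', (R : ℤ) < |ξ l'| → a ξ = 0) (N : ℕ) (ξ : Fin n → ℤ) (l' : Fin n)
    (hξ : ((R + N : ℕ) : ℤ) < |ξ l'|) : (dd l)^[N] a ξ = 0 := by
  induction N generalizing ξ with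
  | zero => exact h ξ l' (by simpa using hξ)
  | succ N ih =>
    rw [Function.iterate_succ_apply', dd, ih ξ (by push_cast at hξ ⊢; omega), ih, sub_zero]
    have h1 : |(Pi.single l (1 : ℤ) : Fin n → ℤ) l'| ≤ 1 := by
      by_cases hl : l' = l
      · subst hl; simp
      · simp [hl]
    have h2 := abs_sub_abs_le_abs_sub (ξ l') (-(Pi.single l (1 : ℤ) : Fin n → ℤ) l')
    rw [abs_neg, sub_neg_eq_add] at h2
    rw [Pi.add_apply]
    push_cast at hξ ⊢
    omega

lemma tsum_enorm_sq_le {b : (Fin n → ℤ) → ℂ} {R : ℕ} {W : ℝ} (hb : ∀ ξ, ‖b ξ‖ ≤ W)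
    (hs : ∀ ξ l, (R : ℤ) < |ξ l| → b ξ = 0) :
    ∑' ξ, ‖b ξ‖ₑ ^ 2 ≤ ENNReal.ofReal ((2 * R + 1) ^ n * W ^ 2) := by
  set S : Finset (Fin n → ℤ) := Fintype.piFinset fun _ => Finset.Icc (-(R : ℤ)) R
  rw [tsum_eq_sum (s := S)]
  · have h1 : ∀ ξ ∈ S, ‖b ξ‖ₑ ^ 2 ≤ ENNReal.ofReal (W ^ 2) := fun ξ _ => by
      rw [← ofReal_norm, ← ENNReal.ofReal_pow (norm_nonneg _)]
      exact ENNReal.ofReal_le_ofReal (pow_le_pow_left₀ (norm_nonneg _) (hb ξ) 2)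
    refine (Finset.sum_le_card_nsmul _ _ _ h1).trans (le_of_eq ?_)
    have hcard : S.card = (2 * R + 1) ^ n := by
      simp only [S, Fintype.card_piFinset, Int.card_Icc, Finset.prod_const, Finset.card_univ,
        Fintype.card_fin]
      congr 1; omega
    rw [hcard, nsmul_eq_mul, ENNReal.ofReal_mul (by positivity), ← ENNReal.ofReal_natCast]
    push_cast; rfl
  · intro ξ hξ
    simp only [S, Fintype.mem_piFinset, not_forall, Finset.mem_Icc, ← abs_le, not_le] at hξ
    obtain ⟨l, hl⟩ := hξ
    simp [hs ξ l hl]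

lemma tsum_enorm_sq_le_of_decay {b : (Fin n → ℤ) → ℂ} {R j : ℕ} {A c e : ℝ} (hA : 0 ≤ A)
    (hc : 1 ≤ c) (hR : 2 * R + 1 ≤ c * 2 ^ j) (hb : ∀ ξ, ‖b ξ‖ ≤ A * 2 ^ (-(j * e)))
    (hs : ∀ ξ l, (R : ℤ) < |ξ l| → b ξ = 0) {L : ℝ} (hL : c ^ n * A ≤ L) :
    ∑' ξ, ‖b ξ‖ₑ ^ 2 ≤ ENNReal.ofReal (L * 2 ^ (j * ((n : ℝ) / 2 - e))) ^ 2 := by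
  refine (tsum_enorm_sq_le hb hs).trans ?_
  have hL0 : 0 ≤ L := le_trans (by positivity) hL
  rw [← ENNReal.ofReal_pow (by positivity)]
  refine ENNReal.ofReal_le_ofReal ?_
  have hcn : 1 ≤ c ^ n := one_le_pow₀ hc
  have e1 : ((2 : ℝ) ^ (j * ((n : ℝ) / 2 - e))) ^ 2 = (2 ^ j) ^ n * (2 ^ (-(j * e))) ^ 2 := by
    simp only [← Real.rpow_natCast, ← Real.rpow_mul (zero_le_two : (0 : ℝ) ≤ 2)]
    rw [← Real.rpow_add two_pos]
    congr 1; push_cast; ring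
  calc (2 * R + 1 : ℝ) ^ n * (A * 2 ^ (-(j * e))) ^ 2
      ≤ (c * 2 ^ j) ^ n * (A * 2 ^ (-(j * e))) ^ 2 := by gcongr
    _ = c ^ n * A ^ 2 * ((2 ^ j) ^ n * (2 ^ (-(j * e))) ^ 2) := by rw [mul_pow, mul_pow]; ring
    _ ≤ (c ^ n * A) ^ 2 * ((2 ^ j) ^ n * (2 ^ (-(j * e))) ^ 2) := by
        refine mul_le_mul_of_nonneg_right ?_ (by positivity)
        nlinarith [mul_nonneg (sub_nonneg.2 hcn) (by positivity : 0 ≤ c ^ n * A ^ 2)]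
    _ ≤ L ^ 2 * ((2 ^ j) ^ n * (2 ^ (-(j * e))) ^ 2) := by gcongr
    _ = _ := by rw [← e1, mul_pow]

/-- The dyadic pieces of a symbol. -/
def symPiece (σ : (Fin n → ℝ) → ℂ) (K j : ℕ) : (Fin n → ℤ) → ℂ :=
  if j < K then fun ξ => σ (castZ ξ) * lpPiece j (castZ ξ) else 0

lemma sum_symPiece (σ : (Fin n → ℝ) → ℂ) (K : ℕ) (ξ : Fin n → ℤ) :
    (∑ j ∈ Finset.range (K + 1), symPiece σ (K + 1) j) ξ = σ (castZ ξ) * chi K (castZ ξ) := by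
  rw [Finset.sum_apply, ← sum_lpPiece, Finset.mul_sum]
  refine Finset.sum_congr rfl fun j hj => ?_
  rw [symPiece, if_pos (Finset.mem_range.1 hj)]

lemma symPiece_eq_zero_of_lt {σ : (Fin n → ℝ) → ℂ} {K j : ℕ} {ξ : Fin n → ℤ} {l : Fin n}
    (h : ((2 ^ (j + 1) : ℕ) : ℤ) < |ξ l|) : symPiece σ K j ξ = 0 := by
  rw [symPiece]
  split_ifs
  · have h1 : (2 : ℝ) ^ (j + 1) ≤ |castZ ξ l| := by
      rw [castZ, ← Int.cast_abs]
      exact_mod_cast h.le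
    change _ * lpPiece j (castZ ξ) = 0
    rw [lpPiece_eq_zero_of_le h1, mul_zero]
  · rfl

lemma tsum_overlap_le {σ : (Fin n → ℝ) → ℂ} {K : ℕ} {ξ : Fin n → ℤ} {F : ℕ → ℝ≥0∞} {B : ℝ≥0∞}
    (hF : ∀ j, F j ≤ B) (h0 : ∀ j, symPiece σ K j ξ = 0 → F j = 0) : ∑' j, F j ≤ 3 * B := by
  by_cases hall : ∀ j, symPiece σ K j ξ = 0
  · simp [fun j => h0 j (hall j)]
  push Not at hall
  classical
  set j₀ := Nat.find hall
  have hj₀ : symPiece σ K j₀ ξ ≠ 0 := Nat.find_spec hall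
  have hup : ∀ l, |ξ l| ≤ ((2 ^ (j₀ + 1) : ℕ) : ℤ) := fun l => by
    by_contra hcon
    exact hj₀ (symPiece_eq_zero_of_lt (not_le.1 hcon))
  rw [tsum_eq_sum (s := Finset.Icc j₀ (j₀ + 2))]
  · refine (Finset.sum_le_card_nsmul _ _ B fun j _ => hF j).trans (le_of_eq ?_)
    rw [Nat.card_Icc, nsmul_eq_mul, show j₀ + 2 + 1 - j₀ = 3 by omega]; rfl
  · intro j hj
    refine h0 j ?_
    rw [Finset.mem_Icc, not_and_or, not_le, not_le] at hj
    rcases hj with hj | hj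
    · exact not_not.1 (Nat.find_min hall hj)
    · obtain ⟨J, rfl⟩ : ∃ J, j = J + 1 := ⟨j - 1, by omega⟩
      rw [symPiece]
      split_ifs
      · change _ * lpPiece (J + 1) (castZ ξ) = 0
        rw [lpPiece_eq_zero_of_lt, mul_zero]
        intro l
        have h1 : |castZ ξ l| ≤ 2 ^ (j₀ + 1) := by
          rw [castZ, ← Int.cast_abs]; exact_mod_cast hup l
        exact h1.trans (pow_le_pow_right₀ (by norm_num) (by omega))
      · rfl

/-- The dyadic pieces of a symbol in the class `S^{-m}_{ρ}` of limited regularity. -/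
theorem exists_symFam {σ : (Fin n → ℝ) → ℂ} (hσ : ContDiff ℝ (⊤ : ℕ∞) σ)
    {C m ρ : ℝ} (hC : 0 < C) (hm : 0 ≤ m) (hρ0 : 0 ≤ ρ) (hρ : ρ ≤ 1)
    (hbd : ∀ l, ∀ i ≤ n / 2 + 1, ∀ x, ‖(pd l)^[i] σ x‖ ≤ C * jbR x ^ (-m - ρ * i)) (hn : 1 ≤ n) :
    ∃ L : ℝ, 0 < L ∧ ∀ K, SymFam n ρ m L K (symPiece σ K) := by
  set N := n / 2 + 1 with hN
  obtain ⟨M, hM1, hM⟩ := exists_norm_iteratedDeriv_chi1_le N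
  set A : ℝ := 2 ^ N * (C * 2 ^ (m + N) * (2 * M * 2 ^ N)) with hA
  have hA0 : 0 < A := by positivity
  set c : ℝ := 5 + 2 * N with hc
  have hc1 : 1 ≤ c := by
    have : (0 : ℝ) ≤ N := by positivity
    linarith
  have hcn : 0 < c ^ n := by positivity
  have hline := norm_iteratedDeriv_piece_le hσ hC.le hm hρ0 hρ hbd (by linarith) hM
  have hbound : ∀ K j ξ, ‖symPiece σ K j ξ‖ ≤ A * 2 ^ (-(j * m)) := by
    intro K j ξ
    rw [symPiece]
    split_ifs
    · have := hline j (castZ ξ) ⟨0, hn⟩ (Nat.zero_le N) (castZ ξ ⟨0, hn⟩)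
      simpa using this
    · rw [Pi.zero_apply, norm_zero]; positivity
  have h2j : ∀ j : ℕ, (1 : ℝ) ≤ 2 ^ j := fun j => one_le_pow₀ (by norm_num)
  refine ⟨(3 + c ^ n) * A, by positivity, fun K => ⟨fun j => ?_, fun j hj => ?_, fun j ξ h l => ?_,
    fun ξ => ?_, fun j => ?_, fun j l => ?_⟩⟩
  · refine (Fintype.piFinset fun _ : Fin n =>
      Finset.Icc (-((2 ^ (j + 1) : ℕ) : ℤ)) ((2 ^ (j + 1) : ℕ) : ℤ)).finite_toSet.subset ?_
    intro ξ hξ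
    simp only [Finset.mem_coe, Fintype.mem_piFinset, Finset.mem_Icc, ← abs_le]
    intro l
    by_contra hcon
    exact hξ (symPiece_eq_zero_of_lt (not_le.1 hcon))
  · rw [symPiece, if_neg (by omega)]
  · by_contra hcon
    refine h (symPiece_eq_zero_of_lt (l := l) ?_)
    rw [not_le, ← Int.cast_abs] at hcon
    exact_mod_cast hcon
  · refine (tsum_overlap_le (σ := σ) (K := K) (ξ := ξ) (B := ENNReal.ofReal A) (fun j => ?_)
      fun j hj => by simp [hj]).trans ?_
    · have h1 : ‖symPiece σ K j ξ‖ₑ ≤ ENNReal.ofReal A * E2 (-(j * m)) := by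
        rw [← ofReal_mul_two_rpow hA0.le, ← ofReal_norm]
        exact ENNReal.ofReal_le_ofReal (hbound K j ξ)
      refine (mul_le_mul' le_rfl h1).trans (le_of_eq ?_)
      rw [mul_left_comm, mul_comm (E2 _), E2_neg_mul_self, mul_one]
    · rw [show (3 : ℝ≥0∞) = ENNReal.ofReal 3 by simp, ← ENNReal.ofReal_mul (by norm_num)]
      exact ENNReal.ofReal_le_ofReal (mul_le_mul_of_nonneg_right (by linarith) hA0.le)
  · refine tsum_enorm_sq_le_of_decay (R := 2 ^ (j + 1)) hA0.le hc1 ?_ (hbound K j)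
      (fun ξ l h => symPiece_eq_zero_of_lt h) (by nlinarith)
    push_cast
    rw [pow_succ]
    have : (0 : ℝ) ≤ N := by positivity
    nlinarith [h2j j]
  · have key := tsum_enorm_sq_le_of_decay (b := (dd l)^[N] (symPiece σ K j))
      (R := 2 ^ (j + 1) + N) (j := j) (A := A) (c := c) (e := m + ρ * N)
      (L := (3 + c ^ n) * A) hA0.le hc1 ?_ (fun ξ => ?_)
      (fun ξ l' h => dd_iterate_eq_zero l (fun ξ l' h => symPiece_eq_zero_of_lt h) N ξ l' h)
      (by nlinarith)
    · refine key.trans (le_of_eq ?_)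
      rw [sub_sub]
    · push_cast
      rw [pow_succ]
      have : (0 : ℝ) ≤ N := by positivity
      nlinarith [h2j j, mul_nonneg this (sub_nonneg.2 (h2j j))]
    · rw [symPiece]
      split_ifs
      · exact norm_dd_iterate_le l (G := fun x => σ x * lpPiece j x)
          (hσ.mul (contDiff_lpPiece j)) N ξ fun t => hline j (castZ ξ) l le_rfl t
      · have h0 : dd l (0 : (Fin n → ℤ) → ℂ) = 0 := by ext; simp [dd]
        rw [Function.iterate_fixed h0, Pi.zero_apply, norm_zero]
        positivity

end pieces

section duality

variable {n : ℕ}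

lemma SymFam.exists_lintegral_mult_rpow_le_of_two_le (hn : 1 ≤ n) {ρ m L p : ℝ} (hρ0 : 0 ≤ ρ)
    (hρ : ρ ≤ 1) (hL : 0 < L) (hp : 2 ≤ p) (hm : p * m = (p - 2) * (n * (1 - ρ) / 2)) :
    ∃ C : ℝ≥0∞, C ≠ ∞ ∧ ∀ K a, SymFam n ρ m L K a → ∀ f, Bdd f →
      ∫⁻ x, ‖mult (∑ j ∈ Finset.range K, a j) f x‖ₑ ^ p ∂μT n ≤
        C * ∫⁻ x, ‖f x‖ₑ ^ p ∂μT n := by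
  obtain rfl | hp := hp.eq_or_lt
  · have hm0 : m = 0 := by linarith
    refine ⟨ENNReal.ofReal L ^ 2, by finiteness, fun K a h f hf => ?_⟩
    simp_rw [ENNReal.rpow_ofNat]
    exact lintegral_mult_sq_le (h.support_sum_finite _) hf (h.enorm_sum_le hm0.ge _)
  · exact SymFam.exists_lintegral_mult_rpow_le hn hρ0 hρ hL hp hm

lemma fc_comp_neg {g : (Fin n → ℝ) → ℂ} (hg : ZPer g) (ξ : Fin n → ℤ) :
    fc (fun x => g (-x)) ξ = ∫ x, eChar x ξ * g x ∂μT n := by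
  rw [fc_eq]
  refine integral_cube_neg (F := fun x => eChar x ξ * g x) fun x v => ?_
  simp only [hg x v, show eChar (x + fun j => (v j : ℝ)) ξ = eChar x ξ from zPer_eChar ξ x v]

lemma Bdd.comp_neg {g : (Fin n → ℝ) → ℂ} (hg : Bdd g) : Bdd fun x => g (-x) :=
  ⟨hg.meas.comp measurable_neg, hg.bound.imp fun _ h _ => h _⟩

lemma integral_mult_mul {a : (Fin n → ℤ) → ℂ} (ha : a.support.Finite) {f g : (Fin n → ℝ) → ℂ}
    (hf : Bdd f) (hg : Bdd g) (hper : ZPer g) :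
    ∫ x, mult a f x * g x ∂μT n = ∫ x, f x * mult a (fun y => g (-y)) (-x) ∂μT n := by
  have hs (u : (Fin n → ℝ) → ℂ) : (fun ξ => a ξ * fc u ξ).support ⊆ ha.toFinset := by
    simp only [Set.Finite.coe_toFinset]
    exact Function.support_mul_subset_left _ _
  have h1 (x : Fin n → ℝ) : mult a f x * g x =
      ∑ ξ ∈ ha.toFinset, a ξ * fc f ξ * (eChar x ξ * g x) := by
    rw [mult, trig_eq_sum (hs f), Finset.sum_mul]
    exact Finset.sum_congr rfl fun _ _ => by ring
  have h2 (x : Fin n → ℝ) : f x * mult a (fun y => g (-y)) (-x) =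
      ∑ ξ ∈ ha.toFinset, a ξ * fc (fun y => g (-y)) ξ * (eChar (-x) ξ * f x) := by
    rw [mult, trig_eq_sum (hs _), Finset.mul_sum]
    exact Finset.sum_congr rfl fun _ _ => by ring
  simp_rw [h1, h2]
  rw [integral_finsetSum _ fun ξ _ => (bdd_mul (bdd_eChar ξ) hg).integrable.const_mul _,
    integral_finsetSum _ fun ξ _ => (bdd_mul (bdd_eChar_neg ξ) hf).integrable.const_mul _]
  refine Finset.sum_congr rfl fun ξ _ => ?_
  rw [integral_const_mul, integral_const_mul, ← fc_eq, fc_comp_neg hper]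
  ring

/-- The function `conj h · |h|^{p-2}`, which pairs with `h` to give `|h|^p`. -/
def dualFn (p : ℝ) (h : (Fin n → ℝ) → ℂ) (x : Fin n → ℝ) : ℂ :=
  (starRingEnd ℂ) (h x) * ((‖h x‖ ^ (p - 2) : ℝ) : ℂ)

lemma norm_dualFn {p : ℝ} (hp : 1 < p) (h : (Fin n → ℝ) → ℂ) (x : Fin n → ℝ) :
    ‖dualFn p h x‖ = ‖h x‖ ^ (p - 1) := by
  rw [dualFn, norm_mul, RCLike.norm_conj, Complex.norm_real, Real.norm_of_nonneg (by positivity)]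
  obtain h0 | h0 := (norm_nonneg (h x)).eq_or_lt
  · rw [← h0, zero_mul, Real.zero_rpow (by linarith)]
  · rw [← Real.rpow_one_add' h0.le (by linarith)]
    congr 1; ring

lemma mul_dualFn {p : ℝ} (hp : 1 < p) (h : (Fin n → ℝ) → ℂ) (x : Fin n → ℝ) :
    h x * dualFn p h x = ((‖h x‖ ^ p : ℝ) : ℂ) := by
  rw [dualFn, ← mul_assoc, Complex.mul_conj, Complex.normSq_eq_norm_sq, ← Complex.ofReal_mul]
  congr 1
  obtain h0 | h0 := (norm_nonneg (h x)).eq_or_lt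
  · rw [← h0, Real.zero_rpow (x := p) (by linarith)]; simp
  · rw [← Real.rpow_natCast, ← Real.rpow_add h0]
    congr 1; push_cast; ring

lemma Bdd.dualFn {p : ℝ} (hp : 1 < p) {h : (Fin n → ℝ) → ℂ} (hh : Bdd h) : Bdd (dualFn p h) := by
  obtain ⟨B, hB⟩ := hh.bound
  refine ⟨?_, B ^ (p - 1), fun x => ?_⟩
  · exact (Complex.continuous_conj.measurable.comp hh.meas).mul
      (Complex.measurable_ofReal.comp (hh.meas.norm.pow_const _))
  · rw [norm_dualFn hp]
    exact Real.rpow_le_rpow (norm_nonneg _) (hB x) (by linarith)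

lemma Bdd.lintegral_rpow_ne_top {p : ℝ} (hp : 0 ≤ p) {h : (Fin n → ℝ) → ℂ} (hh : Bdd h) :
    ∫⁻ x, ‖h x‖ₑ ^ p ∂μT n ≠ ∞ := by
  obtain ⟨B, hB⟩ := hh.bound
  have hle : ∫⁻ x, ‖h x‖ₑ ^ p ∂μT n ≤ ∫⁻ _, ENNReal.ofReal B ^ p ∂μT n :=
    lintegral_mono fun x => ENNReal.rpow_le_rpow
      (by rw [← ofReal_norm]; exact ENNReal.ofReal_le_ofReal (hB x)) hp
  refine ne_top_of_le_ne_top ?_ hle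
  rw [lintegral_const, measure_univ, mul_one]
  finiteness

lemma lintegral_mult_rpow_le_of_conj {p q : ℝ} (hpq : p.HolderConjugate q) {D : ℝ≥0∞}
    {a : (Fin n → ℤ) → ℂ} (ha : a.support.Finite)
    (hD : ∀ g, Bdd g → ∫⁻ x, ‖mult a g x‖ₑ ^ q ∂μT n ≤ D * ∫⁻ x, ‖g x‖ₑ ^ q ∂μT n)
    {f : (Fin n → ℝ) → ℂ} (hf : Bdd f) :
    ∫⁻ x, ‖mult a f x‖ₑ ^ p ∂μT n ≤ D ^ (p / q) * ∫⁻ x, ‖f x‖ₑ ^ p ∂μT n := by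
  have hp := hpq.lt
  have hp0 := hpq.pos
  have hq0 := hpq.symm.pos
  set h := mult a f with hh
  have hhb : Bdd h := bdd_mult ha f
  have hhper : ZPer h := zPer_mult a f
  have hgb : Bdd (dualFn p h) := hhb.dualFn hp
  have hgper : ZPer (dualFn p h) := fun x v => by simp only [dualFn, hhper x v]
  set X := ∫⁻ x, ‖h x‖ₑ ^ p ∂μT n with hX
  have hXtop : X ≠ ∞ := hhb.lintegral_rpow_ne_top hp0.le
  have hg : ∫⁻ x, ‖dualFn p h (-x)‖ₑ ^ q ∂μT n = X := by
    rw [lintegral_cube_neg (F := fun x => ‖dualFn p h x‖ₑ ^ q)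
      fun x v => by simp only [hgper x v]]
    refine lintegral_congr fun x => ?_
    rw [← ofReal_norm, norm_dualFn hp, ← ENNReal.ofReal_rpow_of_nonneg (norm_nonneg _)
      (by linarith), ofReal_norm, ← ENNReal.rpow_mul, hpq.sub_one_mul_conj]
  have hT : ∫⁻ x, ‖mult a (fun y => dualFn p h (-y)) (-x)‖ₑ ^ q ∂μT n ≤ D * X := by
    rw [lintegral_cube_neg (F := fun x => ‖mult a (fun y => dualFn p h (-y)) x‖ₑ ^ q)
      fun x v => by simp only [zPer_mult a _ x v], ← hg]
    exact hD _ hgb.comp_neg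
  have hpair : X = ‖∫ x, h x * dualFn p h x ∂μT n‖ₑ := by
    simp_rw [mul_dualFn hp]
    rw [integral_complex_ofReal, ← ofReal_norm, Complex.norm_real, ofReal_norm,
      Real.enorm_of_nonneg (integral_nonneg fun x => by positivity),
      integral_eq_lintegral_of_nonneg_ae (.of_forall fun x => by positivity)
        (hhb.meas.norm.pow_const p).aestronglyMeasurable]
    simp_rw [← ENNReal.ofReal_rpow_of_nonneg (norm_nonneg _) hp0.le, ofReal_norm]
    rw [ENNReal.ofReal_toReal hXtop]
  have hmain : X ≤ (∫⁻ x, ‖f x‖ₑ ^ p ∂μT n) ^ (1 / p) * (D * X) ^ (1 / q) := by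
    conv_lhs => rw [hpair, hh, integral_mult_mul ha hf hgb hgper]
    refine (enorm_integral_le_lintegral_enorm _).trans ?_
    simp_rw [enorm_mul]
    refine (ENNReal.lintegral_mul_le_Lp_mul_Lq (μT n) hpq hf.meas.enorm.aemeasurable
      ((bdd_mult ha _).comp_neg.meas.enorm.aemeasurable)).trans ?_
    exact mul_le_mul' le_rfl (ENNReal.rpow_le_rpow hT (by positivity))
  obtain h0 | h0 := eq_or_ne X 0
  · rw [h0]; exact zero_le
  have hXq0 : X ^ (1 / q) ≠ 0 := by simp [h0, hXtop]
  have hXqt : X ^ (1 / q) ≠ ∞ := ENNReal.rpow_ne_top_of_nonneg (by positivity) hXtop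
  have hsplit : X = X ^ (1 / p) * X ^ (1 / q) := by
    rw [← ENNReal.rpow_add _ _ h0 hXtop, one_div, one_div, hpq.inv_add_inv_eq_one,
      ENNReal.rpow_one]
  rw [ENNReal.mul_rpow_of_nonneg _ _ (by positivity), ← mul_assoc] at hmain
  conv_lhs at hmain => rw [hsplit]
  have hroot := (ENNReal.mul_le_mul_iff_left hXq0 hXqt).1 hmain
  have := ENNReal.rpow_le_rpow hroot hp0.le
  rw [ENNReal.mul_rpow_of_nonneg _ _ hp0.le, ← ENNReal.rpow_mul, ← ENNReal.rpow_mul,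
    ← ENNReal.rpow_mul, one_div_mul_cancel hp0.ne', ENNReal.rpow_one, ENNReal.rpow_one,
    mul_comm, one_div, inv_mul_eq_div] at this
  exact this

end duality

section limit

variable {n : ℕ}

lemma mult_eq_zero_of_not_summable {s : (Fin n → ℤ) → ℂ} {f : (Fin n → ℝ) → ℂ}
    (h : ¬ Summable fun ξ => s ξ * fc f ξ) : mult s f = 0 := by
  ext x
  refine tsum_eq_zero_of_not_summable fun hs => h ?_
  rw [← summable_norm_iff] at hs ⊢
  simpa using hs

lemma tendsto_mult {s : (Fin n → ℤ) → ℂ} {a : ℕ → (Fin n → ℤ) → ℂ} {f : (Fin n → ℝ) → ℂ}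
    (h : Summable fun ξ => s ξ * fc f ξ) (hle : ∀ K ξ, ‖a K ξ‖ ≤ ‖s ξ‖)
    (hlim : ∀ ξ, ∀ᶠ K in Filter.atTop, a K ξ = s ξ) (x : Fin n → ℝ) :
    Filter.Tendsto (fun K => mult (a K) f x) Filter.atTop (nhds (mult s f x)) := by
  refine tendsto_tsum_of_dominated_convergence h.norm (fun ξ => ?_)
    (.of_forall fun K ξ => ?_)
  · exact Filter.Tendsto.congr' ((hlim ξ).mono fun K hK => by simp only [hK]) tendsto_const_nhds
  · rw [norm_mul, norm_eChar, mul_one, norm_mul, norm_mul]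
    exact mul_le_mul_of_nonneg_right (hle K ξ) (norm_nonneg _)

lemma lintegral_mult_rpow_le_of_approx {s : (Fin n → ℤ) → ℂ} {a : ℕ → (Fin n → ℤ) → ℂ}
    (ha : ∀ K, (a K).support.Finite) (hle : ∀ K ξ, ‖a K ξ‖ ≤ ‖s ξ‖)
    (hlim : ∀ ξ, ∀ᶠ K in Filter.atTop, a K ξ = s ξ) {p : ℝ} (hp : 0 < p)
    {f : (Fin n → ℝ) → ℂ} {B : ℝ≥0∞} (hB : ∀ K, ∫⁻ x, ‖mult (a K) f x‖ₑ ^ p ∂μT n ≤ B) :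
    Measurable (mult s f) ∧ ∫⁻ x, ‖mult s f x‖ₑ ^ p ∂μT n ≤ B := by
  by_cases h : Summable fun ξ => s ξ * fc f ξ
  · have ht := tendsto_mult h hle hlim
    refine ⟨measurable_of_tendsto_metrizable (fun K => (continuous_mult (ha K) f).measurable)
      (tendsto_pi_nhds.2 ht), ?_⟩
    have heq (x : Fin n → ℝ) : ‖mult s f x‖ₑ ^ p =
        Filter.liminf (fun K => ‖mult (a K) f x‖ₑ ^ p) Filter.atTop :=
      (((ENNReal.continuous_rpow_const.tendsto _).comp (ht x).enorm).liminf_eq).symm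
    simp_rw [heq]
    refine (lintegral_liminf_le fun K =>
      ((continuous_mult (ha K) f).measurable.enorm.pow_const p)).trans ?_
    exact Filter.liminf_le_of_frequently_le' (.of_forall hB)
  · rw [mult_eq_zero_of_not_summable h]
    exact ⟨measurable_zero, by simp [hp]⟩

lemma bdd_of_continuous_of_per {f : (Fin n → ℝ) → ℂ} (hf : Continuous f) (hper : Per f) :
    Bdd f := by
  obtain ⟨B, hB⟩ := (isCompact_univ_pi fun _ : Fin n => isCompact_Icc (a := (0 : ℝ)) (b := 1))
    |>.exists_bound_of_continuousOn hf.continuousOn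
  refine ⟨hf.measurable, B, fun x => ?_⟩
  have hx : f x = f fun l => Int.fract (x l) := by
    rw [← hper (fun l => Int.fract (x l)) fun l => ⌊x l⌋]
    congr 1; ext l
    simp [Int.fract_add_floor]
  rw [hx]
  exact hB _ fun l _ => ⟨Int.fract_nonneg _, (Int.fract_lt_one _).le⟩

lemma lpT_eq {p : ℝ} (hp : 0 ≤ p) {g : (Fin n → ℝ) → ℂ} (hg : Measurable g) :
    lpT n p g = (∫⁻ x, ‖g x‖ₑ ^ p ∂μT n).toReal ^ (1 / p) := by
  rw [lpT, integral_eq_lintegral_of_nonneg_ae (.of_forall fun x => by positivity)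
    (hg.norm.pow_const p).aestronglyMeasurable]
  simp_rw [← ENNReal.ofReal_rpow_of_nonneg (norm_nonneg _) hp, ofReal_norm]

lemma exists_lintegral_symPiece_rpow_le (hn : 1 ≤ n) {ρ p : ℝ} (hρ0 : 0 ≤ ρ) (hρ1 : ρ ≤ 1)
    (hp1 : 1 < p) {σ : (Fin n → ℝ) → ℂ} (hσ : ContDiff ℝ (⊤ : ℕ∞) σ) {C : ℝ} (hC : 0 < C)
    (hbd : ∀ l, ∀ i ≤ n / 2 + 1, ∀ x,
      ‖(pd l)^[i] σ x‖ ≤ C * jbR x ^ (-(n * (1 - ρ) * |1 / p - 1 / 2|) - ρ * i)) :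
    ∃ D : ℝ≥0∞, D ≠ ∞ ∧ ∀ K, (∑ j ∈ Finset.range K, symPiece σ K j).support.Finite ∧ ∀ f, Bdd f →
      ∫⁻ x, ‖mult (∑ j ∈ Finset.range K, symPiece σ K j) f x‖ₑ ^ p ∂μT n ≤
        D * ∫⁻ x, ‖f x‖ₑ ^ p ∂μT n := by
  have hp0 : 0 < p := by linarith
  have h1ρ : 0 ≤ 1 - ρ := by linarith
  obtain ⟨L, hL, hfam⟩ := exists_symFam hσ hC (by positivity) hρ0 hρ1 hbd hn
  obtain hp2 | hp2 := le_or_gt 2 p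
  · obtain ⟨D, hD, h⟩ := SymFam.exists_lintegral_mult_rpow_le_of_two_le hn hρ0 hρ1 hL hp2
      (m := n * (1 - ρ) * |1 / p - 1 / 2|) (by
        have : 1 / p ≤ 1 / 2 := one_div_le_one_div_of_le (by norm_num) hp2
        rw [abs_of_nonpos (by linarith)]
        field_simp
        ring)
    exact ⟨D, hD, fun K => ⟨(hfam K).support_sum_finite _, h K _ (hfam K)⟩⟩
  · have hpq := Real.HolderConjugate.conjExponent hp1
    set q := p.conjExponent with hq
    have hq0 := hpq.symm.pos
    have hinv : p⁻¹ = 1 - q⁻¹ := by linarith [hpq.inv_add_inv_eq_one]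
    have h2 : 1 / 2 < 1 / p := one_div_lt_one_div_of_lt hp0 hp2
    have hq2 : 2 ≤ q := by
      rw [one_div, one_div, hinv] at h2
      have : q⁻¹ ≤ 2⁻¹ := by linarith
      exact (inv_le_inv₀ hq0 (by norm_num)).1 this
    obtain ⟨D, hD, h⟩ := SymFam.exists_lintegral_mult_rpow_le_of_two_le hn hρ0 hρ1 hL hq2
      (m := n * (1 - ρ) * |1 / p - 1 / 2|) (by
        rw [abs_of_pos (by linarith), one_div p, hinv]
        field_simp
        ring)
    refine ⟨D ^ (p / q), ENNReal.rpow_ne_top_of_nonneg (by positivity) hD, fun K =>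
      ⟨(hfam K).support_sum_finite _, fun f hf => ?_⟩⟩
    exact lintegral_mult_rpow_le_of_conj hpq ((hfam K).support_sum_finite _)
      (fun g hg => h K _ (hfam K) g hg) hf

end limit

/-- If a smooth symbol `σ₁ : ℝⁿ → ℂ` satisfies `|∂_ξ^α σ₁(ξ)| ≤ C ⟨ξ⟩^{-m_p - ρ|α|}` for
`|α| ≤ [n/2]+1`, with `m_p = n(1-ρ)|1/p - 1/2|`, then the periodic Fourier multiplier with
symbol `σ₁|_{ℤⁿ}` is bounded on `L^p(𝕋ⁿ)`, `1 < p < ∞`. -/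
theorem periodic_multiplier_fefferman_Lp_bounded
    (n : ℕ) (hn : 1 ≤ n) (ρ p : ℝ)
    (hρ0 : 0 ≤ ρ) (hρ1 : ρ ≤ 1) (hp1 : 1 < p)
    (σ₁ : (Fin n → ℝ) → ℂ)
    (hσ_smooth : ContDiff ℝ (⊤ : ℕ∞) σ₁)
    (C : ℝ) (hC : 0 < C)
    (hσ : ∀ α : Fin n → ℕ, (∑ j, α j) ≤ n / 2 + 1 →
      ∀ ξ : Fin n → ℝ,
        ‖pdM α σ₁ ξ‖ ≤
          C * jbR ξ ^ (-((n : ℝ) * (1 - ρ) * |1 / p - 1 / 2|) - ρ * ∑ j, (α j : ℝ))) :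
    ∃ C' : ℝ, 0 < C' ∧ ∀ f : (Fin n → ℝ) → ℂ, ContDiff ℝ (⊤ : ℕ∞) f → Per f →
      lpT n p (Op (fun _ ξ => σ₁ (castZ ξ)) f) ≤ C' * lpT n p f := by
  have hp0 : 0 < p := by linarith
  obtain ⟨D, hD, hbound⟩ := exists_lintegral_symPiece_rpow_le hn hρ0 hρ1 hp1 hσ_smooth hC
    fun l i hi x => by
      have h := hσ (Pi.single l i) (by simpa using hi) x
      rwa [pdM_single, ← Nat.cast_sum, Fintype.sum_pi_single'] at h
  refine ⟨D.toReal ^ (1 / p) + 1, by positivity, fun f hf hper => ?_⟩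
  have hfb := bdd_of_continuous_of_per hf.continuous hper
  have hop : Op (fun _ ξ => σ₁ (castZ ξ)) f = mult (fun ξ => σ₁ (castZ ξ)) f := by
    ext x
    exact tsum_congr fun ξ => by ring
  have hsum (K : ℕ) : (fun ξ => σ₁ (castZ ξ) * chi K (castZ ξ)) =
      ∑ j ∈ Finset.range (K + 1), symPiece σ₁ (K + 1) j :=
    (funext fun ξ => sum_symPiece σ₁ K ξ).symm
  have hlim (ξ : Fin n → ℤ) :
      ∀ᶠ K in Filter.atTop, σ₁ (castZ ξ) * chi K (castZ ξ) = σ₁ (castZ ξ) := by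
    have hlarge : ∀ᶠ K : ℕ in Filter.atTop, ∀ l, |castZ ξ l| ≤ (2 : ℝ) ^ K := by
      rw [Filter.eventually_all]
      exact fun l => (_root_.tendsto_pow_atTop_atTop_of_one_lt (r := (2 : ℝ))
        one_lt_two).eventually_ge_atTop _
    filter_upwards [hlarge] with K hK
    rw [chi_eq_one hK, mul_one]
  obtain ⟨hmeas, hle⟩ := lintegral_mult_rpow_le_of_approx
    (a := fun K ξ => σ₁ (castZ ξ) * chi K (castZ ξ)) (B := D * ∫⁻ x, ‖f x‖ₑ ^ p ∂μT n)
    (fun K => by rw [hsum]; exact (hbound (K + 1)).1)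
    (fun K ξ => by
      rw [norm_mul]
      exact mul_le_of_le_one_right (norm_nonneg _) (norm_chi_le K _))
    hlim hp0 (fun K => by rw [hsum]; exact (hbound (K + 1)).2 f hfb)
  have hfin : ∫⁻ x, ‖f x‖ₑ ^ p ∂μT n ≠ ∞ := hfb.lintegral_rpow_ne_top hp0.le
  rw [hop, lpT_eq hp0.le hmeas, lpT_eq hp0.le hfb.meas]
  have h := ENNReal.toReal_mono (ENNReal.mul_ne_top hD hfin) hle
  rw [ENNReal.toReal_mul] at h
  refine (Real.rpow_le_rpow toReal_nonneg h (by positivity)).trans ?_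
  rw [Real.mul_rpow toReal_nonneg toReal_nonneg]
  exact mul_le_mul_of_nonneg_right (by linarith) (by positivity)
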